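/- For every integer n ≥ 1, the algebra Γ(n) over an algebraically closed field k is τ-tilting finite. -/

import Mathlib

open MulOpposite CategoryTheory CategoryTheory.Limits

noncomputable section

/-- A submodule `N ≤ M` is superfluous if `N ⊔ K = ⊤` implies `K = ⊤`. -/
def SuperfluousSubmodule {R M : Type} [Ring R] [AddCommGroup M] [Module R M]
    (N : Submodule R M) : Prop :=
  ∀ K : Submodule R M, N ⊔ K = ⊤ → K = ⊤

section TauTilting

variable (k : Type) [Field k]
variable (B : Type) [Ring B] [Algebra k B]

/-- A minimal projective presentation `P1 → P0 → M → 0` of a right `B`-module `M`. -/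
def IsMinimalProjPresentation (M P1 P0 : ModuleCat.{0} Bᵐᵒᵖ)
    (f : P1 →ₗ[Bᵐᵒᵖ] P0) (g : P0 →ₗ[Bᵐᵒᵖ] M) : Prop :=
  Module.Projective Bᵐᵒᵖ P1 ∧ Module.Projective Bᵐᵒᵖ P0 ∧
    Function.Surjective g ∧ LinearMap.range f = LinearMap.ker g ∧
    SuperfluousSubmodule (LinearMap.ker g) ∧ SuperfluousSubmodule (LinearMap.ker f)

/-- Left multiplication by `b` on the left `B`-module `Hom_B(P, B)` of a right module `P`. -/
def leftMulHom {P : Type} [AddCommGroup P] [Module Bᵐᵒᵖ P] (b : B)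
    (h : P →ₗ[Bᵐᵒᵖ] B) : P →ₗ[Bᵐᵒᵖ] B where
  toFun p := b * h p
  map_add' x y := by simp [mul_add]
  map_smul' r p := by
    simp only [map_smul, RingHom.id_apply]
    rw [MulOpposite.smul_eq_mul_unop, MulOpposite.smul_eq_mul_unop, mul_assoc]

/-- `M` is τ-rigid:  `Hom_B(M, τM) = 0`, where `τM = D(Tr M)` is computed from a minimal
projective presentation `P1 --f--> P0 → M → 0`, `Tr M = coker(Hom(P0,B) → Hom(P1,B))`, and
`D = Hom_k(-, k)`.  A right-module map `M → D(Tr M)` is encoded as an additive map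
`β : M →+ Hom_k(Hom_B(P1, B), k)` which is balanced (`β (m·b) = β m (b·-)`) and vanishes on
the image of `Hom(P0,B)`, i.e. descends to the cokernel `Tr M`. -/
def IsTauRigid (M : ModuleCat.{0} Bᵐᵒᵖ) : Prop :=
  ∀ (P1 P0 : ModuleCat.{0} Bᵐᵒᵖ) (f : P1 →ₗ[Bᵐᵒᵖ] P0) (g : P0 →ₗ[Bᵐᵒᵖ] M),
    IsMinimalProjPresentation B M P1 P0 f g →
    ∀ β : M →+ ((P1 →ₗ[Bᵐᵒᵖ] B) →ₗ[k] k),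
      (∀ (m : M) (b : B) (h : P1 →ₗ[Bᵐᵒᵖ] B),
        β (op b • m) h = β m (leftMulHom B b h)) →
      (∀ (m : M) (g0 : P0 →ₗ[Bᵐᵒᵖ] B), β m (g0.comp f) = 0) →
      β = 0

/-- A module is indecomposable if it is nonzero and admits no nontrivial direct sum
decomposition. -/
def IndecomposableMod (M : ModuleCat.{0} Bᵐᵒᵖ) : Prop :=
  Nontrivial M ∧ ∀ (L L' : ModuleCat.{0} Bᵐᵒᵖ),
    Nonempty (M ≃ₗ[Bᵐᵒᵖ] (L × L')) → Subsingleton L ∨ Subsingleton L'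

/-- A module is basic (multiplicity-free) if it has no repeated direct summand. -/
def IsBasicMod (M : ModuleCat.{0} Bᵐᵒᵖ) : Prop :=
  ∀ (L C : ModuleCat.{0} Bᵐᵒᵖ),
    Nonempty (M ≃ₗ[Bᵐᵒᵖ] (L × L × C)) → Subsingleton L

/-- `L` is an indecomposable direct summand of `M`. -/
def IsIndecSummand (L M : ModuleCat.{0} Bᵐᵒᵖ) : Prop :=
  IndecomposableMod B L ∧ ∃ L' : ModuleCat.{0} Bᵐᵒᵖ, Nonempty (M ≃ₗ[Bᵐᵒᵖ] (L × L'))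

/-- The rank of the Grothendieck group `K_0(B)` is `n`, i.e. there are exactly `n`
isomorphism classes of simple right `B`-modules. -/
def RankK0Is (n : ℕ) : Prop :=
  ∃ S : Fin n → ModuleCat.{0} Bᵐᵒᵖ,
    (∀ i, IsSimpleModule Bᵐᵒᵖ (S i)) ∧
    (∀ i j, i ≠ j → IsEmpty ((S i) ≃ₗ[Bᵐᵒᵖ] (S j))) ∧
    (∀ T : ModuleCat.{0} Bᵐᵒᵖ, IsSimpleModule Bᵐᵒᵖ T → ∃ i, Nonempty (T ≃ₗ[Bᵐᵒᵖ] S i))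

/-- The number of isomorphism classes of indecomposable direct summands of `M` is `n`. -/
def NumIndecSummandsIs (M : ModuleCat.{0} Bᵐᵒᵖ) (n : ℕ) : Prop :=
  ∃ N : Fin n → ModuleCat.{0} Bᵐᵒᵖ,
    (∀ i, IsIndecSummand B (N i) M) ∧
    (∀ i j, i ≠ j → IsEmpty ((N i) ≃ₗ[Bᵐᵒᵖ] (N j))) ∧
    (∀ L, IsIndecSummand B L M → ∃ i, Nonempty (L ≃ₗ[Bᵐᵒᵖ] N i))

/-- `M` is a τ-tilting module over `B`: it is a finitely generated τ-rigid module whose number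
of non-isomorphic indecomposable direct summands equals the rank of `K_0(B)`. -/
def IsTauTiltingMod (M : ModuleCat.{0} Bᵐᵒᵖ) : Prop :=
  Module.Finite Bᵐᵒᵖ M ∧ IsTauRigid k B M ∧
    ∃ n : ℕ, NumIndecSummandsIs B M n ∧ RankK0Is B n

end TauTilting

section Support

variable (k : Type) [Field k]
variable (A : Type) [Ring A] [Algebra k A]

/-- The quotient of `A` by the two-sided ideal `AeA` generated by `e`. -/
def IdemQuot (e : A) : Type := ((TwoSidedIdeal.span {e}).ringCon).Quotient

instance (e : A) : Ring (IdemQuot A e) :=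
  inferInstanceAs (Ring ((TwoSidedIdeal.span {e}).ringCon).Quotient)

/-- The quotient map `A → A/AeA`. -/
def IdemQuot.mk (e : A) : A →+* IdemQuot A e := RingCon.mk' _

instance (e : A) : Algebra k (IdemQuot A e) :=
  RingHom.toAlgebra' ((IdemQuot.mk A e).comp (algebraMap k A)) (by
    intro c x
    induction x using Quotient.ind with
    | _ a =>
      show (IdemQuot.mk A e) (algebraMap k A c) * (IdemQuot.mk A e) a
          = (IdemQuot.mk A e) a * (IdemQuot.mk A e) (algebraMap k A c)
      rw [← map_mul, ← map_mul, Algebra.commutes])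

/-- `M` is a support τ-tilting module over `A`: there is an idempotent `e ∈ A` such that `M` is
(the restriction of) a τ-tilting module over `A/AeA`. -/
def IsSupportTauTilting (M : ModuleCat.{0} Aᵐᵒᵖ) : Prop :=
  ∃ e : A, IsIdempotentElem e ∧
    ∃ N : ModuleCat.{0} (IdemQuot A e)ᵐᵒᵖ,
      IsTauTiltingMod k (IdemQuot A e) N ∧
      letI : Module Aᵐᵒᵖ N := Module.compHom N (RingHom.op (IdemQuot.mk A e))
      Nonempty (M ≃ₛₗ[RingHom.id Aᵐᵒᵖ] N)

/-- `A` is τ-tilting finite: it admits only finitely many basic support τ-tilting modules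
up to isomorphism. -/
def TauTiltingFinite : Prop :=
  ∃ (n : ℕ) (R : Fin n → ModuleCat.{0} Aᵐᵒᵖ),
    ∀ M : ModuleCat.{0} Aᵐᵒᵖ, IsSupportTauTilting k A M → IsBasicMod A M →
      ∃ i, Nonempty (M ≃ₗ[Aᵐᵒᵖ] R i)

/-- `A` is representation-finite: it has only finitely many isomorphism classes of finitely
generated indecomposable right modules. -/
def RepresentationFinite : Prop :=
  ∃ (n : ℕ) (R : Fin n → ModuleCat.{0} Aᵐᵒᵖ),
    ∀ M : ModuleCat.{0} Aᵐᵒᵖ, Module.Finite Aᵐᵒᵖ M → IndecomposableMod A M →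
      ∃ i, Nonempty (M ≃ₗ[Aᵐᵒᵖ] R i)

end Support

section QuiverAlg
variable (k : Type) [Field k]

/-- The product in the path algebra of a word of arrows (paths are composed from left to
right, so the path `α₁α₂` corresponds to the product `α₁ * α₂`). -/
def arrWord {V E : Type} (l : List E) : FreeAlgebra k (V ⊕ E) :=
  (l.map (fun a => FreeAlgebra.ι k (Sum.inr a))).prod

/-- The defining relations of a bound quiver algebra `kQ/I`: the vertices `e_v` are orthogonal
idempotents summing to `1`, each arrow `a : u → v` satisfies `e_u a = a = a e_v`, and the
extra relations generating the admissible ideal `I` hold. -/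
def quivRel {V E : Type} [Fintype V] [DecidableEq V] (s t : E → V)
    (extra : FreeAlgebra k (V ⊕ E) → FreeAlgebra k (V ⊕ E) → Prop) :
    FreeAlgebra k (V ⊕ E) → FreeAlgebra k (V ⊕ E) → Prop := fun x y =>
  (∃ v w : V, x = FreeAlgebra.ι k (Sum.inl v) * FreeAlgebra.ι k (Sum.inl w) ∧
    y = if v = w then FreeAlgebra.ι k (Sum.inl v) else 0) ∨
  (x = ∑ v : V, FreeAlgebra.ι k (Sum.inl v) ∧ y = 1) ∨
  (∃ a : E, x = FreeAlgebra.ι k (Sum.inl (s a)) * FreeAlgebra.ι k (Sum.inr a) ∧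
    y = FreeAlgebra.ι k (Sum.inr a)) ∨
  (∃ a : E, x = FreeAlgebra.ι k (Sum.inr a) * FreeAlgebra.ι k (Sum.inl (t a)) ∧
    y = FreeAlgebra.ι k (Sum.inr a)) ∨
  extra x y

/-- The bound quiver algebra presented by a quiver `(V, E, s, t)` and extra relations. -/
def BoundQuiverAlg {V E : Type} [Fintype V] [DecidableEq V] (s t : E → V)
    (extra : FreeAlgebra k (V ⊕ E) → FreeAlgebra k (V ⊕ E) → Prop) : Type :=
  RingQuot (quivRel k s t extra)

instance {V E : Type} [Fintype V] [DecidableEq V] (s t : E → V)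
    (extra : FreeAlgebra k (V ⊕ E) → FreeAlgebra k (V ⊕ E) → Prop) :
    Ring (BoundQuiverAlg k s t extra) :=
  inferInstanceAs (Ring (RingQuot (quivRel k s t extra)))

instance {V E : Type} [Fintype V] [DecidableEq V] (s t : E → V)
    (extra : FreeAlgebra k (V ⊕ E) → FreeAlgebra k (V ⊕ E) → Prop) :
    Algebra k (BoundQuiverAlg k s t extra) :=
  inferInstanceAs (Algebra k (RingQuot (quivRel k s t extra)))

end QuiverAlg

section QuiverAlg
variable (k : Type) [Field k]

/-! ### The quiver `Δ(p,q,r)`: three oriented cycles glued at a common vertex `0` -/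

def TriV (p q r : ℕ) : Type :=
  Option ({i : ZMod p // i ≠ 0} ⊕ {j : ZMod q // j ≠ 0} ⊕ {l : ZMod r // l ≠ 0})

instance (p q r : ℕ) : DecidableEq (TriV p q r) :=
  inferInstanceAs (DecidableEq (Option
    ({i : ZMod p // i ≠ 0} ⊕ {j : ZMod q // j ≠ 0} ⊕ {l : ZMod r // l ≠ 0})))

instance (p q r : ℕ) [NeZero p] [NeZero q] [NeZero r] : Fintype (TriV p q r) :=
  inferInstanceAs (Fintype (Option
    ({i : ZMod p // i ≠ 0} ⊕ {j : ZMod q // j ≠ 0} ⊕ {l : ZMod r // l ≠ 0})))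

def TriE (p q r : ℕ) : Type := ZMod p ⊕ ZMod q ⊕ ZMod r

def triV1 (p q r : ℕ) (i : ZMod p) : TriV p q r :=
  if h : i = 0 then none else some (Sum.inl ⟨i, h⟩)
def triV2 (p q r : ℕ) (j : ZMod q) : TriV p q r :=
  if h : j = 0 then none else some (Sum.inr (Sum.inl ⟨j, h⟩))
def triV3 (p q r : ℕ) (l : ZMod r) : TriV p q r :=
  if h : l = 0 then none else some (Sum.inr (Sum.inr ⟨l, h⟩))

def triSrc (p q r : ℕ) : TriE p q r → TriV p q r
  | Sum.inl i => triV1 p q r i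
  | Sum.inr (Sum.inl j) => triV2 p q r j
  | Sum.inr (Sum.inr l) => triV3 p q r l

def triTgt (p q r : ℕ) : TriE p q r → TriV p q r
  | Sum.inl i => triV1 p q r (i + 1)
  | Sum.inr (Sum.inl j) => triV2 p q r (j + 1)
  | Sum.inr (Sum.inr l) => triV3 p q r (l + 1)

/-- The word `α_{s+1} ⋯ α_{s+len}` on the first cycle of `Δ(p,q,r)`. -/
def taw (p q r : ℕ) (st len : ℕ) : List (TriE p q r) :=
  (List.range len).map (fun u => Sum.inl ((st + u : ℕ) : ZMod p))
/-- The word `β_{s+1} ⋯ β_{s+len}` on the second cycle of `Δ(p,q,r)`. -/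
def tbw (p q r : ℕ) (st len : ℕ) : List (TriE p q r) :=
  (List.range len).map (fun u => Sum.inr (Sum.inl ((st + u : ℕ) : ZMod q)))
/-- The word `γ_{s+1} ⋯ γ_{s+len}` on the third cycle of `Δ(p,q,r)`. -/
def tgw (p q r : ℕ) (st len : ℕ) : List (TriE p q r) :=
  (List.range len).map (fun u => Sum.inr (Sum.inr ((st + u : ℕ) : ZMod r)))

section Tri
variable (p q r : ℕ)

/-- The relations `I₃(n)` of the algebra `Γ(n)` (on the quiver `Δ(2,2,n)`). -/
def GamRelExtra (n : ℕ) : FreeAlgebra k (TriV 2 2 n ⊕ TriE 2 2 n) →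
    FreeAlgebra k (TriV 2 2 n ⊕ TriE 2 2 n) → Prop := fun x y =>
  (x = arrWord k (taw 2 2 n 0 2) ∧ y = arrWord k (tgw 2 2 n 0 n ++ tgw 2 2 n 0 n)) ∨
  (x = arrWord k (tbw 2 2 n 0 2) ∧ y = arrWord k (tgw 2 2 n 0 n ++ tgw 2 2 n 0 n)) ∨
  (x = arrWord k (taw 2 2 n 1 1 ++ tgw 2 2 n 0 1) ∧ y = 0) ∨
  (x = arrWord k (tbw 2 2 n 1 1 ++ tgw 2 2 n 0 1) ∧ y = 0) ∨
  (x = arrWord k (tgw 2 2 n (n - 1) 1 ++ taw 2 2 n 0 1) ∧ y = 0) ∨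
  (x = arrWord k (tgw 2 2 n (n - 1) 1 ++ tbw 2 2 n 0 1) ∧ y = 0) ∨
  (x = arrWord k (taw 2 2 n 1 1 ++ tbw 2 2 n 0 1) ∧ y = 0) ∨
  (x = arrWord k (tbw 2 2 n 1 1 ++ taw 2 2 n 0 1) ∧ y = 0) ∨
  (∃ j : ℕ, 2 ≤ j ∧ j ≤ n - 1 ∧
    x = arrWord k (tgw 2 2 n (j - 1) (n - j + 1) ++ tgw 2 2 n 0 n ++ tgw 2 2 n 0 j) ∧
    y = 0)

/-- The algebra `Γ(n) = kΔ(2,2,n)/I₃(n)`. -/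
def GamAlg (n : ℕ) (_ : 0 < n) : Type :=
  haveI : NeZero n := ⟨by omega⟩
  BoundQuiverAlg k (triSrc 2 2 n) (triTgt 2 2 n) (GamRelExtra k n)

instance (n : ℕ) (hn : 0 < n) : Ring (GamAlg k n hn) :=
  haveI : NeZero n := ⟨by omega⟩
  inferInstanceAs (Ring (BoundQuiverAlg k (triSrc 2 2 n) (triTgt 2 2 n) (GamRelExtra k n)))

instance (n : ℕ) (hn : 0 < n) : Algebra k (GamAlg k n hn) :=
  haveI : NeZero n := ⟨by omega⟩
  inferInstanceAs (Algebra k (BoundQuiverAlg k (triSrc 2 2 n) (triTgt 2 2 n) (GamRelExtra k n)))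

/-- The relations `I₄(p,q,r)` of the algebra `T(p,q,r)`. -/
def TRelExtra : FreeAlgebra k (TriV p q r ⊕ TriE p q r) →
    FreeAlgebra k (TriV p q r ⊕ TriE p q r) → Prop := fun x y =>
  (x = arrWord k (taw p q r 0 p) ∧ y = arrWord k (tbw p q r 0 q)) ∨
  (x = arrWord k (tbw p q r 0 q) ∧ y = arrWord k (tgw p q r 0 r)) ∨
  (x = arrWord k (taw p q r (p - 1) 1 ++ tgw p q r 0 1) ∧ y = 0) ∨
  (x = arrWord k (tbw p q r (q - 1) 1 ++ tgw p q r 0 1) ∧ y = 0) ∨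
  (x = arrWord k (tgw p q r (r - 1) 1 ++ taw p q r 0 1) ∧ y = 0) ∨
  (x = arrWord k (tgw p q r (r - 1) 1 ++ tbw p q r 0 1) ∧ y = 0) ∨
  (x = arrWord k (taw p q r (p - 1) 1 ++ tbw p q r 0 1) ∧ y = 0) ∨
  (x = arrWord k (tbw p q r (q - 1) 1 ++ taw p q r 0 1) ∧ y = 0) ∨
  (∃ i : ℕ, 2 ≤ i ∧ i ≤ p - 1 ∧
    x = arrWord k (taw p q r (i - 1) (p - i + 1) ++ taw p q r 0 i) ∧ y = 0) ∨
  (∃ j : ℕ, 2 ≤ j ∧ j ≤ q - 1 ∧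
    x = arrWord k (tbw p q r (j - 1) (q - j + 1) ++ tbw p q r 0 j) ∧ y = 0) ∨
  (∃ l : ℕ, 2 ≤ l ∧ l ≤ r - 1 ∧
    x = arrWord k (tgw p q r (l - 1) (r - l + 1) ++ tgw p q r 0 l) ∧ y = 0)

/-- The algebra `T(p,q,r) = kΔ(p,q,r)/I₄(p,q,r)`. -/
def TAlg3 (_ : 0 < p) (_ : 0 < q) (_ : 0 < r) : Type :=
  haveI : NeZero p := ⟨by omega⟩
  haveI : NeZero q := ⟨by omega⟩
  haveI : NeZero r := ⟨by omega⟩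
  BoundQuiverAlg k (triSrc p q r) (triTgt p q r) (TRelExtra k p q r)

instance (hp : 0 < p) (hq : 0 < q) (hr : 0 < r) : Ring (TAlg3 k p q r hp hq hr) :=
  haveI : NeZero p := ⟨by omega⟩
  haveI : NeZero q := ⟨by omega⟩
  haveI : NeZero r := ⟨by omega⟩
  inferInstanceAs (Ring (BoundQuiverAlg k (triSrc p q r) (triTgt p q r) (TRelExtra k p q r)))

instance (hp : 0 < p) (hq : 0 < q) (hr : 0 < r) : Algebra k (TAlg3 k p q r hp hq hr) :=
  haveI : NeZero p := ⟨by omega⟩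
  haveI : NeZero q := ⟨by omega⟩
  haveI : NeZero r := ⟨by omega⟩
  inferInstanceAs (Algebra k
    (BoundQuiverAlg k (triSrc p q r) (triTgt p q r) (TRelExtra k p q r)))

end Tri
end QuiverAlg

section Generation

variable {R : Type} [Ring R]

/-- `L` is a sum of images of maps from `M`, i.e. `L` lies in `Fac M` up to finiteness. -/
def Generates (R M L : Type) [Ring R] [AddCommGroup M] [Module R M]
    [AddCommGroup L] [Module R L] : Prop :=
  (⨆ f : M →ₗ[R] L, LinearMap.range f) = ⊤

/-- `M` is projective relative to surjections whose kernel is generated by `M`. -/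
def RelProjective (R M : Type) [Ring R] [AddCommGroup M] [Module R M] : Prop :=
  ∀ (E L : Type) [AddCommGroup E] [Module R E] [AddCommGroup L] [Module R L]
    (p : E →ₗ[R] L), Function.Surjective p → Generates R M (LinearMap.ker p) →
    ∀ g : M →ₗ[R] L, ∃ h : M →ₗ[R] E, p ∘ₗ h = g

/-- A brick: every nonzero endomorphism is injective. -/
def Brick (R X : Type) [Ring R] [AddCommGroup X] [Module R X] : Prop :=
  Nontrivial X ∧ ∀ f : X →ₗ[R] X, f ≠ 0 → Function.Injective f

variable {M L X E : Type} [AddCommGroup M] [Module R M] [AddCommGroup L] [Module R L]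
  [AddCommGroup X] [Module R X] [AddCommGroup E] [Module R E]

theorem Generates.induction (h : Generates R M L) {P : L → Prop}
    (hf : ∀ (f : M →ₗ[R] L) m, P (f m)) (h0 : P 0) (hadd : ∀ x y, P x → P y → P (x + y))
    (x : L) : P x := by
  have hx : x ∈ ⨆ f : M →ₗ[R] L, LinearMap.range f := by rw [h]; trivial
  refine Submodule.iSup_induction _ (motive := P) hx ?_ h0 hadd
  rintro f _ ⟨m, rfl⟩
  exact hf f m

theorem map_mem_iSup_range (f : M →ₗ[R] L) (m : M) :
    f m ∈ ⨆ f : M →ₗ[R] L, LinearMap.range f :=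
  Submodule.mem_iSup_of_mem f ⟨m, rfl⟩

theorem generates_iff :
    Generates R M L ↔ ∀ x : L, x ∈ ⨆ f : M →ₗ[R] L, LinearMap.range f :=
  ⟨fun h x => by rw [h]; trivial, fun h => eq_top_iff.2 fun x _ => h x⟩

theorem Generates.of_surjective (f : M →ₗ[R] L) (hf : Function.Surjective f) :
    Generates R M L :=
  generates_iff.2 fun x => by
    obtain ⟨m, rfl⟩ := hf x
    exact map_mem_iSup_range f m

theorem Generates.map_mem (h : Generates R M L) (f : L →ₗ[R] X) (l : L) :
    f l ∈ ⨆ g : M →ₗ[R] X, LinearMap.range g :=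
  h.induction (P := fun l => f l ∈ ⨆ g : M →ₗ[R] X, LinearMap.range g)
    (fun g m => map_mem_iSup_range (f ∘ₗ g) m)
    (by rw [map_zero]; exact Submodule.zero_mem _)
    (fun x y hx hy => by rw [map_add]; exact Submodule.add_mem _ hx hy) l

theorem Generates.trans (h : Generates R M L) (h' : Generates R L X) : Generates R M X :=
  generates_iff.2 fun x =>
    h'.induction (P := fun x => x ∈ ⨆ f : M →ₗ[R] X, LinearMap.range f)
      (fun f l => h.map_mem f l) (Submodule.zero_mem _) (fun _ _ => Submodule.add_mem _) x

theorem Generates.refl : Generates R M M :=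
  Generates.of_surjective LinearMap.id Function.surjective_id

theorem Generates.quotient (h : Generates R M L) (p : L →ₗ[R] X) (hp : Function.Surjective p) :
    Generates R M X :=
  h.trans (Generates.of_surjective p hp)

theorem generates_trace :
    Generates R M (⨆ f : M →ₗ[R] L, LinearMap.range f : Submodule R L) := by
  rw [generates_iff]
  rintro ⟨x, hx⟩
  have key : ∀ x (hx : x ∈ ⨆ f : M →ₗ[R] L, LinearMap.range f),
      (⟨x, hx⟩ : (⨆ f : M →ₗ[R] L, LinearMap.range f : Submodule R L)) ∈
      ⨆ g : M →ₗ[R] (⨆ f : M →ₗ[R] L, LinearMap.range f : Submodule R L),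
        LinearMap.range g := by
    intro x hx
    refine Submodule.iSup_induction' (motive := fun x hx =>
      (⟨x, hx⟩ : (⨆ f : M →ₗ[R] L, LinearMap.range f : Submodule R L)) ∈
      ⨆ g : M →ₗ[R] (⨆ f : M →ₗ[R] L, LinearMap.range f : Submodule R L),
        LinearMap.range g) _ ?_ ?_ ?_ hx
    · rintro f _ ⟨m, rfl⟩
      exact map_mem_iSup_range (f.codRestrict _ (map_mem_iSup_range f)) m
    · exact Submodule.zero_mem _
    · intro x y hx hy h1 h2
      exact Submodule.add_mem _ h1 h2
  exact key x hx

theorem RelProjective.generates_ext (hM : RelProjective R M) (p : E →ₗ[R] L)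
    (hp : Function.Surjective p) (hk : Generates R M (LinearMap.ker p))
    (hL : Generates R M L) : Generates R M E := by
  rw [generates_iff]
  intro x
  have h1 : ∀ l : L, ∃ y ∈ ⨆ f : M →ₗ[R] E, LinearMap.range f, p y = l := by
    refine fun l => hL.induction (P := fun l => ∃ y ∈ ⨆ f : M →ₗ[R] E, LinearMap.range f, p y = l)
      ?_ ⟨0, Submodule.zero_mem _, map_zero _⟩ ?_ l
    · intro f m
      obtain ⟨h, rfl⟩ := hM E L p hp hk f
      exact ⟨h m, map_mem_iSup_range h m, rfl⟩
    · rintro _ _ ⟨y, hy, rfl⟩ ⟨z, hz, rfl⟩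
      exact ⟨y + z, Submodule.add_mem _ hy hz, map_add _ _ _⟩
  obtain ⟨y, hy, hxy⟩ := h1 (p x)
  have h2 : ∀ z : LinearMap.ker p, (z : E) ∈ ⨆ f : M →ₗ[R] E, LinearMap.range f := by
    intro z
    refine hk.induction (P := fun z : LinearMap.ker p =>
      (z : E) ∈ ⨆ f : M →ₗ[R] E, LinearMap.range f) ?_ (Submodule.zero_mem _) ?_ z
    · intro f m
      exact map_mem_iSup_range ((LinearMap.ker p).subtype ∘ₗ f) m
    · intro a b ha hb
      exact Submodule.add_mem _ ha hb
  have h3 := h2 ⟨x - y, by simp [hxy]⟩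
  have := Submodule.add_mem _ h3 hy
  simpa using this

/-- A torsion class of the form `Fac M` is determined by the bricks it contains. -/
theorem generates_of_bricks {M' : Type} [AddCommGroup M'] [Module R M']
    (hM' : RelProjective R M') [IsNoetherian R X] (hX : Generates R M X)
    (hb : ∀ (Y : Type) [AddCommGroup Y] [Module R Y], Module.Finite R Y → Brick R Y →
      Generates R M Y → Generates R M' Y) :
    Generates R M' X := by
  by_contra hcon
  obtain ⟨N, hN, hmax⟩ := set_has_maximal_iff_noetherian.2 ‹IsNoetherian R X›
    {N : Submodule R X | ¬ Generates R M' (X ⧸ N)}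
    ⟨⊥, fun h => hcon (h.quotient (Submodule.quotEquivOfEqBot ⊥ rfl).toLinearMap
      (LinearEquiv.surjective _))⟩
  have hMN : Generates R M (X ⧸ N) := hX.quotient N.mkQ N.mkQ_surjective
  have hquot : ∀ K : Submodule R (X ⧸ N), K ≠ ⊥ → Generates R M' ((X ⧸ N) ⧸ K) := by
    intro K hK
    have hlt : N < K.comap N.mkQ := by
      refine lt_of_le_of_ne (fun x hx => ?_) fun h => hK ?_
      · simp [(Submodule.Quotient.mk_eq_zero N).2 hx]
      · rw [eq_bot_iff]
        intro y hy
        obtain ⟨x, rfl⟩ := N.mkQ_surjective y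
        have : x ∈ N := by rw [h]; exact hy
        simpa using this
    by_contra hc
    refine hmax (K.comap N.mkQ) (fun hg => hc ?_) hlt
    refine hg.quotient ((K.comap N.mkQ).mapQ K N.mkQ le_rfl) ?_
    intro y
    obtain ⟨z, rfl⟩ := K.mkQ_surjective y
    obtain ⟨x, rfl⟩ := N.mkQ_surjective z
    exact ⟨Submodule.Quotient.mk x, rfl⟩
  have htr : (⨆ f : M' →ₗ[R] (X ⧸ N), LinearMap.range f) = ⊥ := by
    by_contra hne
    refine hN (hM'.generates_ext (Submodule.mkQ _) (Submodule.mkQ_surjective _) ?_ (hquot _ hne))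
    have := generates_trace (R := R) (M := M') (L := X ⧸ N)
    refine this.quotient (LinearEquiv.ofEq _ _ ?_).toLinearMap (LinearEquiv.surjective _)
    rw [Submodule.ker_mkQ]
  have hzero : ∀ f : M' →ₗ[R] (X ⧸ N), f = 0 := by
    intro f
    ext m
    have := map_mem_iSup_range f m
    rw [htr] at this
    simpa using this
  refine hN (hb (X ⧸ N) inferInstance ⟨?_, ?_⟩ hMN)
  · by_contra hnt
    rw [not_nontrivial_iff_subsingleton] at hnt
    exact hN (generates_iff.2 fun x => by
      rw [Subsingleton.elim x 0]; exact Submodule.zero_mem _)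
  · intro f hf
    rw [← LinearMap.ker_eq_bot]
    by_contra hk
    have h1 := (hquot _ hk).quotient f.quotKerEquivRange.toLinearMap (LinearEquiv.surjective _)
    refine hf (LinearMap.ext fun x => ?_)
    have h2 : ∀ z : LinearMap.range f, z = 0 := by
      intro z
      refine h1.induction (P := fun z => z = 0) (fun g m => ?_) rfl ?_ z
      · have := hzero ((LinearMap.range f).subtype ∘ₗ g)
        have := LinearMap.congr_fun this m
        exact Subtype.ext this
      · rintro _ _ rfl rfl; simp
    exact congrArg Subtype.val (h2 ⟨f x, x, rfl⟩)

end Generation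

section Decomposition

variable {R : Type} [Ring R]

/-- `M` is nonzero and has no nontrivial complemented submodule. -/
def Indec (R M : Type) [Ring R] [AddCommGroup M] [Module R M] : Prop :=
  Nontrivial M ∧ ∀ p q : Submodule R M, IsCompl p q → p = ⊥ ∨ q = ⊥

/-- `M` has no repeated nonzero direct summand. -/
def MultFree (R M : Type) [Ring R] [AddCommGroup M] [Module R M] : Prop :=
  ∀ (L C : Type) [AddCommGroup L] [Module R L] [AddCommGroup C] [Module R C],
    Nonempty (M ≃ₗ[R] (L × L × C)) → Subsingleton L

variable {M L X N : Type} [AddCommGroup M] [Module R M] [AddCommGroup L] [Module R L]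
  [AddCommGroup X] [Module R X] [AddCommGroup N] [Module R N]

theorem exists_equiv_prod_of_retract (i : L →ₗ[R] M) (p : M →ₗ[R] L)
    (h : p ∘ₗ i = LinearMap.id) : Nonempty (M ≃ₗ[R] L × LinearMap.ker p) := by
  have hc : IsCompl (LinearMap.range i) (LinearMap.ker p) := by
    have hpi : ∀ x, p (i x) = x := fun x => LinearMap.congr_fun h x
    constructor
    · rw [Submodule.disjoint_def]
      rintro _ ⟨x, rfl⟩ hx
      rw [LinearMap.mem_ker, hpi] at hx
      rw [hx, map_zero]
    · rw [codisjoint_iff, eq_top_iff]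
      intro x _
      refine Submodule.mem_sup.2 ⟨i (p x), ⟨_, rfl⟩, x - i (p x), ?_, by abel⟩
      simp [hpi]
  have hinj : Function.Injective i := fun x y hxy => by
    rw [← LinearMap.id_apply (R := R) x, ← LinearMap.id_apply (R := R) y, ← h]
    simp [hxy]
  exact ⟨(Submodule.prodEquivOfIsCompl _ _ hc).symm.trans
    ((LinearEquiv.ofInjective i hinj).symm.prodCongr (LinearEquiv.refl R _))⟩

theorem Indec.isNilpotent_or_isUnit [IsNoetherian R M] [IsArtinian R M] (h : Indec R M)
    (u : Module.End R M) : IsNilpotent u ∨ IsUnit u := by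
  obtain ⟨n, hn⟩ := Filter.eventually_atTop.1 u.eventually_isCompl_ker_pow_range_pow
  have hn' := hn (n + 1) (Nat.le_succ n)
  rcases h.2 _ _ hn' with h1 | h1
  · right
    rw [h1] at hn'
    have h2 : LinearMap.range (u ^ (n + 1)) = ⊤ := by
      have := hn'.sup_eq_top
      simpa using this
    have : IsUnit (u ^ (n + 1)) := (Module.End.isUnit_iff _).2
      ⟨LinearMap.ker_eq_bot.1 h1, LinearMap.range_eq_top.1 h2⟩
    exact (isUnit_pow_iff (Nat.succ_ne_zero n)).1 this
  · left
    exact ⟨n + 1, LinearMap.range_eq_bot.1 h1⟩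

theorem Indec.isUnit_or_isUnit_of_isUnit_add [IsNoetherian R M] [IsArtinian R M]
    (h : Indec R M) (u v : Module.End R M) (huv : IsUnit (u + v)) : IsUnit u ∨ IsUnit v := by
  obtain ⟨w, hw⟩ := huv
  have h1 : (↑w⁻¹ * u) + ↑w⁻¹ * v = 1 := by rw [← mul_add, ← hw]; simp
  rcases h.isNilpotent_or_isUnit (↑w⁻¹ * u) with h2 | h2
  · right
    have := h2.isUnit_one_sub
    rw [← h1, add_sub_cancel_left] at this
    simpa using this
  · left; simpa using h2

theorem Indec.exists_isUnit_of_isUnit_sum [IsNoetherian R M] [IsArtinian R M]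
    (h : Indec R M) {ι : Type} (S : Finset ι) (u : ι → Module.End R M)
    (hu : IsUnit (∑ i ∈ S, u i)) : ∃ i ∈ S, IsUnit (u i) := by
  classical
  induction S using Finset.induction_on with
  | empty =>
    have := h.1
    simp at hu
  | insert a S ha ih =>
    rw [Finset.sum_insert ha] at hu
    rcases h.isUnit_or_isUnit_of_isUnit_add _ _ hu with h1 | h1
    · exact ⟨a, Finset.mem_insert_self _ _, h1⟩
    · obtain ⟨i, hi, h2⟩ := ih h1
      exact ⟨i, Finset.mem_insert_of_mem hi, h2⟩

theorem Indec.nonempty_equiv_of_isUnit (hN : Indec R N) (hM : Nontrivial M)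
    (u : N →ₗ[R] M) (v : M →ₗ[R] N) (h : IsUnit (u ∘ₗ v : Module.End R M)) :
    Nonempty (M ≃ₗ[R] N) := by
  obtain ⟨w, hw⟩ := h
  have h1 : ((w⁻¹ : (Module.End R M)ˣ) : Module.End R M) ∘ₗ u ∘ₗ v = LinearMap.id := by
    rw [← hw]; exact w.inv_mul
  set p : N →ₗ[R] M := ((w⁻¹ : (Module.End R M)ˣ) : Module.End R M) ∘ₗ u with hp
  have hpv : ∀ x, p (v x) = x := fun x => LinearMap.congr_fun h1 x
  have hc : IsCompl (LinearMap.range v) (LinearMap.ker p) := by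
    constructor
    · rw [Submodule.disjoint_def]
      rintro _ ⟨x, rfl⟩ hx
      rw [LinearMap.mem_ker, hpv] at hx
      rw [hx, map_zero]
    · rw [codisjoint_iff, eq_top_iff]
      intro x _
      refine Submodule.mem_sup.2 ⟨v (p x), ⟨_, rfl⟩, x - v (p x), ?_, by abel⟩
      simp [hpv]
  have hinj : Function.Injective v := Function.LeftInverse.injective hpv
  rcases hN.2 _ _ hc with h2 | h2
  · obtain ⟨x, hx⟩ := exists_ne (0 : M)
    refine absurd (hpv x) ?_
    rw [LinearMap.range_eq_bot.1 h2]
    simpa using hx.symm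
  · rw [h2] at hc
    refine ⟨LinearEquiv.ofBijective v ⟨hinj, LinearMap.range_eq_top.1 ?_⟩⟩
    simpa using hc.sup_eq_top

theorem exists_indec_decomposition (M : Type) [AddCommGroup M] [Module R M] [IsArtinian R M] :
    ∃ (ι : Type) (_ : Fintype ι) (N : ι → ModuleCat.{0} R),
      (∀ i, Indec R (N i)) ∧ Nonempty (M ≃ₗ[R] ((i : ι) → N i)) := by
  have key : ∀ p : Submodule R M, ∃ (ι : Type) (_ : Fintype ι) (N : ι → ModuleCat.{0} R),
      (∀ i, Indec R (N i)) ∧ Nonempty (p ≃ₗ[R] ((i : ι) → N i)) := by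
    intro p
    induction p using WellFoundedLT.induction with
    | ind p ih =>
    by_cases hnt : Nontrivial p
    swap
    · rw [not_nontrivial_iff_subsingleton] at hnt
      refine ⟨Empty, inferInstance, Empty.elim, fun i => i.elim, ⟨⟨0, 0, ?_, ?_⟩⟩⟩
      · intro x; exact Subsingleton.elim _ _
      · intro x; ext i; exact i.elim
    by_cases hi : Indec R p
    · exact ⟨Unit, inferInstance, fun _ => ModuleCat.of R p, fun _ => hi,
        ⟨(LinearEquiv.funUnique Unit R p).symm⟩⟩
    have : ∃ q q' : Submodule R p, IsCompl q q' ∧ q ≠ ⊥ ∧ q' ≠ ⊥ := by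
      by_contra hcon
      push Not at hcon
      refine hi ⟨hnt, fun q q' h => ?_⟩
      by_contra h2
      push Not at h2
      exact h2.2 (hcon q q' h h2.1)
    obtain ⟨q, q', hc, hq, hq'⟩ := this
    have hlt : ∀ q q' : Submodule R p, IsCompl q q' → q' ≠ ⊥ → q.map p.subtype < p := by
      intro q q' hc hq'
      refine lt_of_le_of_ne (Submodule.map_subtype_le _ _) fun h => hq' ?_
      have : q = ⊤ := by
        apply Submodule.map_injective_of_injective p.injective_subtype
        rw [h]; simp
      rw [this] at hc
      simpa using hc.inf_eq_bot
    obtain ⟨ι, _, N, hN, ⟨e⟩⟩ := ih _ (hlt q q' hc hq')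
    obtain ⟨ι', _, N', hN', ⟨e'⟩⟩ := ih _ (hlt q' q hc.symm hq)
    refine ⟨ι ⊕ ι', inferInstance, Sum.elim N N', ?_, ⟨?_⟩⟩
    · rintro (i | i)
      · exact hN i
      · exact hN' i
    · have E : (q × q') ≃ₗ[R] ((i : ι) → N i) × ((i : ι') → N' i) :=
        ((Submodule.equivSubtypeMap p q).trans e).prodCongr
          ((Submodule.equivSubtypeMap p q').trans e')
      have F : ((i : ι ⊕ ι') → (Sum.elim N N' i : ModuleCat.{0} R)) ≃ₗ[R]
          ((i : ι) → N i) × ((i : ι') → N' i) :=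
        LinearEquiv.sumPiEquivProdPi R ι ι' (fun i => (Sum.elim N N' i : ModuleCat.{0} R))
      exact ((Submodule.prodEquivOfIsCompl _ _ hc).symm.trans E).trans F.symm
  obtain ⟨ι, h, N, hN, ⟨e⟩⟩ := key ⊤
  exact ⟨ι, h, N, hN, ⟨Submodule.topEquiv.symm.trans e⟩⟩

/-- A multiplicity-free module all of whose indecomposable summands occur in the finite family
`N` is a subproduct of `N`. -/
theorem MultFree.exists_equiv_pi (hM : MultFree R M) [IsArtinian R M]
    {ι : Type} (N : ι → ModuleCat.{0} R)
    (h : ∀ (L : Type) [AddCommGroup L] [Module R L] (i : L →ₗ[R] M) (p : M →ₗ[R] L),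
      p ∘ₗ i = LinearMap.id → Indec R L → ∃ t, Nonempty (L ≃ₗ[R] N t)) :
    ∃ S : Set ι, Nonempty (M ≃ₗ[R] ((s : S) → N s)) := by
  classical
  obtain ⟨J, _, N', hN', ⟨e⟩⟩ := exists_indec_decomposition (R := R) M
  have h1 : ∀ j, ∃ t, Nonempty (N' j ≃ₗ[R] N t) := by
    intro j
    refine h (N' j) (e.symm.toLinearMap ∘ₗ LinearMap.single R (fun j => N' j) j)
      (LinearMap.proj j ∘ₗ e.toLinearMap) ?_ (hN' j)
    ext x
    simp
  choose t ht using h1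
  have hinj : Function.Injective t := by
    intro j l hjl
    by_contra hne
    obtain ⟨f⟩ := ht j
    obtain ⟨g⟩ := ht l
    have hE : Nonempty (N' j ≃ₗ[R] N' l) := by
      rw [← hjl] at g
      exact ⟨f.trans g.symm⟩
    obtain ⟨E⟩ := hE
    let i : (N' j × N' j) →ₗ[R] M := e.symm.toLinearMap ∘ₗ
      ((LinearMap.single R (fun j => N' j) j).coprod
        (LinearMap.single R (fun j => N' j) l ∘ₗ E.toLinearMap))
    let p : M →ₗ[R] (N' j × N' j) :=
      ((LinearMap.proj j).prod (E.symm.toLinearMap ∘ₗ LinearMap.proj l)) ∘ₗ e.toLinearMap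
    have hpi : p ∘ₗ i = LinearMap.id := by
      refine LinearMap.ext fun x => Prod.ext ?_ ?_
      · simp [p, i, Ne.symm hne, hne]
      · simp [p, i, Ne.symm hne, hne]
    obtain ⟨F⟩ := exists_equiv_prod_of_retract i p hpi
    have hs := hM (N' j) (LinearMap.ker p) ⟨F.trans (LinearEquiv.prodAssoc R _ _ _)⟩
    exact not_subsingleton_iff_nontrivial.2 (hN' j).1 hs
  refine ⟨Set.range t, ?_⟩
  let τ := Equiv.ofInjective t hinj
  have F : ((j : J) → N' j) ≃ₗ[R] ((j : J) → N (τ j)) := (LinearEquiv.piCongrRight (φ := fun j => N' j) (ψ := fun j => N (τ j))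
    fun j => (ht j).some)
  exact ⟨(e.trans F).trans (LinearEquiv.piCongrLeft R (fun s : Set.range t => (N s : Type)) τ)⟩

end Decomposition

section Finiteness

variable {k R : Type} [Field k] [Ring R] [Algebra k R]

theorem exists_tuple_generating (k : Type) [Field k] [Algebra k R] [Module.Finite k R]
    (K : Type) [AddCommGroup K] [Module R K] [Module.Finite R K] :
    ∃ (s : ℕ) (x : Fin s → K), ∀ y : K, ∃ h : (Fin s → K) →ₗ[R] K, h x = y := by
  let _ : Module k K := Module.compHom K (algebraMap k R)
  have _ : IsScalarTower k R K := ⟨fun c r x => by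
    rw [Algebra.smul_def, mul_smul]; rfl⟩
  have _ : Module.Finite k K := Module.Finite.trans R K
  obtain ⟨s, x, hx⟩ := Module.Finite.exists_fin (R := k) (M := K)
  refine ⟨s, x, fun y => ?_⟩
  have hy : y ∈ Submodule.span k (Set.range x) := by rw [hx]; trivial
  obtain ⟨c, rfl⟩ := (Submodule.mem_span_range_iff_exists_fun k).1 hy
  exact ⟨∑ i, c i • LinearMap.proj i, by simp⟩

theorem Generates.exists_apply_eq {s : ℕ} {K L : Type} [AddCommGroup K] [Module R K]
    [AddCommGroup L] [Module R L] {x : Fin s → K}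
    (hx : ∀ y : K, ∃ h : (Fin s → K) →ₗ[R] K, h x = y) (hL : Generates R K L) (l : L) :
    ∃ h : (Fin s → K) →ₗ[R] L, h x = l := by
  refine hL.induction (P := fun l => ∃ h : (Fin s → K) →ₗ[R] L, h x = l) ?_ ⟨0, rfl⟩ ?_ l
  · intro f m
    obtain ⟨h, rfl⟩ := hx m
    exact ⟨f ∘ₗ h, rfl⟩
  · rintro _ _ ⟨h, rfl⟩ ⟨h', rfl⟩
    exact ⟨h + h', rfl⟩

theorem generates_finsupp (K I : Type) [AddCommGroup K] [Module R K] :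
    Generates R K (I →₀ K) :=
  generates_iff.2 fun x => by
    refine Finsupp.induction_linear x (Submodule.zero_mem _)
      (fun f g hf hg => Submodule.add_mem _ hf hg) fun i y => ?_
    exact map_mem_iSup_range (Finsupp.lsingle (R := R) i) y

theorem generates_pi (K : Type) [AddCommGroup K] [Module R K] (s : ℕ) :
    Generates R K (Fin s → K) :=
  (generates_finsupp K (Fin s)).quotient (Finsupp.linearEquivFunOnFinite R K (Fin s)).toLinearMap
    (LinearEquiv.surjective _)

theorem Generates.prod {K L L' : Type} [AddCommGroup K] [Module R K] [AddCommGroup L] [Module R L]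
    [AddCommGroup L'] [Module R L'] (h : Generates R K L) (h' : Generates R K L') :
    Generates R K (L × L') :=
  generates_iff.2 fun x => by
    have h1 : (x.1, (0 : L')) ∈ ⨆ f : K →ₗ[R] L × L', LinearMap.range f := by
      refine h.induction (P := fun l => (l, (0 : L')) ∈ ⨆ f : K →ₗ[R] L × L', LinearMap.range f)
        (fun f m => map_mem_iSup_range (LinearMap.inl R L L' ∘ₗ f) m) (Submodule.zero_mem _) ?_ x.1
      intro a b ha hb
      simpa using Submodule.add_mem _ ha hb
    have h2 : ((0 : L), x.2) ∈ ⨆ f : K →ₗ[R] L × L', LinearMap.range f := by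
      refine h'.induction (P := fun l => ((0 : L), l) ∈ ⨆ f : K →ₗ[R] L × L', LinearMap.range f)
        (fun f m => map_mem_iSup_range (LinearMap.inr R L L' ∘ₗ f) m) (Submodule.zero_mem _) ?_ x.2
      intro a b ha hb
      simpa using Submodule.add_mem _ ha hb
    simpa using Submodule.add_mem _ h1 h2

/-- The cokernel of the left approximation of the regular module given by the tuple `x`. -/
abbrev ApproxCokernel (R : Type) [Ring R] {s : ℕ} {K : Type} [AddCommGroup K] [Module R K]
    (x : Fin s → K) : Type :=
  (Fin s → K) ⧸ Submodule.span R {x}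

/-- An Ext-projective object of `Fac K` is a retract of a sum of copies of `K` and of the cokernel
of a left approximation of the regular module. -/
theorem RelProjective.exists_retract {s : ℕ} {K M : Type} [AddCommGroup K] [Module R K]
    [AddCommGroup M] [Module R M] [Module.Finite R M] {x : Fin s → K}
    (hx : ∀ y : K, ∃ h : (Fin s → K) →ₗ[R] K, h x = y)
    (hKM : Generates R K M) (hMK : Generates R M K) (hM : RelProjective R M) :
    ∃ (S : Finset ((K × ApproxCokernel R x) →ₗ[R] M))
      (v : ((K × ApproxCokernel R x) →ₗ[R] M) → (M →ₗ[R] (K × ApproxCokernel R x))),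
      ∑ u ∈ S, u ∘ₗ v u = (LinearMap.id : M →ₗ[R] M) := by
  classical
  let N := K × ApproxCokernel R x
  let I := N →ₗ[R] M
  let q : (I →₀ N) →ₗ[R] M := Finsupp.lsum ℕ (fun u : I => u)
  have hq1 : ∀ (u : I) n, q (Finsupp.single u n) = u n := fun u n => by simp [q]
  have hgen : Generates R K (I →₀ N) :=
    (Generates.refl.prod ((generates_pi K s).quotient _ (Submodule.mkQ_surjective _))).trans
      (generates_finsupp N I)
  have hqs : Function.Surjective q := by
    intro m
    refine hKM.induction (P := fun m => ∃ y, q y = m) ?_ ⟨0, map_zero _⟩ ?_ m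
    · intro f a
      exact ⟨Finsupp.single (f ∘ₗ LinearMap.fst R K _) (a, 0), by rw [hq1]; rfl⟩
    · rintro _ _ ⟨y, rfl⟩ ⟨z, rfl⟩
      exact ⟨y + z, map_add _ _ _⟩
  have hker : Generates R K (LinearMap.ker q) := by
    rw [generates_iff]
    rintro ⟨l, hl⟩
    obtain ⟨h, rfl⟩ := hgen.exists_apply_eq hx l
    have hle : Submodule.span R {x} ≤ LinearMap.ker (q ∘ₗ h) := by
      rw [Submodule.span_singleton_le_iff_mem]
      exact hl
    let g : ApproxCokernel R x →ₗ[R] M := (Submodule.span R {x}).liftQ (q ∘ₗ h) hle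
    let h' : (Fin s → K) →ₗ[R] (I →₀ N) :=
      h - Finsupp.lsingle (R := R) (g ∘ₗ LinearMap.snd R K _) ∘ₗ LinearMap.inr R K _ ∘ₗ
        (Submodule.span R {x}).mkQ
    have hh' : ∀ y, q (h' y) = 0 := by
      intro y
      have h1 : q (h' y) = q (h y) - g (Submodule.Quotient.mk y) := by
        simp only [h', LinearMap.sub_apply, map_sub, LinearMap.comp_apply, Finsupp.lsingle_apply,
          hq1]
        rfl
      rw [h1]
      exact sub_self _
    have hh'x : h' x = h x := by
      have : (Submodule.Quotient.mk x : ApproxCokernel R x) = 0 :=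
        (Submodule.Quotient.mk_eq_zero _).2 (Submodule.mem_span_singleton_self x)
      simp [h', this]
    have hmem := Generates.map_mem (X := LinearMap.ker q) (generates_pi (R := R) K s)
      (h'.codRestrict (LinearMap.ker q) hh') x
    convert hmem using 1
    exact Subtype.ext hh'x.symm
  obtain ⟨σ, hσ⟩ := hM (I →₀ N) M q hqs (hMK.trans hker) LinearMap.id
  have hsupp : ∃ S : Finset I, ∀ m, (σ m).support ⊆ S := by
    obtain ⟨t, ht⟩ := ‹Module.Finite R M›.fg_top
    refine ⟨t.biUnion fun m => (σ m).support, fun m => ?_⟩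
    have hm : m ∈ Submodule.span R (t : Set M) := by rw [ht]; trivial
    induction hm using Submodule.span_induction with
    | mem a ha => exact Finset.subset_biUnion_of_mem (fun m => (σ m).support) ha
    | zero => simp
    | add a b _ _ ha hb =>
      rw [map_add]
      exact Finsupp.support_add.trans (Finset.union_subset ha hb)
    | smul r a _ ha =>
      rw [map_smul]
      exact Finsupp.support_smul.trans ha
  obtain ⟨S, hS⟩ := hsupp
  refine ⟨S, fun u => Finsupp.lapply u ∘ₗ σ, LinearMap.ext fun m => ?_⟩
  have h1 : q (σ m) = m := LinearMap.congr_fun hσ m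
  conv_rhs => rw [LinearMap.id_apply, ← h1]
  simp only [q, Finsupp.lsum_apply]
  rw [Finsupp.sum_of_support_subset _ (hS m) _ (by simp)]
  simp only [LinearMap.sum_apply]
  rfl

/-- Finitely many bricks imply finitely many multiplicity-free relatively projective modules. -/
theorem exists_finite_list_of_bricks (k : Type) [Field k] [Algebra k R] [Module.Finite k R]
    {D : Type} [Finite D] (P : D → ModuleCat.{0} R → Prop)
    (hiso : ∀ d (X Y : ModuleCat.{0} R), P d X → P d Y → Nonempty (X ≃ₗ[R] Y))
    (hP : ∀ X : ModuleCat.{0} R, Module.Finite R X → Brick R X → ∃ d, P d X) :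
    ∃ (n : ℕ) (L : Fin n → ModuleCat.{0} R), ∀ M : ModuleCat.{0} R, Module.Finite R M →
      RelProjective R M → MultFree R M → ∃ i, Nonempty (M ≃ₗ[R] L i) := by
  classical
  have _ : IsNoetherianRing R := isNoetherian_of_tower k inferInstance
  have _ : IsArtinianRing R := isArtinian_of_tower k inferInstance
  let τ : ModuleCat.{0} R → Set D := fun M =>
    {d | ∃ X : ModuleCat.{0} R, Module.Finite R X ∧ Brick R X ∧ P d X ∧ Generates R M X}
  have hτ : ∀ M M' : ModuleCat.{0} R, Module.Finite R M → RelProjective R M' → τ M = τ M' →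
      Generates R M' M := by
    intro M M' _ hM' h
    refine generates_of_bricks (M := M) hM' Generates.refl ?_
    intro Y _ _ hY hb hg
    obtain ⟨d, hd⟩ := hP (ModuleCat.of R Y) hY hb
    have h1 : d ∈ τ M := ⟨ModuleCat.of R Y, hY, hb, hd, hg⟩
    rw [h] at h1
    obtain ⟨X, _, _, hX, hgX⟩ := h1
    obtain ⟨e⟩ := hiso d _ _ hX hd
    exact hgX.quotient e.toLinearMap e.surjective
  have hclass : ∀ c : Set D, ∃ (ι : Type) (_ : Fintype ι) (N : ι → ModuleCat.{0} R),
      ∀ M : ModuleCat.{0} R, Module.Finite R M → RelProjective R M → MultFree R M → τ M = c →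
        ∃ S : Set ι, Nonempty (M ≃ₗ[R] ((s : S) → N s)) := by
    intro c
    by_cases hc : ∃ K : ModuleCat.{0} R, Module.Finite R K ∧ RelProjective R K ∧ τ K = c
    swap
    · exact ⟨Empty, inferInstance, Empty.elim, fun M h1 h2 _ h3 => absurd ⟨M, h1, h2, h3⟩ hc⟩
    obtain ⟨K, hKf, hKr, hKc⟩ := hc
    obtain ⟨s, x, hx⟩ := exists_tuple_generating (R := R) k K
    obtain ⟨ι, hι, N, hN, ⟨e⟩⟩ :=
      exists_indec_decomposition (R := R) (K × ApproxCokernel R x)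
    refine ⟨ι, hι, N, fun M hMf hMr hMm hMc => hMm.exists_equiv_pi N ?_⟩
    intro L _ _ i p hpi hL
    obtain ⟨S, v, hv⟩ := hMr.exists_retract hx (hτ M K hMf hKr (hMc.trans hKc.symm))
      (hτ K M hKf hMr (hKc.trans hMc.symm))
    have _ : Module.Finite R L := Module.Finite.of_surjective p fun y =>
      ⟨i y, LinearMap.congr_fun hpi y⟩
    let F : (((K × ApproxCokernel R x) →ₗ[R] M) × ι) → Module.End R L := fun a =>
      (p ∘ₗ a.1 ∘ₗ e.symm.toLinearMap ∘ₗ LinearMap.single R (fun j => N j) a.2) ∘ₗ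
        (LinearMap.proj a.2 ∘ₗ e.toLinearMap ∘ₗ v a.1 ∘ₗ i)
    have hF : ∑ a ∈ S ×ˢ Finset.univ, F a = 1 := by
      rw [Finset.sum_product]
      have h1 : ∀ u ∈ S, ∑ t, F (u, t) = p ∘ₗ (u ∘ₗ v u) ∘ₗ i := by
        intro u _
        ext y
        simp only [F, LinearMap.sum_apply, LinearMap.comp_apply]
        rw [← map_sum, ← map_sum]
        congr 2
        simp only [LinearEquiv.coe_coe]
        rw [← map_sum, LinearEquiv.symm_apply_eq]
        exact Finset.univ_sum_single _
      rw [Finset.sum_congr rfl h1]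
      ext y
      have h2 := LinearMap.congr_fun hv (i y)
      simp only [LinearMap.sum_apply, LinearMap.comp_apply, LinearMap.id_apply] at h2 ⊢
      rw [← map_sum, h2]
      exact LinearMap.congr_fun hpi y
    obtain ⟨a, _, ha⟩ := hL.exists_isUnit_of_isUnit_sum _ F (by rw [hF]; exact isUnit_one)
    exact ⟨a.2, (hN a.2).nonempty_equiv_of_isUnit hL.1 _ _ ha⟩
  choose ι hι N hN using hclass
  have _ : ∀ c, Finite (ι c) := fun c => @Finite.of_fintype _ (hι c)
  have _ : Finite (Σ c : Set D, Set (ι c)) := inferInstance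
  obtain ⟨n, ⟨f⟩⟩ := Finite.exists_equiv_fin (Σ c : Set D, Set (ι c))
  refine ⟨n, fun j => ModuleCat.of R ((s : (f.symm j).2) → N (f.symm j).1 s), fun M h1 h2 h3 => ?_⟩
  obtain ⟨S, hS⟩ := hN (τ M) M h1 h2 h3 rfl
  refine ⟨f ⟨τ M, S⟩, ?_⟩
  have h4 : f.symm (f ⟨τ M, S⟩) = ⟨τ M, S⟩ := f.symm_apply_apply _
  show Nonempty (M ≃ₗ[R] ((s : (f.symm (f ⟨τ M, S⟩)).2) → N (f.symm (f ⟨τ M, S⟩)).1 s))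
  rw [h4]
  exact hS

end Finiteness

section Presentation

theorem exists_projective_cover {R M : Type} [Ring R] [IsArtinianRing R] [IsNoetherianRing R]
    [AddCommGroup M] [Module R M] [Module.Finite R M] :
    ∃ (P : ModuleCat.{0} R) (g : P →ₗ[R] M), Module.Finite R P ∧ Module.Projective R P ∧
      Function.Surjective g ∧ SuperfluousSubmodule (LinearMap.ker g) := by
  obtain ⟨s, π, hπ⟩ := Module.Finite.exists_fin' R M
  obtain ⟨K, hK, hmin⟩ := set_has_minimal_iff_artinian.2
    (inferInstance : IsArtinian R (Fin s → R)) {K | K.map π = ⊤}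
    ⟨⊤, by simpa [LinearMap.range_eq_top] using hπ⟩
  replace hmin : ∀ K' ≤ K, K'.map π = ⊤ → K' = K := fun K' hle h => by
    by_contra hne
    exact hmin K' h (lt_of_le_of_ne hle hne)
  have hs : Function.Surjective (π ∘ₗ K.subtype) := by
    rw [← LinearMap.range_eq_top, LinearMap.range_comp, Submodule.range_subtype]
    exact hK
  have hsub : ∀ N : Submodule R K, N.map (π ∘ₗ K.subtype) = ⊤ → N = ⊤ := by
    intro N hN
    rw [Submodule.map_comp] at hN
    have := hmin _ (Submodule.map_subtype_le K N) hN
    rw [eq_top_iff]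
    intro x _
    have hx : (x : Fin s → R) ∈ N.map K.subtype := by rw [this]; exact x.2
    obtain ⟨y, hy, hyx⟩ := hx
    rwa [← Subtype.ext (a1 := y) (a2 := x) hyx]
  obtain ⟨u, hu⟩ := Module.projective_lifting_property (π ∘ₗ K.subtype) π hs
  have he : Function.Surjective (u ∘ₗ K.subtype) := by
    rw [← LinearMap.range_eq_top]
    refine hsub _ ?_
    rw [← LinearMap.range_comp, LinearMap.range_eq_top, ← LinearMap.comp_assoc, hu]
    exact hs
  have hbij : Function.Bijective (u ∘ₗ K.subtype) :=
    ⟨IsNoetherian.injective_of_surjective_endomorphism _ he, he⟩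
  let w := LinearEquiv.ofBijective (u ∘ₗ K.subtype) hbij
  refine ⟨ModuleCat.of R K, π ∘ₗ K.subtype, inferInstanceAs (Module.Finite R K),
    Module.Projective.of_split K.subtype (w.symm.toLinearMap ∘ₗ u) ?_, hs, ?_⟩
  · ext1 x
    exact w.symm_apply_apply x
  · intro N hN
    refine hsub N ?_
    have := congrArg (Submodule.map (π ∘ₗ K.subtype)) hN
    rw [Submodule.map_sup, Submodule.map_top, LinearMap.range_eq_top.2 hs] at this
    rw [← this, eq_comm, sup_eq_right, Submodule.map_le_iff_le_comap]
    intro x hx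
    have hx0 : (π ∘ₗ K.subtype) x = 0 := hx
    rw [Submodule.mem_comap, hx0]
    exact Submodule.zero_mem _

theorem exists_isMinimalProjPresentation {B : Type} [Ring B] [IsArtinianRing Bᵐᵒᵖ]
    [IsNoetherianRing Bᵐᵒᵖ] (M : ModuleCat.{0} Bᵐᵒᵖ) [Module.Finite Bᵐᵒᵖ M] :
    ∃ (P1 P0 : ModuleCat.{0} Bᵐᵒᵖ) (f : P1 →ₗ[Bᵐᵒᵖ] P0) (g : P0 →ₗ[Bᵐᵒᵖ] M),
      Module.Finite Bᵐᵒᵖ P1 ∧ IsMinimalProjPresentation B M P1 P0 f g := by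
  obtain ⟨P0, g, h1, h2, h3, h4⟩ := exists_projective_cover (R := Bᵐᵒᵖ) (M := M)
  obtain ⟨P1, f, h5, h6, h7, h8⟩ := exists_projective_cover (R := Bᵐᵒᵖ) (M := LinearMap.ker g)
  refine ⟨P1, P0, (LinearMap.ker g).subtype ∘ₗ f, g, h5, h6, h2, h3, ?_, h4, ?_⟩
  · rw [LinearMap.range_comp, LinearMap.range_eq_top.2 h7, Submodule.map_top,
      Submodule.range_subtype]
  · rwa [LinearMap.ker_comp_of_ker_eq_bot _ (Submodule.ker_subtype _)]

end Presentation

section TauRigid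

variable {k B : Type} [Field k] [Ring B] [Algebra k B]

/-- A homomorphism to the regular module followed by multiplication on an element. -/
def homSMul {P M : Type} [AddCommGroup P] [Module Bᵐᵒᵖ P] [AddCommGroup M] [Module Bᵐᵒᵖ M]
    (h : P →ₗ[Bᵐᵒᵖ] B) (m : M) : P →ₗ[Bᵐᵒᵖ] M where
  toFun p := op (h p) • m
  map_add' x y := by simp [add_smul]
  map_smul' r p := by
    rw [map_smul, MulOpposite.smul_eq_mul_unop, RingHom.id_apply, smul_smul]
    rfl

@[simp]
theorem homSMul_apply {P M : Type} [AddCommGroup P] [Module Bᵐᵒᵖ P] [AddCommGroup M]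
    [Module Bᵐᵒᵖ M] (h : P →ₗ[Bᵐᵒᵖ] B) (m : M) (p : P) : homSMul h m p = op (h p) • m := rfl

/-- Maps out of a finitely generated projective module are sums of maps `homSMul`. -/
theorem exists_sum_homSMul {P : Type} [AddCommGroup P] [Module Bᵐᵒᵖ P] [Module.Finite Bᵐᵒᵖ P]
    [Module.Projective Bᵐᵒᵖ P] : ∃ (s : ℕ) (h : Fin s → (P →ₗ[Bᵐᵒᵖ] B)) (x : Fin s → P),
      ∀ (M : Type) [AddCommGroup M] [Module Bᵐᵒᵖ M] (φ : P →ₗ[Bᵐᵒᵖ] M),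
        φ = ∑ i, homSMul (h i) (φ (x i)) := by
  obtain ⟨s, f, g, -, -, hfg⟩ := Module.Finite.exists_comp_eq_id_of_projective Bᵐᵒᵖ P
  let e : Bᵐᵒᵖ →ₗ[Bᵐᵒᵖ] B :=
    { toFun := unop, map_add' := fun _ _ => rfl, map_smul' := fun r p => rfl }
  refine ⟨s, fun i => e ∘ₗ LinearMap.proj i ∘ₗ g, fun i => f (Pi.single i 1), fun M _ _ φ => ?_⟩
  ext p
  have h1 : f (g p) = p := LinearMap.congr_fun hfg p
  conv_lhs => rw [← h1]
  have h2 : g p = ∑ i, g p i • (Pi.single i 1 : Fin s → Bᵐᵒᵖ) := by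
    conv_lhs => rw [pi_eq_sum_univ' (g p)]
  conv_lhs => rw [h2]
  simp [LinearMap.sum_apply, e]

theorem IsTauRigid.exists_comp_eq {M P1 P0 : ModuleCat.{0} Bᵐᵒᵖ} [Module.Finite Bᵐᵒᵖ P1]
    {f : P1 →ₗ[Bᵐᵒᵖ] P0} {g : P0 →ₗ[Bᵐᵒᵖ] M} (hM : IsTauRigid k B M)
    (hfg : IsMinimalProjPresentation B M P1 P0 f g) (φ : P1 →ₗ[Bᵐᵒᵖ] M) :
    ∃ v : P0 →ₗ[Bᵐᵒᵖ] M, v ∘ₗ f = φ := by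
  let _ : Module k M := Module.compHom M (algebraMap k Bᵐᵒᵖ)
  have hsmul : ∀ (c : k) (m : M), c • m = algebraMap k Bᵐᵒᵖ c • m := fun _ _ => rfl
  have _ : SMulCommClass Bᵐᵒᵖ k M := ⟨fun r c m => by
    rw [hsmul, hsmul, smul_smul, smul_smul, Algebra.commutes]⟩
  let F : (P0 →ₗ[Bᵐᵒᵖ] M) →ₗ[k] (P1 →ₗ[Bᵐᵒᵖ] M) :=
    { toFun := fun v => v ∘ₗ f
      map_add' := fun _ _ => rfl
      map_smul' := fun _ _ => rfl }
  suffices hF : LinearMap.range F = ⊤ from LinearMap.range_eq_top.1 hF φ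
  by_contra hF
  obtain ⟨l, hl0, hl⟩ := Submodule.exists_le_ker_of_lt_top _ (lt_top_iff_ne_top.2 hF)
  let β : M →+ ((P1 →ₗ[Bᵐᵒᵖ] B) →ₗ[k] k) :=
    { toFun := fun m =>
        { toFun := fun h => l (homSMul h m)
          map_add' := fun h h' => by
            rw [← map_add]
            congr 1
            ext p
            simp [add_smul]
          map_smul' := fun c h => by
            rw [RingHom.id_apply, ← map_smul]
            congr 1
            ext p
            simp only [homSMul_apply, LinearMap.smul_apply, hsmul, smul_smul]
            rw [Algebra.smul_def, Algebra.commutes, op_mul]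
            rfl }
      map_zero' := by
        ext h
        have : homSMul h (0 : M) = 0 := by ext p; simp
        simp [this]
      map_add' := fun m m' => by
        ext h
        have : homSMul h (m + m') = homSMul h m + homSMul h m' := by ext p; simp
        simp [this] }
  have hβ : β = 0 := by
    refine hM P1 P0 f g hfg β (fun m b h => ?_) (fun m g0 => ?_)
    · show l _ = l _
      congr 1
      ext p
      simp only [homSMul_apply, smul_smul, ← op_mul]
      rfl
    · exact hl ⟨homSMul g0 m, rfl⟩
  refine hl0 (LinearMap.ext fun φ => ?_)
  have _ : Module.Projective Bᵐᵒᵖ P1 := hfg.1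
  obtain ⟨s, h, x, hx⟩ := exists_sum_homSMul (B := B) (P := P1)
  rw [hx M φ, map_sum]
  refine Finset.sum_eq_zero fun i _ => ?_
  exact LinearMap.congr_fun (DFunLike.congr_fun hβ (φ (x i))) (h i)

theorem IsTauRigid.relProjective [IsArtinianRing Bᵐᵒᵖ] [IsNoetherianRing Bᵐᵒᵖ]
    {M : ModuleCat.{0} Bᵐᵒᵖ} [Module.Finite Bᵐᵒᵖ M] (hM : IsTauRigid k B M) :
    RelProjective Bᵐᵒᵖ M := by
  obtain ⟨P1, P0, f, g, _, hfg⟩ := exists_isMinimalProjPresentation M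
  have _ : Module.Projective Bᵐᵒᵖ P1 := hfg.1
  have _ : Module.Projective Bᵐᵒᵖ P0 := hfg.2.1
  have key : ∀ (L : Type) [AddCommGroup L] [Module Bᵐᵒᵖ L], Generates Bᵐᵒᵖ M L →
      ∀ φ : P1 →ₗ[Bᵐᵒᵖ] L, ∃ v : P0 →ₗ[Bᵐᵒᵖ] L, v ∘ₗ f = φ := by
    intro L _ _ hL φ
    have h1 : ∀ (l : L) (h : P1 →ₗ[Bᵐᵒᵖ] B), ∃ v : P0 →ₗ[Bᵐᵒᵖ] L, v ∘ₗ f = homSMul h l := by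
      refine hL.induction (fun F m h => ?_) (fun h => ⟨0, by ext; simp⟩) ?_
      · obtain ⟨v, hv⟩ := hM.exists_comp_eq hfg (homSMul h m)
        refine ⟨F ∘ₗ v, ?_⟩
        rw [LinearMap.comp_assoc, hv]
        ext p
        simp
      · intro x y hx hy h
        obtain ⟨v, hv⟩ := hx h
        obtain ⟨w, hw⟩ := hy h
        refine ⟨v + w, ?_⟩
        rw [LinearMap.add_comp, hv, hw]
        ext p
        simp
    obtain ⟨s, h, x, hx⟩ := exists_sum_homSMul (B := B) (P := P1)
    choose v hv using fun i => h1 (φ (x i)) (h i)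
    refine ⟨∑ i, v i, ?_⟩
    rw [hx L φ]
    ext p
    simp only [LinearMap.comp_apply, LinearMap.sum_apply]
    exact Finset.sum_congr rfl fun i _ => LinearMap.congr_fun (hv i) p
  intro E L _ _ _ _ p hp hk φ
  obtain ⟨-, -, hg, hex, -, -⟩ := hfg
  obtain ⟨u, hu⟩ := Module.projective_lifting_property p (φ ∘ₗ g) hp
  have hgf : ∀ x, g (f x) = 0 := fun x => by
    have : f x ∈ LinearMap.ker g := by rw [← hex]; exact ⟨x, rfl⟩
    exact this
  have hpu : ∀ x, p (u x) = φ (g x) := fun x => LinearMap.congr_fun hu x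
  have huf : ∀ x, (u ∘ₗ f) x ∈ LinearMap.ker p := fun x => by
    simp [hpu, hgf]
  obtain ⟨v, hv⟩ := key (LinearMap.ker p) hk ((u ∘ₗ f).codRestrict _ huf)
  have hvf : ∀ x, ((v (f x) : LinearMap.ker p) : E) = u (f x) := fun x =>
    congrArg Subtype.val (LinearMap.congr_fun hv x)
  let w : P0 →ₗ[Bᵐᵒᵖ] E := u - (LinearMap.ker p).subtype ∘ₗ v
  have hw : LinearMap.ker g ≤ LinearMap.ker w := by
    rw [← hex]
    rintro _ ⟨x, rfl⟩
    simp [w, hvf]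
  refine ⟨(LinearMap.ker g).liftQ w hw ∘ₗ (g.quotKerEquivOfSurjective hg).symm.toLinearMap, ?_⟩
  ext m
  obtain ⟨x, rfl⟩ := hg m
  have h2 : (g.quotKerEquivOfSurjective hg).symm (g x) = Submodule.Quotient.mk x := by
    rw [LinearEquiv.symm_apply_eq]
    rfl
  simp only [LinearMap.comp_apply, LinearEquiv.coe_coe, h2, Submodule.liftQ_apply]
  have h3 : p (v x : LinearMap.ker p) = 0 := (v x).2
  simp [w, hpu, h3]

end TauRigid

section Transfer

variable {R S : Type} [Ring R] [Ring S]

/-- A linear map over `R` is linear over a quotient of `R` acting compatibly. -/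
def LinearMap.ofSurjectiveScalars {X Y : Type} [AddCommGroup X] [Module R X] [Module S X]
    [AddCommGroup Y] [Module R Y] [Module S Y] (φ : R →+* S) (hφ : Function.Surjective φ)
    (hX : ∀ (r : R) (x : X), r • x = φ r • x) (hY : ∀ (r : R) (y : Y), r • y = φ r • y)
    (f : X →ₗ[R] Y) : X →ₗ[S] Y where
  toFun := f
  map_add' := f.map_add
  map_smul' s x := by
    obtain ⟨r, rfl⟩ := hφ s
    rw [← hX, map_smul, hY]
    rfl

theorem exists_module_of_surjective (φ : R →+* S) (hφ : Function.Surjective φ) (X : Type)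
    [AddCommGroup X] [Module R X] (h : ∀ r, φ r = 0 → ∀ x : X, r • x = 0) :
    ∃ _ : Module S X, ∀ (r : R) (x : X), r • x = φ r • x := by
  let F : S →+* AddMonoid.End X := φ.liftOfSurjective hφ ⟨Module.toAddMonoidEnd R X, fun r hr => by
    ext x
    exact h r hr x⟩
  refine ⟨Module.compHom X F, fun r x => ?_⟩
  have : F (φ r) = Module.toAddMonoidEnd R X r :=
    RingHom.liftOfRightInverse_comp_apply _ _ _ _ _
  show r • x = F (φ r) x
  rw [this]
  rfl

theorem RelProjective.of_idempotent_quotient (φ : R →+* S) (hφ : Function.Surjective φ) {e : R}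
    (he : IsIdempotentElem e) (hφe : φ e = 0)
    (hker : ∀ (X : Type) [AddCommGroup X] [Module R X], (∀ x : X, e • x = 0) →
      ∀ r, φ r = 0 → ∀ x : X, r • x = 0)
    {N : Type} [AddCommGroup N] [Module R N] [Module S N]
    (hN : ∀ (r : R) (n : N), r • n = φ r • n) (h : RelProjective S N) : RelProjective R N := by
  intro E L _ _ _ _ p hp hk g
  have heN : ∀ n : N, e • n = 0 := fun n => by rw [hN, hφe, zero_smul]
  have hek : ∀ x : LinearMap.ker p, e • x = 0 :=
    hk.induction (fun f m => by rw [← map_smul, heN, map_zero]) (smul_zero _)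
      (fun x y hx hy => by rw [smul_add, hx, hy, add_zero])
  let E' : Submodule R (E × N) :=
    LinearMap.ker (p ∘ₗ LinearMap.fst R E N - g ∘ₗ LinearMap.snd R E N)
  have hE' : ∀ x : E', p x.1.1 = g x.1.2 := fun x => sub_eq_zero.1 x.2
  have heE : ∀ x : E', e • x = 0 := by
    intro x
    have h1 : e • x.1.1 ∈ LinearMap.ker p := by
      rw [LinearMap.mem_ker, map_smul, hE', ← map_smul, heN, map_zero]
    have h2 := congrArg Subtype.val (hek ⟨_, h1⟩)
    have h3 : e • x.1.1 = 0 := by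
      simpa [smul_smul, he.eq] using h2
    exact Subtype.ext (Prod.ext h3 (heN _))
  obtain ⟨_, hS⟩ := exists_module_of_surjective φ hφ E' (hker E' heE)
  let q : E' →ₗ[S] N := LinearMap.ofSurjectiveScalars φ hφ hS hN (LinearMap.snd R E N ∘ₗ E'.subtype)
  have hq : ∀ x : E', q x = x.1.2 := fun _ => rfl
  have hqs : Function.Surjective q := by
    intro n
    obtain ⟨x, hx⟩ := hp (g n)
    exact ⟨⟨(x, n), sub_eq_zero.2 hx⟩, rfl⟩
  have hqk : Generates S N (LinearMap.ker q) := by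
    rw [generates_iff]
    rintro ⟨⟨⟨x, n⟩, hx⟩, hn⟩
    have hn' : n = 0 := hn
    subst hn'
    have hpx : x ∈ LinearMap.ker p := by
      have := hE' ⟨⟨x, 0⟩, hx⟩
      simpa using this
    have hmem : ∀ z : LinearMap.ker p, ((z : E), (0 : N)) ∈ E' := fun z => by
      have := z.2
      simp [E']
    let F : LinearMap.ker p →ₗ[R] E' :=
      { toFun := fun z => ⟨(z, 0), hmem z⟩
        map_add' := fun a b => Subtype.ext (Prod.ext rfl (add_zero _).symm)
        map_smul' := fun r a => Subtype.ext (Prod.ext rfl (smul_zero _).symm) }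
    have key : ∀ z : LinearMap.ker p, (⟨F z, rfl⟩ : LinearMap.ker q) ∈
        ⨆ f : N →ₗ[S] LinearMap.ker q, LinearMap.range f := by
      refine hk.induction (fun f m => ?_) (Submodule.zero_mem _) (fun a b ha hb => ?_)
      · let G : N →ₗ[S] E' := LinearMap.ofSurjectiveScalars φ hφ hN hS (F ∘ₗ f)
        exact map_mem_iSup_range (G.codRestrict (LinearMap.ker q) fun _ => rfl) m
      · convert Submodule.add_mem _ ha hb using 1
        exact Subtype.ext (map_add F a b)
    exact key ⟨x, hpx⟩
  obtain ⟨σ, hσ⟩ := h E' N q hqs hqk LinearMap.id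
  let σ' : N →ₗ[R] E' :=
    { toFun := σ
      map_add' := σ.map_add
      map_smul' := fun r n => by rw [hN, map_smul, RingHom.id_apply, hS] }
  refine ⟨LinearMap.fst R E N ∘ₗ E'.subtype ∘ₗ σ', LinearMap.ext fun n => ?_⟩
  show p (σ n).1.1 = g n
  rw [hE', ← hq]
  exact congrArg g (LinearMap.congr_fun hσ n)

theorem RelProjective.congr {M N : Type} [AddCommGroup M] [Module R M] [AddCommGroup N]
    [Module R N] (e : M ≃ₗ[R] N) (h : RelProjective R N) : RelProjective R M := by
  intro E L _ _ _ _ p hp hk g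
  have hN : Generates R N M := Generates.of_surjective e.symm.toLinearMap e.symm.surjective
  obtain ⟨σ, hσ⟩ := h E L p hp (hN.trans hk) (g ∘ₗ e.symm.toLinearMap)
  refine ⟨σ ∘ₗ e.toLinearMap, ?_⟩
  rw [← LinearMap.comp_assoc, hσ]
  ext x
  simp

end Transfer

section SupportTauTilting

variable {k A : Type} [Field k] [Ring A] [Algebra k A]

theorem IdemQuot.mk_surjective (e : A) : Function.Surjective (IdemQuot.mk A e) :=
  RingCon.mk'_surjective _

theorem IdemQuot.mk_eq_zero_iff {e a : A} :
    IdemQuot.mk A e a = 0 ↔ a ∈ TwoSidedIdeal.span {e} := by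
  rw [TwoSidedIdeal.mem_iff]
  exact RingCon.eq _

theorem op_smul_eq_zero_of_mem_span {e a : A} {X : Type} [AddCommGroup X] [Module Aᵐᵒᵖ X]
    (hX : ∀ x : X, op e • x = 0) (ha : a ∈ TwoSidedIdeal.span {e}) (x : X) : op a • x = 0 := by
  induction ha using TwoSidedIdeal.span_induction generalizing x with
  | mem a ha => rw [Set.mem_singleton_iff.1 ha, hX]
  | zero => rw [MulOpposite.op_zero, zero_smul]
  | add a b _ _ ha hb => rw [MulOpposite.op_add, add_smul, ha, hb, add_zero]
  | neg a _ ha => rw [MulOpposite.op_neg, neg_smul, ha, neg_zero]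
  | left_absorb b a _ ha => rw [op_mul, mul_smul, ha]
  | right_absorb b a _ ha => rw [op_mul, mul_smul, ha, smul_zero]

instance [Module.Finite k A] (e : A) : Module.Finite k (IdemQuot A e) :=
  Module.Finite.of_surjective
    ({ toFun := IdemQuot.mk A e
       map_add' := map_add _
       map_smul' := fun c a => by
        rw [Algebra.smul_def, map_mul, RingHom.id_apply, Algebra.smul_def]
        rfl } : A →ₗ[k] IdemQuot A e) (IdemQuot.mk_surjective e)

theorem module_finite_op [Module.Finite k A] : Module.Finite k Aᵐᵒᵖ :=
  Module.Finite.equiv (MulOpposite.opLinearEquiv k)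

theorem IsSupportTauTilting.finite_and_relProjective [Module.Finite k A] {M : ModuleCat.{0} Aᵐᵒᵖ}
    (hM : IsSupportTauTilting k A M) : Module.Finite Aᵐᵒᵖ M ∧ RelProjective Aᵐᵒᵖ M := by
  obtain ⟨e, he, N, ⟨hNf, hNr, -⟩, ⟨ε⟩⟩ := hM
  have hfin := module_finite_op (k := k) (A := IdemQuot A e)
  have _ : IsArtinianRing (IdemQuot A e)ᵐᵒᵖ := isArtinian_of_tower k inferInstance
  have _ : IsNoetherianRing (IdemQuot A e)ᵐᵒᵖ := isNoetherian_of_tower k inferInstance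
  let φ : Aᵐᵒᵖ →+* (IdemQuot A e)ᵐᵒᵖ := RingHom.op (IdemQuot.mk A e)
  have hφ : Function.Surjective φ := fun b => by
    obtain ⟨a, ha⟩ := IdemQuot.mk_surjective e b.unop
    exact ⟨op a, unop_injective ha⟩
  let _ : Module Aᵐᵒᵖ N := Module.compHom N φ
  have hN : ∀ (r : Aᵐᵒᵖ) (n : N), r • n = φ r • n := fun _ _ => rfl
  have hNA : Module.Finite Aᵐᵒᵖ N := by
    obtain ⟨t, ht⟩ := hNf.fg_top
    refine ⟨⟨t, eq_top_iff.2 fun x _ => ?_⟩⟩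
    have hx : x ∈ Submodule.span (IdemQuot A e)ᵐᵒᵖ (t : Set N) := by rw [ht]; trivial
    induction hx using Submodule.span_induction with
    | mem a ha => exact Submodule.subset_span ha
    | zero => exact Submodule.zero_mem _
    | add a b _ _ ha hb => exact Submodule.add_mem _ (ha trivial) (hb trivial)
    | smul r a _ ha =>
      obtain ⟨r, rfl⟩ := hφ r
      rw [← hN]
      exact Submodule.smul_mem _ _ (ha trivial)
  have hrel : RelProjective Aᵐᵒᵖ N := by
    refine RelProjective.of_idempotent_quotient φ hφ (e := op e) ?_ ?_ ?_ hN hNr.relProjective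
    · exact congrArg op he
    · exact congrArg op (IdemQuot.mk_eq_zero_iff.2 (TwoSidedIdeal.subset_span rfl))
    · intro X _ _ hX r hr x
      exact op_smul_eq_zero_of_mem_span hX (IdemQuot.mk_eq_zero_iff.1 (congrArg unop hr)) x
  let ε' : M ≃ₗ[Aᵐᵒᵖ] N := ε
  exact ⟨Module.Finite.equiv ε'.symm, hrel.congr ε'⟩

/-- A finite-dimensional algebra with finitely many bricks is τ-tilting finite. -/
theorem tauTiltingFinite_of_bricks [Module.Finite k A] {D : Type} [Finite D]
    (P : D → ModuleCat.{0} Aᵐᵒᵖ → Prop)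
    (hiso : ∀ d (X Y : ModuleCat.{0} Aᵐᵒᵖ), P d X → P d Y → Nonempty (X ≃ₗ[Aᵐᵒᵖ] Y))
    (hP : ∀ X : ModuleCat.{0} Aᵐᵒᵖ, Module.Finite Aᵐᵒᵖ X → Brick Aᵐᵒᵖ X → ∃ d, P d X) :
    TauTiltingFinite k A := by
  have _ : Module.Finite k Aᵐᵒᵖ := module_finite_op
  obtain ⟨n, L, hL⟩ := exists_finite_list_of_bricks k P hiso hP
  refine ⟨n, L, fun M hM hb => ?_⟩
  obtain ⟨h1, h2⟩ := hM.finite_and_relProjective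
  exact hL M h1 h2 fun L C _ _ _ _ h => hb (ModuleCat.of _ L) (ModuleCat.of _ C) h

end SupportTauTilting

section Representation

/-- Representations of `Δ(2,2,n)` satisfying the relations that hold on bricks of `Γ(n)`: the
operators are the actions of the trivial paths, of the arrows `α₁, α₂, β₁, β₂` and of the sum `G` of
the arrows `γ_l`. -/
structure BrickRep (k : Type) [Field k] (n : ℕ) [NeZero n] (X : Type) [AddCommGroup X]
    [Module k X] where
  E : ZMod n → Module.End k X
  Ea : Module.End k X
  Eb : Module.End k X
  A1 : Module.End k X
  A2 : Module.End k X
  B1 : Module.End k X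
  B2 : Module.End k X
  G : Module.End k X
  E_E : ∀ l m x, E l (E m x) = if l = m then E m x else 0
  Ea_Ea : ∀ x, Ea (Ea x) = Ea x
  Eb_Eb : ∀ x, Eb (Eb x) = Eb x
  E_Ea : ∀ l x, E l (Ea x) = 0
  Ea_E : ∀ l x, Ea (E l x) = 0
  E_Eb : ∀ l x, E l (Eb x) = 0
  Eb_E : ∀ l x, Eb (E l x) = 0
  Ea_Eb : ∀ x, Ea (Eb x) = 0
  Eb_Ea : ∀ x, Eb (Ea x) = 0
  sum_eq : ∀ x, ∑ l, E l x + Ea x + Eb x = x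
  G_E : ∀ l x, G (E l x) = E (l + 1) (G x)
  G_Ea : ∀ x, G (Ea x) = 0
  Ea_G : ∀ x, Ea (G x) = 0
  G_Eb : ∀ x, G (Eb x) = 0
  Eb_G : ∀ x, Eb (G x) = 0
  G_pow : G ^ n = 0
  A1_E0 : ∀ x, A1 (E 0 x) = A1 x
  Ea_A1 : ∀ x, Ea (A1 x) = A1 x
  A2_Ea : ∀ x, A2 (Ea x) = A2 x
  E0_A2 : ∀ x, E 0 (A2 x) = A2 x
  B1_E0 : ∀ x, B1 (E 0 x) = B1 x
  Eb_B1 : ∀ x, Eb (B1 x) = B1 x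
  B2_Eb : ∀ x, B2 (Eb x) = B2 x
  E0_B2 : ∀ x, E 0 (B2 x) = B2 x
  A1_G : ∀ x, A1 (G x) = 0
  B1_G : ∀ x, B1 (G x) = 0
  G_A2 : ∀ x, G (A2 x) = 0
  G_B2 : ∀ x, G (B2 x) = 0
  A1_A2 : ∀ x, A1 (A2 x) = 0
  A1_B2 : ∀ x, A1 (B2 x) = 0
  B1_A2 : ∀ x, B1 (A2 x) = 0
  B1_B2 : ∀ x, B1 (B2 x) = 0
  A2_A1 : ∀ x, A2 (A1 x) = 0
  B2_B1 : ∀ x, B2 (B1 x) = 0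

namespace BrickRep

variable {k : Type} [Field k] {n : ℕ} [NeZero n] {X Y : Type} [AddCommGroup X] [Module k X]
  [AddCommGroup Y] [Module k Y] (ρ : BrickRep k n X) (σ : BrickRep k n Y)

/-- Homomorphisms of representations. -/
structure IsHom (T : X →ₗ[k] Y) : Prop where
  E : ∀ l x, T (ρ.E l x) = σ.E l (T x)
  Ea : ∀ x, T (ρ.Ea x) = σ.Ea (T x)
  Eb : ∀ x, T (ρ.Eb x) = σ.Eb (T x)
  A1 : ∀ x, T (ρ.A1 x) = σ.A1 (T x)
  A2 : ∀ x, T (ρ.A2 x) = σ.A2 (T x)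
  B1 : ∀ x, T (ρ.B1 x) = σ.B1 (T x)
  B2 : ∀ x, T (ρ.B2 x) = σ.B2 (T x)
  G : ∀ x, T (ρ.G x) = σ.G (T x)

/-- Every nonzero endomorphism is injective. -/
def IsBrick : Prop :=
  Nontrivial X ∧ ∀ T : X →ₗ[k] X, IsHom ρ ρ T → T ≠ 0 → Function.Injective T

/-- The representation with the roles of the first two cycles exchanged. -/
def swap : BrickRep k n X where
  E := ρ.E
  Ea := ρ.Eb
  Eb := ρ.Ea
  A1 := ρ.B1
  A2 := ρ.B2
  B1 := ρ.A1
  B2 := ρ.A2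
  G := ρ.G
  E_E := ρ.E_E
  Ea_Ea := ρ.Eb_Eb
  Eb_Eb := ρ.Ea_Ea
  E_Ea := ρ.E_Eb
  Ea_E := ρ.Eb_E
  E_Eb := ρ.E_Ea
  Eb_E := ρ.Ea_E
  Ea_Eb := ρ.Eb_Ea
  Eb_Ea := ρ.Ea_Eb
  sum_eq x := by rw [add_right_comm, ρ.sum_eq]
  G_E := ρ.G_E
  G_Ea := ρ.G_Eb
  Ea_G := ρ.Eb_G
  G_Eb := ρ.G_Ea
  Eb_G := ρ.Ea_G
  G_pow := ρ.G_pow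
  A1_E0 := ρ.B1_E0
  Ea_A1 := ρ.Eb_B1
  A2_Ea := ρ.B2_Eb
  E0_A2 := ρ.E0_B2
  B1_E0 := ρ.A1_E0
  Eb_B1 := ρ.Ea_A1
  B2_Eb := ρ.A2_Ea
  E0_B2 := ρ.E0_A2
  A1_G := ρ.B1_G
  B1_G := ρ.A1_G
  G_A2 := ρ.G_B2
  G_B2 := ρ.G_A2
  A1_A2 := ρ.B1_B2
  A1_B2 := ρ.B1_A2
  B1_A2 := ρ.A1_B2
  B1_B2 := ρ.A1_A2
  A2_A1 := ρ.B2_B1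
  B2_B1 := ρ.A2_A1

/-- The dual representation. -/
@[simps]
def dual : BrickRep k n (Module.Dual k X) where
  E l := (ρ.E (-l)).dualMap
  Ea := ρ.Ea.dualMap
  Eb := ρ.Eb.dualMap
  A1 := ρ.A2.dualMap
  A2 := ρ.A1.dualMap
  B1 := ρ.B2.dualMap
  B2 := ρ.B1.dualMap
  G := ρ.G.dualMap
  E_E l m φ := by
    ext x
    by_cases h : l = m
    · simp [h, ρ.E_E]
    · simp [h, ρ.E_E, Ne.symm h]
  Ea_Ea φ := by ext x; simp [ρ.Ea_Ea]
  Eb_Eb φ := by ext x; simp [ρ.Eb_Eb]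
  E_Ea l φ := by ext x; simp [ρ.Ea_E]
  Ea_E l φ := by ext x; simp [ρ.E_Ea]
  E_Eb l φ := by ext x; simp [ρ.Eb_E]
  Eb_E l φ := by ext x; simp [ρ.E_Eb]
  Ea_Eb φ := by ext x; simp [ρ.Eb_Ea]
  Eb_Ea φ := by ext x; simp [ρ.Ea_Eb]
  sum_eq φ := by
    ext x
    have h : ∑ l, ρ.E (-l) x = ∑ l, ρ.E l x :=
      Equiv.sum_comp (Equiv.neg (ZMod n)) fun l => ρ.E l x
    simp only [LinearMap.add_apply, LinearMap.sum_apply, LinearMap.dualMap_apply]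
    rw [← map_sum, h, ← map_add, ← map_add, ρ.sum_eq]
  G_E l φ := by
    ext x
    simp [ρ.G_E]
  G_Ea φ := by ext x; simp [ρ.Ea_G]
  Ea_G φ := by ext x; simp [ρ.G_Ea]
  G_Eb φ := by ext x; simp [ρ.Eb_G]
  Eb_G φ := by ext x; simp [ρ.G_Eb]
  G_pow := by
    have h : ∀ m (φ : Module.Dual k X) x, (ρ.G.dualMap ^ m) φ x = φ ((ρ.G ^ m) x) := by
      intro m
      induction m with
      | zero => intro φ x; rfl
      | succ m ih =>
        intro φ x
        rw [pow_succ, Module.End.mul_apply, ih, LinearMap.dualMap_apply, ← Module.End.mul_apply,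
          ← pow_succ']
    ext φ x
    rw [h, ρ.G_pow]
    simp
  A1_E0 φ := by ext x; simp [ρ.E0_A2]
  Ea_A1 φ := by ext x; simp [ρ.A2_Ea]
  A2_Ea φ := by ext x; simp [ρ.Ea_A1]
  E0_A2 φ := by ext x; simp [ρ.A1_E0]
  B1_E0 φ := by ext x; simp [ρ.E0_B2]
  Eb_B1 φ := by ext x; simp [ρ.B2_Eb]
  B2_Eb φ := by ext x; simp [ρ.Eb_B1]
  E0_B2 φ := by ext x; simp [ρ.B1_E0]
  A1_G φ := by ext x; simp [ρ.G_A2]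
  B1_G φ := by ext x; simp [ρ.G_B2]
  G_A2 φ := by ext x; simp [ρ.A1_G]
  G_B2 φ := by ext x; simp [ρ.B1_G]
  A1_A2 φ := by ext x; simp [ρ.A1_A2]
  A1_B2 φ := by ext x; simp [ρ.B1_A2]
  B1_A2 φ := by ext x; simp [ρ.A1_B2]
  B1_B2 φ := by ext x; simp [ρ.B1_B2]
  A2_A1 φ := by ext x; simp [ρ.A2_A1]
  B2_B1 φ := by ext x; simp [ρ.B2_B1]

variable {ρ σ}

theorem IsHom.swap {T : X →ₗ[k] Y} (h : IsHom ρ σ T) : IsHom ρ.swap σ.swap T :=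
  ⟨h.E, h.Eb, h.Ea, h.B1, h.B2, h.A1, h.A2, h.G⟩

theorem IsHom.comp {Z : Type} [AddCommGroup Z] [Module k Z] {τ : BrickRep k n Z}
    {T : X →ₗ[k] Y} {S : Y →ₗ[k] Z} (hT : IsHom ρ σ T) (hS : IsHom σ τ S) :
    IsHom ρ τ (S ∘ₗ T) := by
  constructor <;> intros <;>
    simp only [LinearMap.comp_apply, hT.E, hS.E, hT.Ea, hS.Ea, hT.Eb, hS.Eb, hT.A1, hS.A1, hT.A2,
      hS.A2, hT.B1, hS.B1, hT.B2, hS.B2, hT.G, hS.G]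

theorem IsHom.of_dual [FiniteDimensional k X] [FiniteDimensional k Y]
    {T : Module.Dual k Y →ₗ[k] Module.Dual k X} (h : IsHom σ.dual ρ.dual T) :
    ∃ S : X →ₗ[k] Y, IsHom ρ σ S ∧ S.dualMap = T := by
  let S : X →ₗ[k] Y := (Module.evalEquiv k Y).symm.toLinearMap ∘ₗ T.dualMap ∘ₗ
    Module.Dual.eval k X
  have hS : ∀ (φ : Module.Dual k Y) x, φ (S x) = T φ x := by
    intro φ x
    have h1 : Module.evalEquiv k Y (S x) = T.dualMap (Module.Dual.eval k X x) := by
      simp [S]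
    have h2 := LinearMap.congr_fun h1 φ
    simpa using h2
  have hext : ∀ y y' : Y, (∀ φ : Module.Dual k Y, φ y = φ y') → y = y' := fun y y' hy => by
    refine (Module.evalEquiv k Y).injective (LinearMap.ext fun φ => ?_)
    simpa using hy φ
  refine ⟨S, ?_, ?_⟩
  · constructor
    · intro l x
      refine hext _ _ fun φ => ?_
      have h1 := LinearMap.congr_fun (h.E (-l) φ) x
      simp only [dual_E, neg_neg, LinearMap.dualMap_apply] at h1
      rw [hS, ← h1, ← hS, LinearMap.dualMap_apply]
    all_goals
      intro x
      refine hext _ _ fun φ => ?_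
      rw [hS, ← LinearMap.dualMap_apply, ← LinearMap.dualMap_apply (g := φ), hS]
    · exact (LinearMap.congr_fun (h.Ea φ) x).symm
    · exact (LinearMap.congr_fun (h.Eb φ) x).symm
    · exact (LinearMap.congr_fun (h.A2 φ) x).symm
    · exact (LinearMap.congr_fun (h.A1 φ) x).symm
    · exact (LinearMap.congr_fun (h.B2 φ) x).symm
    · exact (LinearMap.congr_fun (h.B1 φ) x).symm
    · exact (LinearMap.congr_fun (h.G φ) x).symm
  · ext φ x
    exact hS φ x

theorem IsBrick.dual [FiniteDimensional k X] (h : IsBrick ρ) : IsBrick ρ.dual := by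
  have _ := h.1
  refine ⟨inferInstance, fun T hT h0 => ?_⟩
  obtain ⟨S, hS, rfl⟩ := hT.of_dual
  have h1 : S ≠ 0 := by
    rintro rfl
    exact h0 (by ext; simp)
  have h2 : Function.Surjective S := LinearMap.injective_iff_surjective.1 (h.2 S hS h1)
  exact LinearMap.dualMap_injective_of_surjective h2

/-- Two bricks with maps in both directions whose composition is nonzero are isomorphic. -/
theorem IsBrick.bijective (hρ : IsBrick ρ) (hσ : IsBrick σ) [FiniteDimensional k Y] {T : X →ₗ[k] Y}
    {S : Y →ₗ[k] X} (hT : IsHom ρ σ T) (hS : IsHom σ ρ S) (h0 : S ∘ₗ T ≠ 0) :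
    Function.Bijective T := by
  have h1 := hρ.2 _ (hT.comp hS) h0
  have _ := hρ.1
  have hinj : Function.Injective T := fun x y hxy => h1 (congrArg S hxy)
  have h2 : T ∘ₗ S ≠ 0 := fun h => by
    obtain ⟨x, hx⟩ := exists_ne (0 : X)
    have h3 : T (S (T x)) = 0 := LinearMap.congr_fun h (T x)
    rw [← map_zero T] at h3
    exact hx (h1 ((hinj h3).trans (map_zero (S ∘ₗ T)).symm))
  have h3 := LinearMap.injective_iff_surjective.1 (hσ.2 _ (hS.comp hT) h2)
  exact ⟨hinj, fun y => by
    obtain ⟨z, hz⟩ := h3 y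
    exact ⟨S z, hz⟩⟩

end BrickRep
end Representation

section LinearAlgebra

variable {k : Type} [Field k]

theorem exists_ne_bot_le_of_chain {V : Type} [AddCommGroup V] [Module k V] [Nontrivial V] {n : ℕ}
    {F : Fin n → Submodule k V} (hF : Monotone F) : ∃ M ≠ ⊥, ∀ i, F i ≠ ⊥ → M ≤ F i := by
  classical
  let S : Finset (Fin n) := Finset.univ.filter fun i => F i ≠ ⊥
  by_cases h : S.Nonempty
  · refine ⟨F (S.min' h), (Finset.mem_filter.1 (S.min'_mem h)).2, fun i hi => hF ?_⟩
    exact S.min'_le _ (Finset.mem_filter.2 ⟨Finset.mem_univ _, hi⟩)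
  · refine ⟨⊤, top_ne_bot, fun i hi => absurd ⟨i, ?_⟩ h⟩
    exact Finset.mem_filter.2 ⟨Finset.mem_univ _, hi⟩

theorem exists_ne_top_ge_of_chain {V : Type} [AddCommGroup V] [Module k V] [Nontrivial V] {n : ℕ}
    {F : Fin n → Submodule k V} (hF : Monotone F) : ∃ M ≠ ⊤, ∀ i, F i ≠ ⊤ → F i ≤ M := by
  classical
  let S : Finset (Fin n) := Finset.univ.filter fun i => F i ≠ ⊤
  by_cases h : S.Nonempty
  · refine ⟨F (S.max' h), (Finset.mem_filter.1 (S.max'_mem h)).2, fun i hi => hF ?_⟩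
    exact S.le_max' _ (Finset.mem_filter.2 ⟨Finset.mem_univ _, hi⟩)
  · refine ⟨⊥, bot_ne_top, fun i hi => absurd ⟨i, ?_⟩ h⟩
    exact Finset.mem_filter.2 ⟨Finset.mem_univ _, hi⟩

/-- A linear map compatible with a chain of subspaces and with two further subspaces. -/
structure IsFlagHom {n : ℕ} {V V' : Type} [AddCommGroup V] [Module k V] [AddCommGroup V']
    [Module k V'] (F : Fin n → Submodule k V) (K L : Submodule k V) (F' : Fin n → Submodule k V')
    (K' L' : Submodule k V') (s : V →ₗ[k] V') : Prop where
  chain : ∀ i, ∀ u ∈ F i, s u ∈ F' i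
  left : ∀ u ∈ K, s u ∈ K'
  right : ∀ u ∈ L, s u ∈ L'

/-- The space is one-dimensional. -/
def IsLineFlag (k : Type) [Field k] (V : Type) [AddCommGroup V] [Module k V] : Prop :=
  ∃ w : V, w ≠ 0 ∧ ∀ u, ∃ c : k, u = c • w

/-- The space is spanned by `x ∈ K` and `y ∈ L`, and the proper nonzero terms of the chain are
spanned by `x + y`; `α` and `β` are multiples of the coordinate functions. -/
def IsPlaneFlag {n : ℕ} {V : Type} [AddCommGroup V] [Module k V] (F : Fin n → Submodule k V)
    (K L : Submodule k V) : Prop :=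
  ∃ (x y : V) (α β : V →ₗ[k] k), x ∈ K ∧ y ∈ L ∧ (∀ u ∈ L, α u = 0) ∧ (∀ u ∈ K, β u = 0) ∧
    (∀ i, F i ≠ ⊤ → ∀ u ∈ F i, α u = β u) ∧ (∀ i, F i ≠ ⊥ → x + y ∈ F i) ∧ α x ≠ 0

theorem exists_dual_ker_ge {V : Type} [AddCommGroup V] [Module k V] {M : Submodule k V}
    (h : M ≠ ⊤) : ∃ φ : V →ₗ[k] k, φ ≠ 0 ∧ ∀ u ∈ M, φ u = 0 := by
  obtain ⟨φ, h1, h2⟩ := Submodule.exists_le_ker_of_lt_top _ (lt_top_iff_ne_top.2 h)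
  exact ⟨φ, h1, fun u hu => h2 hu⟩

theorem isFlagHom_plane {n : ℕ} {V V' : Type} [AddCommGroup V] [Module k V]
    [AddCommGroup V'] [Module k V'] {F : Fin n → Submodule k V} {K L : Submodule k V}
    {F' : Fin n → Submodule k V'} {K' L' : Submodule k V'}
    (ht : ∀ i, F i = ⊤ → F' i = ⊤) (hb : ∀ i, F' i = ⊥ → F i = ⊥) {α β : V →ₗ[k] k}
    (hα : ∀ u ∈ L, α u = 0) (hβ : ∀ u ∈ K, β u = 0)
    (hαβ : ∀ i, F i ≠ ⊤ → ∀ u ∈ F i, α u = β u) {x y : V'} (hx : x ∈ K') (hy : y ∈ L')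
    (hxy : ∀ i, F' i ≠ ⊥ → x + y ∈ F' i) :
    IsFlagHom F K L F' K' L' (α.smulRight x + β.smulRight y) := by
  refine ⟨fun i u hu => ?_, fun u hu => ?_, fun u hu => ?_⟩
  · by_cases h1 : F i = ⊤
    · rw [ht i h1]; trivial
    by_cases h2 : F' i = ⊥
    · rw [hb i h2, Submodule.mem_bot] at hu
      rw [hu, map_zero]
      exact Submodule.zero_mem _
    have h3 : (α.smulRight x + β.smulRight y) u = β u • (x + y) := by
      simp [hαβ i h1 u hu]
    rw [h3]
    exact Submodule.smul_mem _ _ (hxy i h2)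
  · simpa [hβ u hu] using Submodule.smul_mem _ _ hx
  · simpa [hα u hu] using Submodule.smul_mem _ _ hy

theorem isLineFlag_or_isPlaneFlag {n : ℕ} {V : Type} [AddCommGroup V] [Module k V] [Nontrivial V]
    {F : Fin n → Submodule k V} (hF : Monotone F) {K L : Submodule k V}
    (h : ∀ s : V →ₗ[k] V, IsFlagHom F K L F K L s → s ≠ 0 → Function.Injective s) :
    IsLineFlag k V ∨ IsPlaneFlag F K L := by
  by_cases hline : IsLineFlag k V
  · exact Or.inl hline
  right
  obtain ⟨M, hM, hMF⟩ := exists_ne_bot_le_of_chain hF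
  obtain ⟨N, hN, hNF⟩ := exists_ne_top_ge_of_chain hF
  have rank_one : ∀ (φ : V →ₗ[k] k) (w : V), φ ≠ 0 → w ≠ 0 →
      ¬ IsFlagHom F K L F K L (φ.smulRight w) := by
    intro φ w hφ hw hs
    obtain ⟨u, hu⟩ : ∃ u, φ u ≠ 0 := by
      by_contra hc
      push Not at hc
      exact hφ (LinearMap.ext hc)
    have h0 : φ.smulRight w ≠ 0 := fun h0 => by
      have := LinearMap.congr_fun h0 u
      simp [hu, hw] at this
    refine hline ⟨u, fun hu0 => hu (by rw [hu0, map_zero]), fun v => ⟨φ v / φ u, ?_⟩⟩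
    refine h _ hs h0 ?_
    simp [smul_smul, div_mul_cancel₀ _ hu]
  have key1 : ∀ w ∈ M, w ≠ 0 → ∀ φ : V →ₗ[k] k, φ ≠ 0 → (w ∈ K ∨ ∀ u ∈ K, φ u = 0) →
      (w ∈ L ∨ ∀ u ∈ L, φ u = 0) → False := by
    intro w hw hw0 φ hφ hK hL
    have aux : ∀ P : Submodule k V, (w ∈ P ∨ ∀ u ∈ P, φ u = 0) →
        ∀ u ∈ P, (φ.smulRight w) u ∈ P := by
      rintro P (hP | hP) u hu
      · exact P.smul_mem _ hP
      · rw [LinearMap.smulRight_apply, hP u hu, zero_smul]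
        exact P.zero_mem
    refine rank_one φ w hφ hw0 ⟨fun i => aux _ ?_, aux _ hK, aux _ hL⟩
    by_cases hi : F i = ⊥
    · right
      intro u hu
      rw [hi, Submodule.mem_bot] at hu
      rw [hu, map_zero]
    · exact Or.inl (hMF i hi hw)
  have key2 : ∀ (φ : V →ₗ[k] k) (w : V), φ ≠ 0 → w ≠ 0 → (∀ u ∈ N, φ u = 0) → w ∈ K → w ∈ L →
      False := by
    intro φ w hφ hw0 hφN hK hL
    refine rank_one φ w hφ hw0 ⟨fun i u hu => ?_, fun u _ => K.smul_mem _ hK,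
      fun u _ => L.smul_mem _ hL⟩
    by_cases hi : F i = ⊤
    · rw [hi]; trivial
    · rw [LinearMap.smulRight_apply, hφN u (hNF i hi hu), zero_smul]
      exact Submodule.zero_mem _
  obtain ⟨ψ, hψ0, hψN⟩ := exists_dual_ker_ge hN
  have hMK : ∀ w ∈ M, w ∈ K → w = 0 := by
    intro w hw hwK
    by_contra hw0
    by_cases hL : L = ⊤
    · exact key1 w hw hw0 ψ hψ0 (Or.inl hwK) (Or.inl (by rw [hL]; trivial))
    · obtain ⟨φ, hφ, hφL⟩ := exists_dual_ker_ge hL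
      exact key1 w hw hw0 φ hφ (Or.inl hwK) (Or.inr hφL)
  have hML : ∀ w ∈ M, w ∈ L → w = 0 := by
    intro w hw hwL
    by_contra hw0
    by_cases hK : K = ⊤
    · exact key1 w hw hw0 ψ hψ0 (Or.inl (by rw [hK]; trivial)) (Or.inl hwL)
    · obtain ⟨φ, hφ, hφK⟩ := exists_dual_ker_ge hK
      exact key1 w hw hw0 φ hφ (Or.inr hφK) (Or.inl hwL)
  obtain ⟨w, hwM, hw0⟩ := (Submodule.ne_bot_iff M).1 hM
  have hsup : K ⊔ L = ⊤ := by
    by_contra hc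
    obtain ⟨φ, hφ, hφKL⟩ := exists_dual_ker_ge hc
    exact key1 w hwM hw0 φ hφ (Or.inr fun u hu => hφKL u (Submodule.mem_sup_left hu))
      (Or.inr fun u hu => hφKL u (Submodule.mem_sup_right hu))
  have hinf : ∀ u ∈ K, u ∈ L → u = 0 := fun u hK hL => by
    by_contra hu0
    exact key2 ψ u hψ0 hu0 hψN hK hL
  have hc : IsCompl K L := ⟨Submodule.disjoint_def.2 hinf, codisjoint_iff.2 hsup⟩
  have hwKL : w ∈ K ⊔ L := by rw [hsup]; trivial
  obtain ⟨x, hx, y, hy, hxy⟩ := Submodule.mem_sup.1 hwKL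
  have hy0 : y ≠ 0 := by
    rintro rfl
    rw [add_zero] at hxy
    exact hw0 (hMK w hwM (hxy ▸ hx))
  have hx0 : x ≠ 0 := by
    rintro rfl
    rw [zero_add] at hxy
    exact hw0 (hML w hwM (hxy ▸ hy))
  let pK : V →ₗ[k] V := K.projection L hc
  have pK1 : ∀ u ∈ K, pK u = u := fun u hu => Submodule.projection_apply_left hc ⟨u, hu⟩
  have pK2 : ∀ u ∈ L, pK u = 0 := fun u hu => Submodule.projection_apply_right hc ⟨u, hu⟩
  have hα : ∃ α β : V →ₗ[k] k, (∀ u ∈ L, α u = 0) ∧ (∀ u ∈ K, β u = 0) ∧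
      ∀ u, ψ u = α u - β u := by
    refine ⟨ψ ∘ₗ pK, ψ ∘ₗ pK - ψ, fun u hu => ?_, fun u hu => ?_, fun u => ?_⟩
    · simp [pK2 u hu]
    · simp [pK1 u hu]
    · simp
  obtain ⟨α, β, hαL, hβK, hψ⟩ := hα
  have hαβ : ∀ i, F i ≠ ⊤ → ∀ u ∈ F i, α u = β u := fun i hi u hu => by
    rw [← sub_eq_zero, ← hψ]
    exact hψN u (hNF i hi hu)
  have hxyF : ∀ i, F i ≠ ⊥ → x + y ∈ F i := fun i hi => hxy ▸ hMF i hi hwM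
  refine ⟨x, y, α, β, hx, hy, hαL, hβK, hαβ, hxyF, ?_⟩
  let T : V →ₗ[k] V := α.smulRight x + β.smulRight y
  have hT : ∀ u, T u = α u • x + β u • y := fun u => by simp [T]
  have hTF : IsFlagHom F K L F K L T :=
    isFlagHom_plane (fun _ => id) (fun _ => id) hαL hβK hαβ hx hy hxyF
  have hT0 : T ≠ 0 := by
    intro h0
    have h1 : ∀ u, α u • x = 0 ∧ β u • y = 0 := fun u => by
      have h2 : α u • x + β u • y = 0 := by rw [← hT, h0, LinearMap.zero_apply]
      have h3 : α u • x = 0 := by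
        refine hinf _ (Submodule.smul_mem _ _ hx) ?_
        rw [eq_neg_of_add_eq_zero_left h2]
        exact Submodule.neg_mem _ (Submodule.smul_mem _ _ hy)
      refine ⟨h3, ?_⟩
      rwa [h3, zero_add] at h2
    refine hψ0 (LinearMap.ext fun u => ?_)
    rw [hψ, (smul_eq_zero.1 (h1 u).1).resolve_right hx0,
      (smul_eq_zero.1 (h1 u).2).resolve_right hy0, sub_zero, LinearMap.zero_apply]
  intro h1
  refine hx0 (h T hTF hT0 ?_)
  rw [hT, h1, hβK x hx, map_zero, zero_smul, zero_smul, add_zero]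

theorem IsLineFlag.eq_top {V : Type} [AddCommGroup V] [Module k V] (h : IsLineFlag k V)
    {M : Submodule k V} {u : V} (hu : u ∈ M) (hu0 : u ≠ 0) : M = ⊤ := by
  obtain ⟨w, hw, h⟩ := h
  obtain ⟨c, rfl⟩ := h u
  have hc : c ≠ 0 := fun hc => hu0 (by rw [hc, zero_smul])
  refine (Submodule.eq_top_iff').2 fun v => ?_
  obtain ⟨d, rfl⟩ := h v
  rw [← div_mul_cancel₀ d hc, ← smul_smul]
  exact M.smul_mem _ hu

theorem IsLineFlag.exists_dual {V : Type} [AddCommGroup V] [Module k V] (h : IsLineFlag k V) :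
    ∃ (w : V) (φ : V →ₗ[k] k), w ≠ 0 ∧ φ w ≠ 0 := by
  have h' := h
  obtain ⟨w, hw, h⟩ := h
  have hbot : (⊥ : Submodule k V) ≠ ⊤ := fun hb => by
    have h1 : w ∈ (⊥ : Submodule k V) := hb ▸ Submodule.mem_top
    exact hw (by simpa using h1)
  obtain ⟨φ, hφ, -⟩ := exists_dual_ker_ge hbot
  refine ⟨w, φ, hw, fun h0 => hφ (LinearMap.ext fun u => ?_)⟩
  obtain ⟨c, rfl⟩ := h u
  simp [h0]

theorem IsLineFlag.isFlagHom {n : ℕ} {V V' : Type} [AddCommGroup V] [Module k V]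
    [AddCommGroup V'] [Module k V'] {F : Fin n → Submodule k V} {K L : Submodule k V}
    {F' : Fin n → Submodule k V'} {K' L' : Submodule k V'} (h : IsLineFlag k V)
    (ht : ∀ i, F i = ⊤ → F' i = ⊤) (hK : K = ⊤ → K' = ⊤) (hL : L = ⊤ → L' = ⊤)
    (s : V →ₗ[k] V') : IsFlagHom F K L F' K' L' s := by
  have key : ∀ (P : Submodule k V) (P' : Submodule k V'), (P = ⊤ → P' = ⊤) →
      ∀ u ∈ P, s u ∈ P' := by
    intro P P' hP u hu
    by_cases hu0 : u = 0
    · rw [hu0, map_zero]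
      exact P'.zero_mem
    · rw [hP (h.eq_top hu hu0)]
      trivial
  exact ⟨fun i => key _ _ (ht i), key _ _ hK, key _ _ hL⟩

/-- Two bricks among flags of the same type admit maps in both directions with nonzero
composition. -/
theorem exists_isFlagHom_pair {n : ℕ} {V V' : Type} [AddCommGroup V] [Module k V]
    [AddCommGroup V'] [Module k V'] {F : Fin n → Submodule k V} {K L : Submodule k V}
    {F' : Fin n → Submodule k V'} {K' L' : Submodule k V'}
    (ht : ∀ i, F i = ⊤ ↔ F' i = ⊤) (hb : ∀ i, F i = ⊥ ↔ F' i = ⊥) (hK : K = ⊤ ↔ K' = ⊤)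
    (hL : L = ⊤ ↔ L' = ⊤)
    (h : IsLineFlag k V ∧ IsLineFlag k V' ∨ IsPlaneFlag F K L ∧ IsPlaneFlag F' K' L') :
    ∃ (s : V →ₗ[k] V') (s' : V' →ₗ[k] V), IsFlagHom F K L F' K' L' s ∧
      IsFlagHom F' K' L' F K L s' ∧ s' ∘ₗ s ≠ 0 := by
  rcases h with ⟨h, h'⟩ | ⟨h, h'⟩
  · obtain ⟨w, φ, hw, hφ⟩ := h.exists_dual
    obtain ⟨w', φ', hw', hφ'⟩ := h'.exists_dual
    refine ⟨φ.smulRight w', φ'.smulRight w,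
      h.isFlagHom (fun i => (ht i).1) hK.1 hL.1 _, h'.isFlagHom (fun i => (ht i).2) hK.2 hL.2 _,
      fun h0 => ?_⟩
    have := LinearMap.congr_fun h0 w
    simp [hφ, hφ', hw] at this
  · obtain ⟨x, y, α, β, hx, hy, hα, hβ, hαβ, hxy, hαx⟩ := h
    obtain ⟨x', y', α', β', hx', hy', hα', hβ', hαβ', hxy', hαx'⟩ := h'
    refine ⟨_, _, isFlagHom_plane (fun i => (ht i).1) (fun i => (hb i).2) hα hβ hαβ hx' hy' hxy',
      isFlagHom_plane (fun i => (ht i).2) (fun i => (hb i).1) hα' hβ' hαβ' hx hy hxy, fun h0 => ?_⟩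
    have := congrArg α (LinearMap.congr_fun h0 x)
    simp [hβ x hx, hα y hy, hαx, hαx'] at this

end LinearAlgebra

section Classification

theorem exists_linearMap_extension {k ι X X' : Type} [Field k] [Fintype ι] [DecidableEq ι]
    [AddCommGroup X] [Module k X] [AddCommGroup X'] [Module k X'] (Q U : ι → Module.End k X)
    (hQ : ∀ x, ∑ j, Q j x = x) (hQU : ∀ i j x, Q i (U j x) = if i = j then U j x else 0)
    (hU : ∀ j x, ∃ y, U j y = Q j x) (S : ι → X →ₗ[k] X') (hS : ∀ j x, U j x = 0 → S j x = 0) :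
    ∃ T : X →ₗ[k] X', ∀ j x, T (U j x) = S j x := by
  let p : (ι → X) →ₗ[k] X := ∑ j, U j ∘ₗ LinearMap.proj j
  let p' : (ι → X) →ₗ[k] X' := ∑ j, S j ∘ₗ LinearMap.proj j
  have hp : ∀ v, p v = ∑ j, U j (v j) := fun v => by simp [p]
  have hp' : ∀ v, p' v = ∑ j, S j (v j) := fun v => by simp [p']
  have hsurj : Function.Surjective p := fun x => by
    choose v hv using fun j => hU j x
    exact ⟨v, by rw [hp, ← hQ x]; exact Finset.sum_congr rfl fun j _ => hv j⟩
  have hker : ∀ v, p v = 0 → p' v = 0 := fun v hv => by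
    rw [hp']
    refine Finset.sum_eq_zero fun j _ => hS _ _ ?_
    have h1 : Q j (p v) = U j (v j) := by simp [hp, hQU]
    rw [← h1, hv, map_zero]
  obtain ⟨g, hg⟩ := p.exists_rightInverse_of_surjective (LinearMap.range_eq_top.2 hsurj)
  refine ⟨p' ∘ₗ g, fun j x => ?_⟩
  have h1 : p (Pi.single j x) = U j x := by
    rw [hp, Finset.sum_eq_single j]
    · simp
    · intro i _ hi
      simp [Pi.single_eq_of_ne hi]
    · simp
  have h2 : p' (Pi.single j x) = S j x := by
    rw [hp', Finset.sum_eq_single j]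
    · simp
    · intro i _ hi
      simp [Pi.single_eq_of_ne hi]
    · simp
  have h3 : p (g (U j x) - Pi.single j x) = 0 := by
    rw [map_sub, h1, ← LinearMap.comp_apply, hg, LinearMap.id_apply, sub_self]
  have h4 := hker _ h3
  rw [map_sub, h2, sub_eq_zero] at h4
  exact h4

namespace BrickRep

variable {k : Type} [Field k] {n : ℕ} [NeZero n] {X Y : Type} [AddCommGroup X] [Module k X]
  [AddCommGroup Y] [Module k Y] (ρ : BrickRep k n X) (σ : BrickRep k n Y)

/-- There are maps in both directions with nonzero composition. -/
def HomPair : Prop :=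
  ∃ (T : X →ₗ[k] Y) (S : Y →ₗ[k] X), IsHom ρ σ T ∧ IsHom σ ρ S ∧ S ∘ₗ T ≠ 0

theorem G_pow_E (m : ℕ) (l : ZMod n) (x : X) :
    (ρ.G ^ m) (ρ.E l x) = ρ.E (l + m) ((ρ.G ^ m) x) := by
  induction m generalizing l x with
  | zero => simp
  | succ m ih =>
    rw [pow_succ, Module.End.mul_apply, ρ.G_E, ih, Module.End.mul_apply]
    push_cast
    ring_nf

theorem G_pow_eq_zero {m : ℕ} (h : n ≤ m) (x : X) : (ρ.G ^ m) x = 0 := by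
  rw [pow_eq_zero_of_le h ρ.G_pow, LinearMap.zero_apply]

theorem A1_E {l : ZMod n} (hl : l ≠ 0) (x : X) : ρ.A1 (ρ.E l x) = 0 := by
  rw [← ρ.A1_E0, ρ.E_E, if_neg hl.symm, map_zero]

theorem B1_E {l : ZMod n} (hl : l ≠ 0) (x : X) : ρ.B1 (ρ.E l x) = 0 := ρ.swap.A1_E hl x

theorem E_A1 (l : ZMod n) (x : X) : ρ.E l (ρ.A1 x) = 0 := by rw [← ρ.Ea_A1, ρ.E_Ea]

theorem E_B1 (l : ZMod n) (x : X) : ρ.E l (ρ.B1 x) = 0 := ρ.swap.E_A1 l x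

theorem Ea_B1 (x : X) : ρ.Ea (ρ.B1 x) = 0 := by rw [← ρ.Eb_B1, ρ.Ea_Eb]

theorem Eb_A1 (x : X) : ρ.Eb (ρ.A1 x) = 0 := ρ.swap.Ea_B1 x

theorem G_A1 (x : X) : ρ.G (ρ.A1 x) = 0 := by rw [← ρ.Ea_A1, ρ.G_Ea]

theorem G_B1 (x : X) : ρ.G (ρ.B1 x) = 0 := ρ.swap.G_A1 x

theorem A1_Ea (x : X) : ρ.A1 (ρ.Ea x) = 0 := by rw [← ρ.A1_E0, ρ.E_Ea, map_zero]

theorem A1_Eb (x : X) : ρ.A1 (ρ.Eb x) = 0 := by rw [← ρ.A1_E0, ρ.E_Eb, map_zero]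

theorem B1_Ea (x : X) : ρ.B1 (ρ.Ea x) = 0 := ρ.swap.A1_Eb x

/-- The simple representation at the middle vertex of the first cycle is a direct summand. -/
def HasSimpleSummand : Prop :=
  ∃ (y : X) (φ : X →ₗ[k] k), ρ.Ea y = y ∧ φ y = 1 ∧ ∀ x, φ (ρ.A1 x) = 0

/-- The representation given by a path of length `m` that starts at the vertex `i` of the third
cycle is a direct summand. -/
def HasIntervalSummand (i : ZMod n) (m : ℕ) : Prop :=
  ∃ (v : X) (φ : X →ₗ[k] k), ρ.E i v = v ∧ (ρ.G ^ (m + 1)) v = 0 ∧ φ ((ρ.G ^ m) v) = 1 ∧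
    ∀ x, φ ((ρ.G ^ (m + 1)) x) = 0

variable {ρ σ}

theorem HasSimpleSummand.exists_isHom (hρ : HasSimpleSummand ρ) (hσ : HasSimpleSummand σ)
    (hA : ρ.A2 = 0) (hB : ρ.B2 = 0) (hA' : σ.A2 = 0) (hB' : σ.B2 = 0) : HomPair ρ σ := by
  have key : ∀ {X Y : Type} [AddCommGroup X] [Module k X] [AddCommGroup Y] [Module k Y]
      (ρ : BrickRep k n X) (σ : BrickRep k n Y), ρ.A2 = 0 → ρ.B2 = 0 → σ.A2 = 0 → σ.B2 = 0 →
      ∀ (φ : X →ₗ[k] k) (y : Y), (∀ x, φ (ρ.A1 x) = 0) → σ.Ea y = y →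
        IsHom ρ σ ((φ ∘ₗ ρ.Ea).smulRight y) := by
    intro X Y _ _ _ _ ρ σ hA hB hA' hB' φ y hφ hy
    constructor <;> intros <;> rw [LinearMap.smulRight_apply, LinearMap.smulRight_apply, ← hy] <;>
      simp [ρ.Ea_E, σ.E_Ea, ρ.Ea_Ea, σ.Ea_Ea, ρ.Ea_Eb, σ.Eb_Ea, ρ.Ea_A1, hφ, σ.A1_Ea, hA, hB, hA',
        hB', ρ.Ea_B1, σ.B1_Ea, ρ.Ea_G, σ.G_Ea]
  obtain ⟨y, φ, hy, hφy, hφ⟩ := hρ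
  obtain ⟨y', φ', hy', hφy', hφ'⟩ := hσ
  refine ⟨_, _, key ρ σ hA hB hA' hB' φ y' hφ hy', key σ ρ hA' hB' hA hB φ' y hφ' hy, fun h0 => ?_⟩
  have h1 := congrArg φ (LinearMap.congr_fun h0 y)
  simp [hy, hφy, hy', hφy'] at h1

theorem exists_isHom_of_interval (hA : ρ.A2 = 0) (hB : ρ.B2 = 0) (hA' : σ.A2 = 0) (hB' : σ.B2 = 0)
    {i : ZMod n} (hi : i ≠ 0) {m : ℕ} (hm : m < n) {v : X} {φ : X →ₗ[k] k} {v' : Y}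
    (hv : ρ.E i v = v) (hφv : φ ((ρ.G ^ m) v) = 1)
    (hφ : ∀ x, φ ((ρ.G ^ (m + 1)) x) = 0) (hv' : σ.E i v' = v') (hGv' : (σ.G ^ (m + 1)) v' = 0) :
    ∃ T : X →ₗ[k] Y, IsHom ρ σ T ∧ T v = v' := by
  let T : X →ₗ[k] Y := ∑ t ∈ Finset.range (m + 1),
    (φ ∘ₗ (ρ.G ^ (m - t)) ∘ₗ ρ.E (i + t)).smulRight ((σ.G ^ t) v')
  have hT : ∀ x, T x = ∑ t ∈ Finset.range (m + 1),
      φ ((ρ.G ^ (m - t)) (ρ.E (i + t) x)) • (σ.G ^ t) v' := fun x => by simp [T]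
  have hGt : ∀ t : ℕ, (σ.G ^ t) v' = σ.E (i + t) ((σ.G ^ t) v') := fun t => by
    rw [← σ.G_pow_E, hv']
  have zero_right : ∀ D : Module.End k Y, (∀ t, D ((σ.G ^ t) v') = 0) → ∀ x, D (T x) = 0 := by
    intro D hD x
    simp [hT, hD]
  have zero_left : ∀ x, (∀ l, ρ.E l x = 0) → T x = 0 := by
    intro x hx
    simp [hT, hx]
  have hA1 : ∀ t, σ.A1 ((σ.G ^ t) v') = 0 := by
    rintro (_ | t)
    · rw [pow_zero, Module.End.one_apply, ← hv', σ.A1_E hi]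
    · rw [pow_succ', Module.End.mul_apply, σ.A1_G]
  have hB1 : ∀ t, σ.B1 ((σ.G ^ t) v') = 0 := by
    rintro (_ | t)
    · rw [pow_zero, Module.End.one_apply, ← hv', σ.B1_E hi]
    · rw [pow_succ', Module.End.mul_apply, σ.B1_G]
  refine ⟨T, ⟨fun l x => ?_, fun x => ?_, fun x => ?_, fun x => ?_, fun x => ?_, fun x => ?_,
    fun x => ?_, fun x => ?_⟩, ?_⟩
  · rw [hT, hT, map_sum]
    refine Finset.sum_congr rfl fun t _ => ?_
    rw [ρ.E_E, map_smul, hGt, σ.E_E]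
    by_cases h : l = i + t
    · rw [if_pos h, if_pos h.symm, h]
    · rw [if_neg h, if_neg (Ne.symm h), map_zero, map_zero, zero_smul, smul_zero]
  · rw [zero_left _ fun l => ρ.E_Ea l x, zero_right]
    intro t
    rw [hGt, σ.Ea_E]
  · rw [zero_left _ fun l => ρ.E_Eb l x, zero_right]
    intro t
    rw [hGt, σ.Eb_E]
  · rw [zero_left _ fun l => ρ.E_A1 l x, zero_right _ hA1]
  · simp [hA, hA']
  · rw [zero_left _ fun l => ρ.E_B1 l x, zero_right _ hB1]
  · simp [hB, hB']
  · rw [hT, hT, map_sum, Finset.sum_range_succ', Finset.sum_range_succ]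
    have h1 : ρ.G ^ (m + 1) = ρ.G ^ m * ρ.G := pow_succ _ _
    have h2 : φ ((ρ.G ^ (m - 0)) (ρ.E (i + (0 : ℕ)) (ρ.G x))) = 0 := by
      have h3 : ρ.E (i + (0 : ℕ)) (ρ.G x) = ρ.G (ρ.E (i - 1) x) := by
        rw [ρ.G_E]
        simp
      rw [h3, tsub_zero, ← Module.End.mul_apply, ← h1, hφ]
    have h3 : σ.G ((σ.G ^ m) v') = 0 := by
      rw [← Module.End.mul_apply, ← pow_succ', hGv']
    rw [h2, map_smul, h3, zero_smul, smul_zero]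
    congr 1
    refine Finset.sum_congr rfl fun t ht => ?_
    have ht' := Finset.mem_range.1 ht
    have h4 : ρ.E (i + (t + 1 : ℕ)) (ρ.G x) = ρ.G (ρ.E (i + t) x) := by
      rw [ρ.G_E]
      push_cast
      rw [add_assoc]
    have h5 : m - t = m - (t + 1) + 1 := by omega
    rw [h4, map_smul, h5, pow_succ ρ.G, Module.End.mul_apply, pow_succ' σ.G t, Module.End.mul_apply]
  · rw [hT, Finset.sum_eq_single 0]
    · simp [hv, hφv]
    · intro t ht ht0
      have h1 : ρ.E (i + t) v = 0 := by
        rw [← hv, ρ.E_E, if_neg]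
        intro h
        have h2 : (t : ZMod n) = 0 := by simpa using h
        have h3 := Nat.le_of_dvd (Nat.pos_of_ne_zero ht0) ((ZMod.natCast_eq_zero_iff t n).1 h2)
        have := Finset.mem_range.1 ht
        omega
      rw [h1, map_zero, map_zero, zero_smul]
    · simp

theorem HasIntervalSummand.exists_isHom (hA : ρ.A2 = 0) (hB : ρ.B2 = 0) (hA' : σ.A2 = 0)
    (hB' : σ.B2 = 0) {i : ZMod n} (hi : i ≠ 0) {m : ℕ} (hm : m < n)
    (hρ : HasIntervalSummand ρ i m) (hσ : HasIntervalSummand σ i m) : HomPair ρ σ := by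
  obtain ⟨v, φ, hv, hGv, hφv, hφ⟩ := hρ
  obtain ⟨v', φ', hv', hGv', hφv', hφ'⟩ := hσ
  obtain ⟨T, hT, hTv⟩ := exists_isHom_of_interval hA hB hA' hB' hi hm hv hφv hφ hv' hGv'
  obtain ⟨S, hS, hSv⟩ := exists_isHom_of_interval hA' hB' hA hB hi hm hv' hφv' hφ' hv hGv
  refine ⟨T, S, hT, hS, fun h0 => ?_⟩
  have h1 : v = 0 := by
    rw [← hSv, ← hTv]
    exact LinearMap.congr_fun h0 v
  simp [h1] at hφv

theorem exists_dual_eq_one {M : Submodule k X} {x : X} (hx : x ∉ M) :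
    ∃ φ : X →ₗ[k] k, φ x = 1 ∧ ∀ u ∈ M, φ u = 0 := by
  obtain ⟨φ, h1, h2⟩ := Submodule.exists_le_ker_of_notMem hx
  exact ⟨(φ x)⁻¹ • φ, by simp [h1], fun u hu => by simp [LinearMap.mem_ker.1 (h2 hu)]⟩

theorem hasSimpleSummand_of_ne {y : X} (h : ∀ z, ρ.A1 z ≠ ρ.Ea y) : HasSimpleSummand ρ := by
  obtain ⟨φ, h1, h2⟩ := exists_dual_eq_one (M := LinearMap.range ρ.A1) (x := ρ.Ea y)
    (fun ⟨z, hz⟩ => h z hz)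
  exact ⟨_, φ, ρ.Ea_Ea y, h1, fun x => h2 _ ⟨x, rfl⟩⟩

theorem exists_hasIntervalSummand_of_ne {i : ZMod n} {y : X} (h : ∀ z, ρ.G z ≠ ρ.E i y) :
    ∃ m < n, HasIntervalSummand ρ i m := by
  classical
  have hex : ∃ l, ∃ v, ρ.E i v = v ∧ (ρ.G ^ l) v = 0 ∧ ∀ z, ρ.G z ≠ v :=
    ⟨n, ρ.E i y, by rw [ρ.E_E, if_pos rfl], ρ.G_pow_eq_zero le_rfl _, h⟩
  have hle : Nat.find hex ≤ n :=
    Nat.find_min' hex ⟨ρ.E i y, by rw [ρ.E_E, if_pos rfl], ρ.G_pow_eq_zero le_rfl _, h⟩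
  obtain ⟨v, hv, hGv, hvz⟩ := Nat.find_spec hex
  obtain ⟨m, hm⟩ : ∃ m, Nat.find hex = m + 1 := by
    refine Nat.exists_eq_succ_of_ne_zero fun h0 => hvz 0 ?_
    rw [h0] at hGv
    rw [map_zero]
    exact hGv.symm
  rw [hm] at hGv
  refine ⟨m, by omega, ?_⟩
  obtain ⟨φ, h1, h2⟩ := exists_dual_eq_one (M := LinearMap.range (ρ.G ^ (m + 1)))
    (x := (ρ.G ^ m) v) (by
      rintro ⟨z, hz⟩
      refine Nat.find_min hex (m := m) (by omega) ⟨v - ρ.G (ρ.E (i - 1) z), ?_, ?_, ?_⟩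
      · rw [map_sub, hv, ρ.G_E, ρ.E_E, if_pos (sub_add_cancel i 1).symm]
      · rw [map_sub, ← Module.End.mul_apply, ← pow_succ, ρ.G_pow_E, hz]
        have h1 : i - 1 + ((m + 1 : ℕ) : ZMod n) = i + m := by
          push_cast
          ring
        rw [h1, ← ρ.G_pow_E, hv, sub_self]
      · intro u hu
        refine hvz (u + ρ.E (i - 1) z) ?_
        rw [map_add, hu, sub_add_cancel])
  exact ⟨v, φ, hv, hGv, h1, fun x => h2 _ ⟨x, rfl⟩⟩

end BrickRep
end Classification

section Classification

namespace BrickRep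

variable {k : Type} [Field k] {n : ℕ} [NeZero n] {X Y : Type} [AddCommGroup X] [Module k X]
  [AddCommGroup Y] [Module k Y] (ρ : BrickRep k n X) (σ : BrickRep k n Y)

/-- The representation is generated by its space at the central vertex. -/
structure IsGeneratedAtZero : Prop where
  a : ∀ x, ∃ z, ρ.A1 z = ρ.Ea x
  b : ∀ x, ∃ z, ρ.B1 z = ρ.Eb x
  c : ∀ l : ZMod n, l ≠ 0 → ∀ x, ∃ z, ρ.G z = ρ.E l x

/-- The projections to the spaces at the vertices. -/
def vertexProj : ZMod n ⊕ Bool → Module.End k X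
  | Sum.inl l => ρ.E l
  | Sum.inr false => ρ.Ea
  | Sum.inr true => ρ.Eb

/-- The actions of the paths that start at the central vertex. -/
def pathOp : ZMod n ⊕ Bool → Module.End k X
  | Sum.inl l => ρ.G ^ l.val * ρ.E 0
  | Sum.inr false => ρ.A1
  | Sum.inr true => ρ.B1

theorem pathOp_inl (l : ZMod n) (x : X) : ρ.pathOp (Sum.inl l) x = (ρ.G ^ l.val) (ρ.E 0 x) := rfl

theorem pathOp_inl_eq (l : ZMod n) (x : X) :
    ρ.pathOp (Sum.inl l) x = ρ.E l ((ρ.G ^ l.val) x) := by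
  rw [pathOp_inl, ρ.G_pow_E, zero_add, ZMod.natCast_zmod_val]

theorem sum_vertexProj (x : X) : ∑ j, ρ.vertexProj j x = x := by
  rw [Fintype.sum_sum_type, Fintype.sum_bool]
  simp only [vertexProj]
  rw [add_comm (ρ.Eb x), ← add_assoc, ρ.sum_eq]

theorem vertexProj_pathOp (i j : ZMod n ⊕ Bool) (x : X) :
    ρ.vertexProj i (ρ.pathOp j x) = if i = j then ρ.pathOp j x else 0 := by
  rcases i with l | _ | _ <;> rcases j with m | _ | _ <;>
    simp [vertexProj, pathOp_inl_eq, ρ.E_E, ρ.Ea_E, ρ.Eb_E] <;>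
    simp [pathOp, ρ.E_A1, ρ.E_B1, ρ.Ea_A1, ρ.Eb_A1, ρ.Ea_B1, ρ.Eb_B1]

variable {ρ σ}

theorem IsGeneratedAtZero.exists_pathOp (h : IsGeneratedAtZero ρ) (j : ZMod n ⊕ Bool) (x : X) :
    ∃ y, ρ.pathOp j y = ρ.vertexProj j x := by
  rcases j with l | _ | _
  · have key : ∀ m : ℕ, m < n → ∀ x, ∃ y, (ρ.G ^ m) (ρ.E 0 y) = ρ.E (m : ZMod n) x := by
      intro m
      induction m with
      | zero => exact fun _ x => ⟨x, by simp⟩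
      | succ m ih =>
        intro hm x
        have h0 : ((m + 1 : ℕ) : ZMod n) ≠ 0 := fun h0 => by
          have := Nat.le_of_dvd (Nat.succ_pos m) ((ZMod.natCast_eq_zero_iff _ _).1 h0)
          omega
        obtain ⟨z, hz⟩ := h.c _ h0 x
        obtain ⟨y, hy⟩ := ih (by omega) z
        refine ⟨y, ?_⟩
        rw [pow_succ', Module.End.mul_apply, hy, ρ.G_E, hz, ρ.E_E]
        push_cast
        rw [if_pos rfl]
    obtain ⟨y, hy⟩ := key l.val l.val_lt x
    refine ⟨y, ?_⟩
    rw [pathOp_inl, hy, ZMod.natCast_zmod_val]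
    rfl
  · exact h.a x
  · exact h.b x

theorem IsGeneratedAtZero.map_op (h : IsGeneratedAtZero ρ) {T S : X →ₗ[k] Y}
    {D : Module.End k X} {D' : Module.End k Y} (c : ZMod n ⊕ Bool → Option (ZMod n ⊕ Bool))
    (hT : ∀ j x, T (ρ.pathOp j x) = σ.pathOp j (S x))
    (hD : ∀ j x, D (ρ.pathOp j x) = (c j).elim 0 fun i => ρ.pathOp i x)
    (hD' : ∀ j x, D' (σ.pathOp j x) = (c j).elim 0 fun i => σ.pathOp i x) (x : X) :
    T (D x) = D' (T x) := by
  rw [← ρ.sum_vertexProj x]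
  simp only [map_sum]
  refine Finset.sum_congr rfl fun j _ => ?_
  obtain ⟨y, hy⟩ := h.exists_pathOp j x
  rw [← hy, hD, hT, hD']
  cases c j with
  | none => exact map_zero T
  | some i => exact hT i y

variable (ρ) in
theorem vertexProj_pathOp' (i j : ZMod n ⊕ Bool) (x : X) :
    ρ.vertexProj i (ρ.pathOp j x) =
      (if i = j then some j else none : Option _).elim 0 fun i => ρ.pathOp i x := by
  rw [vertexProj_pathOp]
  split_ifs <;> rfl

variable (ρ) in
theorem A1_A1 (x : X) : ρ.A1 (ρ.A1 x) = 0 := by rw [← ρ.Ea_A1 x, ρ.A1_Ea]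

variable (ρ) in
theorem A1_B1 (x : X) : ρ.A1 (ρ.B1 x) = 0 := by rw [← ρ.Eb_B1, ρ.A1_Eb]

variable (ρ) in
theorem B1_A1 (x : X) : ρ.B1 (ρ.A1 x) = 0 := ρ.swap.A1_B1 x

variable (ρ) in
theorem B1_B1 (x : X) : ρ.B1 (ρ.B1 x) = 0 := ρ.swap.A1_A1 x

variable (ρ) in
theorem A1_pathOp (j : ZMod n ⊕ Bool) (x : X) :
    ρ.A1 (ρ.pathOp j x) =
      (if j = Sum.inl 0 then some (Sum.inr false) else none : Option _).elim 0
        fun i => ρ.pathOp i x := by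
  rcases j with l | _ | _
  · by_cases hl : l = 0
    · subst hl
      simp [pathOp, ρ.A1_E0]
    · simp [hl, pathOp_inl_eq, ρ.A1_E hl]
  · simp [pathOp, ρ.A1_A1]
  · simp [pathOp, ρ.A1_B1]

variable (ρ) in
theorem B1_pathOp (j : ZMod n ⊕ Bool) (x : X) :
    ρ.B1 (ρ.pathOp j x) =
      (if j = Sum.inl 0 then some (Sum.inr true) else none : Option _).elim 0
        fun i => ρ.pathOp i x := by
  rcases j with l | _ | _
  · by_cases hl : l = 0
    · subst hl
      simp [pathOp, ρ.B1_E0]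
    · simp [hl, pathOp_inl_eq, ρ.B1_E hl]
  · simp [pathOp, ρ.B1_A1]
  · simp [pathOp, ρ.B1_B1]

variable (ρ) in
theorem G_pathOp (j : ZMod n ⊕ Bool) (x : X) :
    ρ.G (ρ.pathOp j x) =
      (j.elim (fun l => if l.val + 1 < n then some (Sum.inl (l + 1)) else none) fun _ => none :
        Option _).elim 0 fun i => ρ.pathOp i x := by
  rcases j with l | _ | _
  · have h1 : ρ.G (ρ.pathOp (Sum.inl l) x) = (ρ.G ^ (l.val + 1)) (ρ.E 0 x) := by
      rw [pow_succ', Module.End.mul_apply, pathOp_inl]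
    rw [h1]
    by_cases hl : l.val + 1 < n
    · have h2 : (l + 1).val = l.val + 1 := by
        conv_lhs => rw [← ZMod.natCast_zmod_val l]
        rw [← Nat.cast_succ, ZMod.val_natCast_of_lt hl]
      simp [hl, pathOp_inl, h2]
    · rw [ρ.G_pow_eq_zero (by omega)]
      simp [hl]
  · simp [pathOp, ρ.G_A1]
  · simp [pathOp, ρ.G_B1]

theorem IsGeneratedAtZero.isHom (h : IsGeneratedAtZero ρ) (hA : ρ.A2 = 0) (hB : ρ.B2 = 0)
    (hA' : σ.A2 = 0) (hB' : σ.B2 = 0) {T S : X →ₗ[k] Y}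
    (hT : ∀ j x, T (ρ.pathOp j x) = σ.pathOp j (S x)) : IsHom ρ σ T where
  E l := h.map_op _ hT (ρ.vertexProj_pathOp' (Sum.inl l)) (σ.vertexProj_pathOp' (Sum.inl l))
  Ea := h.map_op _ hT (ρ.vertexProj_pathOp' (Sum.inr false)) (σ.vertexProj_pathOp' (Sum.inr false))
  Eb := h.map_op _ hT (ρ.vertexProj_pathOp' (Sum.inr true)) (σ.vertexProj_pathOp' (Sum.inr true))
  A1 := h.map_op _ hT ρ.A1_pathOp σ.A1_pathOp
  A2 x := by simp [hA, hA']
  B1 := h.map_op _ hT ρ.B1_pathOp σ.B1_pathOp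
  B2 x := by simp [hB, hB']
  G := h.map_op _ hT ρ.G_pathOp σ.G_pathOp

variable (ρ) in
/-- The space at the central vertex. -/
abbrev central : Submodule k X := LinearMap.range (ρ.E 0)

variable (ρ) in
/-- The elements at the central vertex killed by a given operator. -/
def kerAt (D : Module.End k X) : Submodule k ρ.central := (LinearMap.ker D).comap (Submodule.subtype _)

theorem mem_kerAt {D : Module.End k X} {u : ρ.central} : u ∈ ρ.kerAt D ↔ D u = 0 := Iff.rfl

theorem E_zero_central (u : ρ.central) : ρ.E 0 (u : X) = u := by
  obtain ⟨_, x, rfl⟩ := u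
  exact (ρ.E_E 0 0 x).trans (if_pos rfl)

variable (ρ) in
/-- The chain of kernels of the powers of `G`. -/
def chain (i : Fin n) : Submodule k ρ.central := ρ.kerAt (ρ.G ^ (i : ℕ))

variable (ρ) in
theorem chain_monotone : Monotone ρ.chain := fun i j hij u hu => by
  rw [chain, mem_kerAt] at *
  obtain ⟨d, hd⟩ := Nat.exists_eq_add_of_le' (show (i : ℕ) ≤ j from hij)
  rw [hd, pow_add, Module.End.mul_apply, hu, map_zero]

theorem IsGeneratedAtZero.exists_isHom (h : IsGeneratedAtZero ρ) (hA : ρ.A2 = 0) (hB : ρ.B2 = 0)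
    (hA' : σ.A2 = 0) (hB' : σ.B2 = 0) {s : ρ.central →ₗ[k] σ.central}
    (hs : IsFlagHom ρ.chain (ρ.kerAt ρ.A1) (ρ.kerAt ρ.B1) σ.chain (σ.kerAt σ.A1) (σ.kerAt σ.B1) s) :
    ∃ T : X →ₗ[k] Y, IsHom ρ σ T ∧ ∀ u : ρ.central, T u = s u := by
  let S : X →ₗ[k] Y := Submodule.subtype _ ∘ₗ s ∘ₗ (ρ.E 0).rangeRestrict
  have hS : ∀ x, S x = s ((ρ.E 0).rangeRestrict x) := fun _ => rfl
  have hSE : ∀ x, σ.E 0 (S x) = S x := fun x => E_zero_central _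
  obtain ⟨T, hT⟩ := exists_linearMap_extension ρ.vertexProj ρ.pathOp ρ.sum_vertexProj
    ρ.vertexProj_pathOp h.exists_pathOp (fun j => σ.pathOp j ∘ₗ S) (by
      rintro (l | _ | _) x hx
      · have h1 := hs.chain ⟨l.val, l.val_lt⟩ ((ρ.E 0).rangeRestrict x) hx
        have h2 : (σ.G ^ l.val) (S x) = 0 := h1
        rw [LinearMap.comp_apply, pathOp_inl, hSE, h2]
      · exact hs.left ((ρ.E 0).rangeRestrict x) ((ρ.A1_E0 x).trans hx)
      · exact hs.right ((ρ.E 0).rangeRestrict x) ((ρ.B1_E0 x).trans hx))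
  refine ⟨T, h.isHom hA hB hA' hB' hT, fun u => ?_⟩
  have h1 := hT (Sum.inl 0) u
  simp only [LinearMap.comp_apply, pathOp_inl, ZMod.val_zero, pow_zero, Module.End.one_apply, hSE,
    E_zero_central] at h1
  rw [h1, hS]
  congr 2
  exact Subtype.ext (E_zero_central u)

theorem IsGeneratedAtZero.isLineFlag_or_isPlaneFlag (h : IsGeneratedAtZero ρ) (hA : ρ.A2 = 0)
    (hB : ρ.B2 = 0) (hρ : IsBrick ρ) :
    IsLineFlag k ρ.central ∨ IsPlaneFlag ρ.chain (ρ.kerAt ρ.A1) (ρ.kerAt ρ.B1) := by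
  have : Nontrivial ρ.central := by
    rw [Submodule.nontrivial_iff_ne_bot]
    intro h0
    have h1 : ∀ x, ρ.E 0 x = 0 := fun x => by
      have h2 : ρ.E 0 x ∈ ρ.central := ⟨x, rfl⟩
      rwa [h0, Submodule.mem_bot] at h2
    obtain ⟨x, hx⟩ := @exists_ne X hρ.1 0
    refine hx ?_
    rw [← ρ.sum_vertexProj x]
    refine Finset.sum_eq_zero fun j _ => ?_
    obtain ⟨y, hy⟩ := h.exists_pathOp j x
    rw [← hy]
    rcases j with l | _ | _
    · rw [pathOp_inl, h1, map_zero]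
    · rw [pathOp, ← ρ.A1_E0, h1, map_zero]
    · rw [pathOp, ← ρ.B1_E0, h1, map_zero]
  refine _root_.isLineFlag_or_isPlaneFlag ρ.chain_monotone fun s hs h0 => ?_
  obtain ⟨T, hT, hTs⟩ := h.exists_isHom hA hB hA hB hs
  have hinj := hρ.2 T hT fun hT0 => h0 (LinearMap.ext fun u => Subtype.ext (by
    rw [← hTs, hT0]
    rfl))
  intro u v huv
  refine Subtype.ext (hinj ?_)
  rw [hTs, hTs, huv]

/-- The invariants that distinguish the bricks on which `α₂` and `β₂` vanish. -/
abbrev LowerType (n : ℕ) : Type :=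
  Bool ⊕ (ZMod n × Fin n) ⊕ (Bool × (Fin n → Prop) × (Fin n → Prop) × Prop × Prop)

variable (ρ) in
/-- The bricks of a given type. -/
def HasLowerType : LowerType n → Prop
  | Sum.inl false => HasSimpleSummand ρ
  | Sum.inl true => HasSimpleSummand ρ.swap
  | Sum.inr (Sum.inl (i, m)) => i ≠ 0 ∧ HasIntervalSummand ρ i m
  | Sum.inr (Sum.inr (c, t, b, p, q)) => IsGeneratedAtZero ρ ∧
      (c = true → IsLineFlag k ρ.central) ∧
      (c = false → IsPlaneFlag ρ.chain (ρ.kerAt ρ.A1) (ρ.kerAt ρ.B1)) ∧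
      (∀ i, ρ.chain i = ⊤ ↔ t i) ∧ (∀ i, ρ.chain i = ⊥ ↔ b i) ∧ (ρ.kerAt ρ.A1 = ⊤ ↔ p) ∧
      (ρ.kerAt ρ.B1 = ⊤ ↔ q)

theorem exists_hasLowerType (hρ : IsBrick ρ) (hA : ρ.A2 = 0) (hB : ρ.B2 = 0) :
    ∃ d, HasLowerType ρ d := by
  by_cases ha : ∀ x, ∃ z, ρ.A1 z = ρ.Ea x
  swap
  · push Not at ha
    obtain ⟨y, hy⟩ := ha
    exact ⟨Sum.inl false, hasSimpleSummand_of_ne hy⟩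
  by_cases hb : ∀ x, ∃ z, ρ.B1 z = ρ.Eb x
  swap
  · push Not at hb
    obtain ⟨y, hy⟩ := hb
    exact ⟨Sum.inl true, hasSimpleSummand_of_ne (ρ := ρ.swap) hy⟩
  by_cases hc : ∀ l : ZMod n, l ≠ 0 → ∀ x, ∃ z, ρ.G z = ρ.E l x
  swap
  · push Not at hc
    obtain ⟨l, hl, y, hy⟩ := hc
    obtain ⟨m, hm, h⟩ := exists_hasIntervalSummand_of_ne hy
    exact ⟨Sum.inr (Sum.inl (l, ⟨m, hm⟩)), hl, h⟩
  have hg : IsGeneratedAtZero ρ := ⟨ha, hb, hc⟩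
  rcases hg.isLineFlag_or_isPlaneFlag hA hB hρ with h | h
  · exact ⟨Sum.inr (Sum.inr (true, _, _, _, _)), hg, fun _ => h, nofun, fun _ => Iff.rfl,
      fun _ => Iff.rfl, Iff.rfl, Iff.rfl⟩
  · exact ⟨Sum.inr (Sum.inr (false, _, _, _, _)), hg, nofun, fun _ => h, fun _ => Iff.rfl,
      fun _ => Iff.rfl, Iff.rfl, Iff.rfl⟩

theorem HasLowerType.homPair {d : LowerType n} (hρ : HasLowerType ρ d) (hσ : HasLowerType σ d)
    (hA : ρ.A2 = 0) (hB : ρ.B2 = 0) (hA' : σ.A2 = 0) (hB' : σ.B2 = 0) : HomPair ρ σ := by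
  rcases d with (_ | _) | ⟨i, m⟩ | ⟨c, t, b, p, q⟩
  · exact HasSimpleSummand.exists_isHom hρ hσ hA hB hA' hB'
  · obtain ⟨T, S, hT, hS, h⟩ := HasSimpleSummand.exists_isHom (ρ := ρ.swap) (σ := σ.swap) hρ hσ
      hB hA hB' hA'
    exact ⟨T, S, hT.swap, hS.swap, h⟩
  · exact HasIntervalSummand.exists_isHom hA hB hA' hB' hρ.1 m.2 hρ.2 hσ.2
  · obtain ⟨hg, hl, hp, h1, h2, h3, h4⟩ := hρ
    obtain ⟨hg', hl', hp', h1', h2', h3', h4'⟩ := hσ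
    obtain ⟨s, s', hs, hs', h⟩ := exists_isFlagHom_pair (fun i => (h1 i).trans (h1' i).symm)
      (fun i => (h2 i).trans (h2' i).symm) (h3.trans h3'.symm) (h4.trans h4'.symm)
      (by
        cases c
        · exact Or.inr ⟨hp rfl, hp' rfl⟩
        · exact Or.inl ⟨hl rfl, hl' rfl⟩)
    obtain ⟨T, hT, hTs⟩ := hg.exists_isHom hA hB hA' hB' hs
    obtain ⟨S, hS, hSs⟩ := hg'.exists_isHom hA' hB' hA hB hs'
    refine ⟨T, S, hT, hS, fun h0 => h (LinearMap.ext fun u => Subtype.ext ?_)⟩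
    rw [LinearMap.comp_apply, ← hSs, ← hTs]
    exact LinearMap.congr_fun h0 u

variable (ρ) in
/-- The bricks of a given type; the two summands stand for the bricks on which `α₂` and `β₂`
vanish and for those on which `α₁` and `β₁` vanish. -/
def HasType : LowerType n ⊕ LowerType n → Prop
  | Sum.inl d => ρ.A2 = 0 ∧ ρ.B2 = 0 ∧ HasLowerType ρ d
  | Sum.inr d => ρ.A1 = 0 ∧ ρ.B1 = 0 ∧ HasLowerType ρ.dual d

theorem dual_A2_eq_zero (h : ρ.A1 = 0) : ρ.dual.A2 = 0 := by
  ext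
  simp [h]

theorem dual_B2_eq_zero (h : ρ.B1 = 0) : ρ.dual.B2 = 0 := by
  ext
  simp [h]

theorem HasType.exists_bijective [FiniteDimensional k X] [FiniteDimensional k Y]
    {d : LowerType n ⊕ LowerType n} (hρ : IsBrick ρ) (hσ : IsBrick σ) (hd : HasType ρ d)
    (hd' : HasType σ d) : ∃ T : X →ₗ[k] Y, IsHom ρ σ T ∧ Function.Bijective T := by
  rcases d with d | d
  · obtain ⟨hA, hB, hd⟩ := hd
    obtain ⟨hA', hB', hd'⟩ := hd'
    obtain ⟨T, S, hT, hS, h⟩ := hd.homPair hd' hA hB hA' hB'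
    exact ⟨T, hT, hρ.bijective hσ hT hS h⟩
  · obtain ⟨hA, hB, hd⟩ := hd
    obtain ⟨hA', hB', hd'⟩ := hd'
    obtain ⟨T, S, hT, hS, h⟩ := hd'.homPair hd (dual_A2_eq_zero hA') (dual_B2_eq_zero hB')
      (dual_A2_eq_zero hA) (dual_B2_eq_zero hB)
    obtain ⟨T', hT', rfl⟩ := hT.of_dual
    exact ⟨T', hT', LinearMap.dualMap_bijective_iff.1 (hσ.dual.bijective hρ.dual hT hS h)⟩

/-- Either the second or the first arrows of both cycles act as zero on a brick. -/
theorem IsBrick.arrows_eq_zero (hρ : IsBrick ρ) : (ρ.A2 = 0 ∧ ρ.B2 = 0) ∨ (ρ.A1 = 0 ∧ ρ.B1 = 0) := by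
  let M : Submodule k X := LinearMap.range ρ.A2 ⊔ LinearMap.range ρ.B2 ⊔
    LinearMap.range (ρ.E 0 * ρ.G)
  have hMA : ∀ x, ρ.A2 x ∈ M := fun x =>
    Submodule.mem_sup_left (Submodule.mem_sup_left ⟨x, rfl⟩)
  have hMB : ∀ x, ρ.B2 x ∈ M := fun x =>
    Submodule.mem_sup_left (Submodule.mem_sup_right ⟨x, rfl⟩)
  have hMG : ∀ x, ρ.E 0 (ρ.G x) ∈ M := fun x => Submodule.mem_sup_right ⟨x, rfl⟩
  have key : ∀ w, w ∈ M → w ≠ 0 → ρ.E 0 w = w → ρ.A1 w = 0 → ρ.B1 w = 0 → ρ.G w = 0 →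
      ρ.A1 = 0 ∧ ρ.B1 = 0 := by
    intro w hwM hw0 hw hAw hBw hGw
    have hM : ∀ x, ρ.E 0 x ∈ M := by
      intro x
      by_contra hx
      obtain ⟨φ, h1, h2⟩ := exists_dual_eq_one hx
      have hEa : ρ.Ea w = 0 := by rw [← hw, ρ.Ea_E]
      have hEb : ρ.Eb w = 0 := by rw [← hw, ρ.Eb_E]
      have hA2 : ρ.A2 w = 0 := by rw [← ρ.A2_Ea, hEa, map_zero]
      have hB2 : ρ.B2 w = 0 := by rw [← ρ.B2_Eb, hEb, map_zero]
      let T : X →ₗ[k] X := (φ ∘ₗ ρ.E 0).smulRight w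
      have hT : ∀ x, T x = φ (ρ.E 0 x) • w := fun _ => rfl
      have hTh : IsHom ρ ρ T := by
        constructor
        · intro l y
          rw [hT, hT, ρ.E_E, map_smul]
          by_cases hl : l = 0
          · rw [hl, if_pos rfl, hw]
          · rw [if_neg (Ne.symm hl), ← hw, ρ.E_E, if_neg hl, map_zero, zero_smul, smul_zero]
        all_goals intro y; rw [hT, hT, map_smul]
        · rw [ρ.E_Ea, map_zero, zero_smul, hEa, smul_zero]
        · rw [ρ.E_Eb, map_zero, zero_smul, hEb, smul_zero]
        · rw [ρ.E_A1, map_zero, zero_smul, hAw, smul_zero]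
        · rw [ρ.E0_A2, h2 _ (hMA y), zero_smul, hA2, smul_zero]
        · rw [ρ.E_B1, map_zero, zero_smul, hBw, smul_zero]
        · rw [ρ.E0_B2, h2 _ (hMB y), zero_smul, hB2, smul_zero]
        · rw [h2 _ (hMG y), zero_smul, hGw, smul_zero]
      have hT0 : T ≠ 0 := fun h0 => by
        have h3 : T x = 0 := by rw [h0, LinearMap.zero_apply]
        rw [hT, h1, one_smul] at h3
        exact hw0 h3
      refine hw0 (hρ.2 T hTh hT0 ?_)
      rw [hT, hw, h2 w hwM, zero_smul, map_zero]
    have vanish : ∀ D : Module.End k X, (∀ x, D (ρ.A2 x) = 0) → (∀ x, D (ρ.B2 x) = 0) →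
        (∀ x, D (ρ.E 0 (ρ.G x)) = 0) → ∀ x, D (ρ.E 0 x) = 0 := by
      intro D h1 h2 h3 x
      have h4 : M ≤ LinearMap.ker D := by
        refine sup_le (sup_le ?_ ?_) ?_
        · rintro _ ⟨y, rfl⟩
          exact h1 y
        · rintro _ ⟨y, rfl⟩
          exact h2 y
        · rintro _ ⟨y, rfl⟩
          exact h3 y
      exact h4 (hM x)
    constructor
    · ext x
      rw [← ρ.A1_E0, vanish ρ.A1 ρ.A1_A2 ρ.A1_B2 fun y => by rw [ρ.A1_E0, ρ.A1_G]]
      rfl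
    · ext x
      rw [← ρ.B1_E0, vanish ρ.B1 ρ.B1_A2 ρ.B1_B2 fun y => by rw [ρ.B1_E0, ρ.B1_G]]
      rfl
  by_cases hA : ρ.A2 = 0
  · by_cases hB : ρ.B2 = 0
    · exact Or.inl ⟨hA, hB⟩
    · obtain ⟨x, hx⟩ := DFunLike.ne_iff.1 hB
      exact Or.inr (key _ (hMB x) hx (ρ.E0_B2 x) (ρ.A1_B2 x) (ρ.B1_B2 x) (ρ.G_B2 x))
  · obtain ⟨x, hx⟩ := DFunLike.ne_iff.1 hA
    exact Or.inr (key _ (hMA x) hx (ρ.E0_A2 x) (ρ.A1_A2 x) (ρ.B1_A2 x) (ρ.G_A2 x))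

theorem IsBrick.exists_hasType [FiniteDimensional k X] (hρ : IsBrick ρ) : ∃ d, HasType ρ d := by
  rcases hρ.arrows_eq_zero with ⟨h1, h2⟩ | ⟨h1, h2⟩
  · obtain ⟨d, hd⟩ := exists_hasLowerType hρ h1 h2
    exact ⟨Sum.inl d, h1, h2, hd⟩
  · obtain ⟨d, hd⟩ := exists_hasLowerType hρ.dual (dual_A2_eq_zero h1) (dual_B2_eq_zero h2)
    exact ⟨Sum.inr d, h1, h2, hd⟩

end BrickRep
end Classification

section Generators

theorem mul_pow_shift {n : ℕ} {A : Type} [Ring A] {e : ZMod n → A} {G : A}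
    (h : ∀ l, e l * G = G * e (l + 1)) (m : ℕ) (l : ZMod n) :
    e l * G ^ m = G ^ m * e (l + m) := by
  induction m generalizing l with
  | zero => simp
  | succ m ih =>
    rw [pow_succ', ← mul_assoc, h, mul_assoc, ih, ← mul_assoc]
    push_cast
    ring_nf

/-- Elements of an algebra that satisfy the defining relations of `Γ(n)`: the trivial paths, the
arrows `α₁, α₂, β₁, β₂` and the sum `G` of the arrows `γ_l`. -/
structure GamGens (k : Type) [Field k] (n : ℕ) [NeZero n] (A : Type) [Ring A] [Algebra k A] where
  e : ZMod n → A
  ea : A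
  eb : A
  a1 : A
  a2 : A
  b1 : A
  b2 : A
  G : A
  e_e : ∀ l m, e l * e m = if l = m then e l else 0
  ea_ea : ea * ea = ea
  eb_eb : eb * eb = eb
  e_ea : ∀ l, e l * ea = 0
  ea_e : ∀ l, ea * e l = 0
  e_eb : ∀ l, e l * eb = 0
  eb_e : ∀ l, eb * e l = 0
  ea_eb : ea * eb = 0
  eb_ea : eb * ea = 0
  sum_eq : ∑ l, e l + ea + eb = 1
  e_G : ∀ l, e l * G = G * e (l + 1)
  ea_G : ea * G = 0
  G_ea : G * ea = 0
  eb_G : eb * G = 0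
  G_eb : G * eb = 0
  e0_a1 : e 0 * a1 = a1
  a1_ea : a1 * ea = a1
  ea_a2 : ea * a2 = a2
  a2_e0 : a2 * e 0 = a2
  e0_b1 : e 0 * b1 = b1
  b1_eb : b1 * eb = b1
  eb_b2 : eb * b2 = b2
  b2_e0 : b2 * e 0 = b2
  G_a1 : G * a1 = 0
  G_b1 : G * b1 = 0
  a2_G : a2 * G = 0
  b2_G : b2 * G = 0
  a2_b1 : a2 * b1 = 0
  b2_a1 : b2 * a1 = 0
  a1_a2 : a1 * a2 = e 0 * G ^ (2 * n)
  b1_b2 : b1 * b2 = e 0 * G ^ (2 * n)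
  G_pow : G ^ (2 * n + 1) = 0
  eq_top : ∀ M : Submodule k A, 1 ∈ M → (∀ l, ∀ x ∈ M, x * e l ∈ M) → (∀ x ∈ M, x * ea ∈ M) →
    (∀ x ∈ M, x * eb ∈ M) → (∀ x ∈ M, x * a1 ∈ M) → (∀ x ∈ M, x * a2 ∈ M) →
    (∀ x ∈ M, x * b1 ∈ M) → (∀ x ∈ M, x * b2 ∈ M) → (∀ x ∈ M, x * G ∈ M) → M = ⊤

namespace GamGens

variable {k : Type} [Field k] {n : ℕ} [NeZero n] {A : Type} [Ring A] [Algebra k A]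
  (g : GamGens k n A)

/-- The same elements with the roles of the first two cycles exchanged. -/
def swap : GamGens k n A where
  e := g.e
  ea := g.eb
  eb := g.ea
  a1 := g.b1
  a2 := g.b2
  b1 := g.a1
  b2 := g.a2
  G := g.G
  e_e := g.e_e
  ea_ea := g.eb_eb
  eb_eb := g.ea_ea
  e_ea := g.e_eb
  ea_e := g.eb_e
  e_eb := g.e_ea
  eb_e := g.ea_e
  ea_eb := g.eb_ea
  eb_ea := g.ea_eb
  sum_eq := by rw [add_right_comm, g.sum_eq]
  e_G := g.e_G
  ea_G := g.eb_G
  G_ea := g.G_eb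
  eb_G := g.ea_G
  G_eb := g.G_ea
  e0_a1 := g.e0_b1
  a1_ea := g.b1_eb
  ea_a2 := g.eb_b2
  a2_e0 := g.b2_e0
  e0_b1 := g.e0_a1
  b1_eb := g.a1_ea
  eb_b2 := g.ea_a2
  b2_e0 := g.a2_e0
  G_a1 := g.G_b1
  G_b1 := g.G_a1
  a2_G := g.b2_G
  b2_G := g.a2_G
  a2_b1 := g.b2_a1
  b2_a1 := g.a2_b1
  a1_a2 := g.b1_b2
  b1_b2 := g.a1_a2
  G_pow := g.G_pow
  eq_top M h1 h2 h3 h4 h5 h6 h7 h8 h9 := g.eq_top M h1 h2 h4 h3 h7 h8 h5 h6 h9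

theorem e_a1 (l : ZMod n) : g.e l * g.a1 = if l = 0 then g.a1 else 0 := by
  rw [← g.e0_a1, ← mul_assoc, g.e_e]
  split_ifs with h
  · rw [h]
  · rw [zero_mul]

theorem a1_e (l : ZMod n) : g.a1 * g.e l = 0 := by rw [← g.a1_ea, mul_assoc, g.ea_e, mul_zero]

theorem ea_a1 : g.ea * g.a1 = 0 := by rw [← g.e0_a1, ← mul_assoc, g.ea_e, zero_mul]

theorem eb_a1 : g.eb * g.a1 = 0 := by rw [← g.e0_a1, ← mul_assoc, g.eb_e, zero_mul]

theorem a1_eb : g.a1 * g.eb = 0 := by rw [← g.a1_ea, mul_assoc, g.ea_eb, mul_zero]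

theorem a1_G : g.a1 * g.G = 0 := by rw [← g.a1_ea, mul_assoc, g.ea_G, mul_zero]

theorem e_a2 (l : ZMod n) : g.e l * g.a2 = 0 := by rw [← g.ea_a2, ← mul_assoc, g.e_ea, zero_mul]

theorem a2_e (l : ZMod n) : g.a2 * g.e l = if l = 0 then g.a2 else 0 := by
  rw [← g.a2_e0, mul_assoc, g.e_e]
  split_ifs with h1 h2 h2
  · rfl
  · exact absurd h1.symm h2
  · exact absurd h2.symm h1
  · rw [mul_zero]

theorem eb_a2 : g.eb * g.a2 = 0 := by rw [← g.ea_a2, ← mul_assoc, g.eb_ea, zero_mul]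

theorem a2_ea : g.a2 * g.ea = 0 := by rw [← g.a2_e0, mul_assoc, g.e_ea, mul_zero]

theorem a2_eb : g.a2 * g.eb = 0 := by rw [← g.a2_e0, mul_assoc, g.e_eb, mul_zero]

theorem G_a2 : g.G * g.a2 = 0 := by rw [← g.ea_a2, ← mul_assoc, g.G_ea, zero_mul]

theorem eb_b1 : g.eb * g.b1 = 0 := g.swap.ea_a1

theorem ea_b1 : g.ea * g.b1 = 0 := g.swap.eb_a1

theorem ea_b2 : g.ea * g.b2 = 0 := g.swap.eb_a2

theorem e_b1 (l : ZMod n) : g.e l * g.b1 = if l = 0 then g.b1 else 0 := g.swap.e_a1 l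

theorem e_b2 (l : ZMod n) : g.e l * g.b2 = 0 := g.swap.e_a2 l

theorem b1_e (l : ZMod n) : g.b1 * g.e l = 0 := g.swap.a1_e l

theorem b2_e (l : ZMod n) : g.b2 * g.e l = if l = 0 then g.b2 else 0 := g.swap.a2_e l

theorem b1_ea : g.b1 * g.ea = 0 := g.swap.a1_eb

theorem b2_ea : g.b2 * g.ea = 0 := g.swap.a2_eb

theorem b2_eb : g.b2 * g.eb = 0 := g.swap.a2_ea

theorem b1_G : g.b1 * g.G = 0 := g.swap.a1_G

theorem G_b2 : g.G * g.b2 = 0 := g.swap.G_a2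

theorem a1_mul_eq_zero {x : A} (hx : g.ea * x = 0) : g.a1 * x = 0 := by
  rw [← g.a1_ea, mul_assoc, hx, mul_zero]

theorem a2_mul_eq_zero {x : A} (hx : g.e 0 * x = 0) : g.a2 * x = 0 := by
  rw [← g.a2_e0, mul_assoc, hx, mul_zero]

theorem a1_a1 : g.a1 * g.a1 = 0 := g.a1_mul_eq_zero g.ea_a1

theorem a1_b1 : g.a1 * g.b1 = 0 := g.a1_mul_eq_zero g.ea_b1

theorem a1_b2 : g.a1 * g.b2 = 0 := g.a1_mul_eq_zero g.ea_b2

theorem a2_a2 : g.a2 * g.a2 = 0 := g.a2_mul_eq_zero (g.e_a2 0)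

theorem a2_b2 : g.a2 * g.b2 = 0 := g.a2_mul_eq_zero (g.e_b2 0)

theorem b1_b1 : g.b1 * g.b1 = 0 := g.swap.a1_a1

theorem b1_a1 : g.b1 * g.a1 = 0 := g.swap.a1_b1

theorem b1_a2 : g.b1 * g.a2 = 0 := g.swap.a1_b2

theorem b2_b2 : g.b2 * g.b2 = 0 := g.swap.a2_a2

theorem b2_a2 : g.b2 * g.a2 = 0 := g.swap.a2_b2

theorem G_pow_mul {m : ℕ} (hm : m ≠ 0) {x : A} (hx : g.G * x = 0) : g.G ^ m * x = 0 := by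
  obtain ⟨m, rfl⟩ := Nat.exists_eq_succ_of_ne_zero hm
  rw [pow_succ, mul_assoc, hx, mul_zero]

theorem mul_G_pow {m : ℕ} (hm : m ≠ 0) {x : A} (hx : x * g.G = 0) : x * g.G ^ m = 0 := by
  obtain ⟨m, rfl⟩ := Nat.exists_eq_succ_of_ne_zero hm
  rw [pow_succ', ← mul_assoc, hx, zero_mul]

theorem two_mul_ne_zero : 2 * n ≠ 0 := mul_ne_zero two_ne_zero (NeZero.ne n)

theorem a2_a1_a2 : g.a2 * g.a1 * g.a2 = 0 := by
  rw [mul_assoc, g.a1_a2, ← mul_assoc, g.a2_e0, g.mul_G_pow two_mul_ne_zero g.a2_G]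

theorem a1_a2_a1 : g.a1 * (g.a2 * g.a1) = 0 := by
  rw [← mul_assoc, g.a1_a2, mul_assoc, g.G_pow_mul two_mul_ne_zero g.G_a1, mul_zero]

theorem e_G_pow (m : ℕ) (l : ZMod n) : g.e l * g.G ^ m = g.G ^ m * g.e (l + m) :=
  mul_pow_shift g.e_G m l

theorem mul_comm_of_forall {z : A} (h1 : ∀ l, g.e l * z = z * g.e l) (h2 : g.ea * z = z * g.ea)
    (h3 : g.eb * z = z * g.eb) (h4 : g.a1 * z = z * g.a1) (h5 : g.a2 * z = z * g.a2)
    (h6 : g.b1 * z = z * g.b1) (h7 : g.b2 * z = z * g.b2) (h8 : g.G * z = z * g.G) (a : A) :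
    a * z = z * a := by
  let M : Submodule k A := LinearMap.eqLocus (LinearMap.mulRight k z) (LinearMap.mulLeft k z)
  have key : ∀ u, u * z = z * u → ∀ x ∈ M, x * u ∈ M := by
    intro u hu x hx
    have hx' : x * z = z * x := hx
    show x * u * z = z * (x * u)
    rw [mul_assoc, hu, ← mul_assoc, hx', mul_assoc]
  have hM : M = ⊤ := g.eq_top M (by show 1 * z = z * 1; rw [one_mul, mul_one])
    (fun l => key _ (h1 l)) (key _ h2) (key _ h3) (key _ h4) (key _ h5) (key _ h6) (key _ h7)
    (key _ h8)
  have ha : a ∈ M := hM ▸ Submodule.mem_top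
  exact ha

theorem G_pow_central (a : A) : a * g.G ^ n = g.G ^ n * a := by
  have hn := NeZero.ne n
  refine g.mul_comm_of_forall (fun l => ?_) ?_ ?_ ?_ ?_ ?_ ?_ ?_ a
  · rw [g.e_G_pow, ZMod.natCast_self, add_zero]
  · rw [g.mul_G_pow hn g.ea_G, g.G_pow_mul hn g.G_ea]
  · rw [g.mul_G_pow hn g.eb_G, g.G_pow_mul hn g.G_eb]
  · rw [g.mul_G_pow hn g.a1_G, g.G_pow_mul hn g.G_a1]
  · rw [g.mul_G_pow hn g.a2_G, g.G_pow_mul hn g.G_a2]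
  · rw [g.mul_G_pow hn g.b1_G, g.G_pow_mul hn g.G_b1]
  · rw [g.mul_G_pow hn g.b2_G, g.G_pow_mul hn g.G_b2]
  · rw [← pow_succ, ← pow_succ']

theorem a2_a1_central (a : A) : a * (g.a2 * g.a1) = g.a2 * g.a1 * a := by
  refine g.mul_comm_of_forall (fun l => ?_) ?_ ?_ ?_ ?_ ?_ ?_ ?_ a
  · rw [← mul_assoc, g.e_a2, mul_assoc, g.a1_e, zero_mul, mul_zero]
  · rw [← mul_assoc, g.ea_a2, mul_assoc, g.a1_ea]
  · rw [← mul_assoc, g.eb_a2, mul_assoc, g.a1_eb, zero_mul, mul_zero]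
  · rw [g.a1_a2_a1, mul_assoc, g.a1_a1, mul_zero]
  · rw [g.a2_a1_a2, ← mul_assoc, g.a2_a2, zero_mul]
  · rw [← mul_assoc, g.b1_a2, mul_assoc, g.a1_b1, mul_zero, zero_mul]
  · rw [← mul_assoc, g.b2_a2, mul_assoc, g.a1_b2, mul_zero, zero_mul]
  · rw [← mul_assoc, g.G_a2, mul_assoc, g.a1_G, mul_zero, zero_mul]

theorem isNilpotent_G_pow : IsNilpotent (g.G ^ n) := by
  refine ⟨3, ?_⟩
  rw [← pow_mul]
  exact pow_eq_zero_of_le (by have := NeZero.pos n; omega) g.G_pow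

theorem isNilpotent_a2_a1 : IsNilpotent (g.a2 * g.a1) :=
  ⟨2, by rw [pow_two, ← mul_assoc, g.a2_a1_a2, zero_mul]⟩

/-- A finite set that spans the algebra. -/
def spanningSet : Set A :=
  (Set.range fun p : ZMod n × Fin (2 * n + 1) => g.e p.1 * g.G ^ (p.2 : ℕ)) ∪
    {g.ea, g.eb, g.a1, g.a2, g.b1, g.b2, g.a2 * g.a1, g.b2 * g.b1}

theorem finite_spanningSet : g.spanningSet.Finite :=
  (Set.finite_range _).union (by simp)

theorem e_G_pow_mem (l : ZMod n) (m : ℕ) :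
    g.e l * g.G ^ m ∈ Submodule.span k g.spanningSet := by
  by_cases hm : m < 2 * n + 1
  · exact Submodule.subset_span (Or.inl ⟨(l, ⟨m, hm⟩), rfl⟩)
  · rw [pow_eq_zero_of_le (not_lt.1 hm) g.G_pow, mul_zero]
    exact Submodule.zero_mem _

theorem span_spanningSet : Submodule.span k g.spanningSet = ⊤ := by
  have hspan := fun {x} (hx : x ∈ g.spanningSet) =>
    (Submodule.subset_span hx : x ∈ Submodule.span k g.spanningSet)
  have mem : g.ea ∈ Submodule.span k g.spanningSet ∧ g.eb ∈ Submodule.span k g.spanningSet ∧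
      g.a1 ∈ Submodule.span k g.spanningSet ∧ g.a2 ∈ Submodule.span k g.spanningSet ∧
      g.b1 ∈ Submodule.span k g.spanningSet ∧ g.b2 ∈ Submodule.span k g.spanningSet ∧
      g.a2 * g.a1 ∈ Submodule.span k g.spanningSet ∧
      g.b2 * g.b1 ∈ Submodule.span k g.spanningSet := by
    refine ⟨?_, ?_, ?_, ?_, ?_, ?_, ?_, ?_⟩ <;>
      exact hspan (by simp [spanningSet])
  obtain ⟨m1, m2, m3, m4, m5, m6, m7, m8⟩ := mem
  have he : ∀ l, g.e l ∈ Submodule.span k g.spanningSet := fun l => by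
    simpa using g.e_G_pow_mem l 0
  have zero := Submodule.zero_mem (Submodule.span k g.spanningSet)
  have key : ∀ u : A, (∀ l m, g.e l * g.G ^ m * u ∈ Submodule.span k g.spanningSet) →
      g.ea * u ∈ Submodule.span k g.spanningSet → g.eb * u ∈ Submodule.span k g.spanningSet →
      g.a1 * u ∈ Submodule.span k g.spanningSet → g.a2 * u ∈ Submodule.span k g.spanningSet →
      g.b1 * u ∈ Submodule.span k g.spanningSet → g.b2 * u ∈ Submodule.span k g.spanningSet →
      g.a2 * (g.a1 * u) ∈ Submodule.span k g.spanningSet →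
      g.b2 * (g.b1 * u) ∈ Submodule.span k g.spanningSet →
      ∀ x ∈ Submodule.span k g.spanningSet, x * u ∈ Submodule.span k g.spanningSet := by
    intro u h1 h2 h3 h4 h5 h6 h7 h8 h9
    suffices h : Submodule.span k g.spanningSet ≤
        (Submodule.span k g.spanningSet).comap (LinearMap.mulRight k u) from h
    rw [Submodule.span_le]
    rintro x (⟨⟨l, m⟩, rfl⟩ | rfl | rfl | rfl | rfl | rfl | rfl | rfl | rfl)
    · exact h1 l m
    · exact h2
    · exact h3
    · exact h4
    · exact h5
    · exact h6
    · exact h7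
    · rw [← mul_assoc] at h8
      exact h8
    · rw [← mul_assoc] at h9
      exact h9
  have mono : ∀ u : A, g.G * u = 0 → (∀ l, g.e l * u ∈ Submodule.span k g.spanningSet) →
      ∀ l m, g.e l * g.G ^ m * u ∈ Submodule.span k g.spanningSet := by
    rintro u hu h l (_ | m)
    · simpa using h l
    · rw [mul_assoc, g.G_pow_mul (Nat.succ_ne_zero m) hu, mul_zero]
      exact zero
  refine g.eq_top _ ?_ (fun l => key _ ?_ ?_ ?_ ?_ ?_ ?_ ?_ ?_ ?_)
    (key _ (mono _ g.G_ea fun l => ?_) ?_ ?_ ?_ ?_ ?_ ?_ ?_ ?_)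
    (key _ (mono _ g.G_eb fun l => ?_) ?_ ?_ ?_ ?_ ?_ ?_ ?_ ?_)
    (key _ (mono _ g.G_a1 fun l => ?_) ?_ ?_ ?_ ?_ ?_ ?_ ?_ ?_)
    (key _ (mono _ g.G_a2 fun l => ?_) ?_ ?_ ?_ ?_ ?_ ?_ ?_ ?_)
    (key _ (mono _ g.G_b1 fun l => ?_) ?_ ?_ ?_ ?_ ?_ ?_ ?_ ?_)
    (key _ (mono _ g.G_b2 fun l => ?_) ?_ ?_ ?_ ?_ ?_ ?_ ?_ ?_)
    (key _ (fun l m => ?_) ?_ ?_ ?_ ?_ ?_ ?_ ?_ ?_)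
  · rw [← g.sum_eq]
    exact Submodule.add_mem _ (Submodule.add_mem _ (Submodule.sum_mem _ fun l _ => he l) m1) m2
  · intro i m
    have h1 : g.e l = g.e (l - m + m) := by rw [sub_add_cancel]
    rw [mul_assoc, h1, ← g.e_G_pow, ← mul_assoc, g.e_e]
    split_ifs
    · exact g.e_G_pow_mem i m
    · rw [zero_mul]
      exact zero
  all_goals
    try simp only [e_a1, a1_e, ea_a1, eb_a1, a1_eb, a1_G, e_a2, a2_e, eb_a2, a2_ea, a2_eb,
      e_b1, b1_e, ea_b1, eb_b1, b1_ea, b1_G, e_b2, b2_e, ea_b2, b2_ea, b2_eb, a1_a1, a1_b1,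
      a1_b2, a2_a2, a2_b2, b1_b1, b1_a1, b1_a2, b2_b2, b2_a2, g.ea_ea, g.eb_eb, g.e_ea, g.ea_e,
      g.e_eb, g.eb_e, g.ea_eb, g.eb_ea, g.ea_G, g.eb_G, g.a1_ea, g.ea_a2, g.b1_eb, g.eb_b2,
      g.a2_G, g.b2_G, g.a2_b1, g.b2_a1, mul_zero]
    first
      | assumption
      | (split_ifs <;> assumption)
      | skip
  · rw [g.a1_a2]
    exact g.e_G_pow_mem 0 _
  · rw [← mul_assoc, g.a2_a1_a2]
    exact zero
  · rw [g.b1_b2]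
    exact g.e_G_pow_mem 0 _
  · rw [← mul_assoc, show g.b2 * g.b1 * g.b2 = 0 from g.swap.a2_a1_a2]
    exact zero
  · rw [mul_assoc, ← pow_succ]
    exact g.e_G_pow_mem _ _

end GamGens
end Generators

section BrickModules

/-- A central nilpotent element annihilates every brick. -/
theorem Brick.op_smul_eq_zero {A X : Type} [Ring A] [AddCommGroup X] [Module Aᵐᵒᵖ X]
    (h : Brick Aᵐᵒᵖ X) {z : A} (hz : ∀ a, a * z = z * a) (hn : IsNilpotent z) (x : X) :
    op z • x = 0 := by
  let f : X →ₗ[Aᵐᵒᵖ] X :=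
    { toFun := fun x => op z • x
      map_add' := smul_add _
      map_smul' := fun r x => by
        show op z • op r.unop • x = op r.unop • op z • x
        rw [op_smul_op_smul, op_smul_op_smul, hz] }
  by_cases hf : f = 0
  · exact LinearMap.congr_fun hf x
  · obtain ⟨m, hm⟩ := hn
    have hinj : Function.Injective f := h.2 f hf
    have hpow : ∀ (m : ℕ) (x : X), f^[m] x = op (z ^ m) • x := by
      intro m
      induction m with
      | zero => intro x; simp
      | succ m ih =>
        intro x
        rw [Function.iterate_succ_apply, ih, pow_succ']
        exact op_smul_op_smul _ _ _
    refine hinj.iterate m ?_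
    rw [hpow, hpow, hm, MulOpposite.op_zero, zero_smul, zero_smul]

namespace GamGens

variable {k : Type} [Field k] {n : ℕ} [NeZero n] {A : Type} [Ring A] [Algebra k A]
  (g : GamGens k n A) {X Y : Type} [AddCommGroup X] [Module Aᵐᵒᵖ X]

theorem G_pow_smul (h : Brick Aᵐᵒᵖ X) {m : ℕ} (hm : n ≤ m) (x : X) : op (g.G ^ m) • x = 0 := by
  obtain ⟨j, rfl⟩ := Nat.exists_eq_add_of_le hm
  rw [pow_add, ← op_smul_op_smul, h.op_smul_eq_zero g.G_pow_central g.isNilpotent_G_pow, smul_zero]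

theorem e0_G_pow_smul (h : Brick Aᵐᵒᵖ X) (x : X) : op (g.e 0 * g.G ^ (2 * n)) • x = 0 := by
  rw [← op_smul_op_smul, g.G_pow_smul h (by omega)]

variable [Module k X] [IsScalarTower k Aᵐᵒᵖ X] [AddCommGroup Y] [Module k Y] [Module Aᵐᵒᵖ Y]
  [IsScalarTower k Aᵐᵒᵖ Y]

/-- The representation given by a brick. -/
def brickRep (h : Brick Aᵐᵒᵖ X) : BrickRep k n X where
  E l := Algebra.lsmul k k X (op (g.e l))
  Ea := Algebra.lsmul k k X (op g.ea)
  Eb := Algebra.lsmul k k X (op g.eb)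
  A1 := Algebra.lsmul k k X (op g.a1)
  A2 := Algebra.lsmul k k X (op g.a2)
  B1 := Algebra.lsmul k k X (op g.b1)
  B2 := Algebra.lsmul k k X (op g.b2)
  G := Algebra.lsmul k k X (op g.G)
  E_E l m x := by
    simp only [Algebra.lsmul_coe, op_smul_op_smul, g.e_e]
    split_ifs with h1 h2 h2
    · rfl
    · exact absurd h1.symm h2
    · exact absurd h2.symm h1
    · rw [MulOpposite.op_zero, zero_smul]
  Ea_Ea x := by simp only [Algebra.lsmul_coe, op_smul_op_smul, g.ea_ea]
  Eb_Eb x := by simp only [Algebra.lsmul_coe, op_smul_op_smul, g.eb_eb]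
  E_Ea l x := by simp [op_smul_op_smul, g.ea_e]
  Ea_E l x := by simp [op_smul_op_smul, g.e_ea]
  E_Eb l x := by simp [op_smul_op_smul, g.eb_e]
  Eb_E l x := by simp [op_smul_op_smul, g.e_eb]
  Ea_Eb x := by simp [op_smul_op_smul, g.eb_ea]
  Eb_Ea x := by simp [op_smul_op_smul, g.ea_eb]
  sum_eq x := by
    simp only [Algebra.lsmul_coe]
    rw [← Finset.sum_smul, ← add_smul, ← add_smul, ← Finset.op_sum, ← MulOpposite.op_add,
      ← MulOpposite.op_add, g.sum_eq, op_one, one_smul]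
  G_E l x := by simp only [Algebra.lsmul_coe, op_smul_op_smul, g.e_G]
  G_Ea x := by simp [op_smul_op_smul, g.ea_G]
  Ea_G x := by simp [op_smul_op_smul, g.G_ea]
  G_Eb x := by simp [op_smul_op_smul, g.eb_G]
  Eb_G x := by simp [op_smul_op_smul, g.G_eb]
  G_pow := by
    rw [← map_pow, ← op_pow]
    ext x
    exact g.G_pow_smul h le_rfl x
  A1_E0 x := by simp only [Algebra.lsmul_coe, op_smul_op_smul, g.e0_a1]
  Ea_A1 x := by simp only [Algebra.lsmul_coe, op_smul_op_smul, g.a1_ea]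
  A2_Ea x := by simp only [Algebra.lsmul_coe, op_smul_op_smul, g.ea_a2]
  E0_A2 x := by simp only [Algebra.lsmul_coe, op_smul_op_smul, g.a2_e0]
  B1_E0 x := by simp only [Algebra.lsmul_coe, op_smul_op_smul, g.e0_b1]
  Eb_B1 x := by simp only [Algebra.lsmul_coe, op_smul_op_smul, g.b1_eb]
  B2_Eb x := by simp only [Algebra.lsmul_coe, op_smul_op_smul, g.eb_b2]
  E0_B2 x := by simp only [Algebra.lsmul_coe, op_smul_op_smul, g.b2_e0]
  A1_G x := by simp [op_smul_op_smul, g.G_a1]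
  B1_G x := by simp [op_smul_op_smul, g.G_b1]
  G_A2 x := by simp [op_smul_op_smul, g.a2_G]
  G_B2 x := by simp [op_smul_op_smul, g.b2_G]
  A1_A2 x := by
    simp only [Algebra.lsmul_coe, op_smul_op_smul]
    exact h.op_smul_eq_zero g.a2_a1_central g.isNilpotent_a2_a1 x
  A1_B2 x := by simp [op_smul_op_smul, g.b2_a1]
  B1_A2 x := by simp [op_smul_op_smul, g.a2_b1]
  B1_B2 x := by
    simp only [Algebra.lsmul_coe, op_smul_op_smul]
    exact h.op_smul_eq_zero g.swap.a2_a1_central g.swap.isNilpotent_a2_a1 x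
  A2_A1 x := by
    simp only [Algebra.lsmul_coe, op_smul_op_smul, g.a1_a2]
    exact g.e0_G_pow_smul h x
  B2_B1 x := by
    simp only [Algebra.lsmul_coe, op_smul_op_smul, g.b1_b2]
    exact g.e0_G_pow_smul h x

theorem map_op_smul (hX : Brick Aᵐᵒᵖ X) (hY : Brick Aᵐᵒᵖ Y) {T : X →ₗ[k] Y}
    (hT : BrickRep.IsHom (g.brickRep hX) (g.brickRep hY) T) (a : Aᵐᵒᵖ) (x : X) :
    T (a • x) = a • T x := by
  let M : Submodule k A :=
    { carrier := {a | ∀ x, T (op a • x) = op a • T x}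
      add_mem' := fun {a b} ha hb x => by
        rw [MulOpposite.op_add, add_smul, map_add, ha, hb, add_smul]
      zero_mem' := fun x => by simp
      smul_mem' := fun c a ha x => by
        rw [MulOpposite.op_smul, smul_assoc, map_smul, ha, smul_assoc] }
  have key : ∀ u : A, (∀ x, T (op u • x) = op u • T x) → ∀ a ∈ M, a * u ∈ M := by
    intro u hu a ha x
    rw [← op_smul_op_smul, hu, ha, op_smul_op_smul]
  have hM : M = ⊤ := g.eq_top M (fun x => by simp) (fun l => key _ (hT.E l)) (key _ hT.Ea)
    (key _ hT.Eb) (key _ hT.A1) (key _ hT.A2) (key _ hT.B1) (key _ hT.B2) (key _ hT.G)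
  have ha : a.unop ∈ M := hM ▸ Submodule.mem_top
  exact ha x

theorem isBrick_brickRep (h : Brick Aᵐᵒᵖ X) : BrickRep.IsBrick (g.brickRep h) := by
  refine ⟨h.1, fun T hT h0 => ?_⟩
  let T' : X →ₗ[Aᵐᵒᵖ] X := { T with map_smul' := g.map_op_smul h h hT }
  refine h.2 T' fun hT' => h0 ?_
  ext x
  exact LinearMap.congr_fun hT' x

include g in
theorem moduleFinite : Module.Finite k A :=
  ⟨Submodule.fg_def.2 ⟨_, g.finite_spanningSet, g.span_spanningSet⟩⟩

end GamGens

theorem isScalarTower_compHom {k B X : Type} [Field k] [Ring B] [Algebra k B] [AddCommGroup X]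
    [Module B X] :
    letI : Module k X := Module.compHom X (algebraMap k B)
    IsScalarTower k B X := by
  let _ : Module k X := Module.compHom X (algebraMap k B)
  refine ⟨fun c b x => ?_⟩
  show (c • b) • x = algebraMap k B c • b • x
  rw [smul_smul, Algebra.smul_def]

theorem GamGens.tauTiltingFinite {k : Type} [Field k] {n : ℕ} [NeZero n] {A : Type} [Ring A]
    [Algebra k A] (g : GamGens k n A) : TauTiltingFinite k A := by
  have _ : Module.Finite k A := g.moduleFinite
  have _ : Module.Finite k Aᵐᵒᵖ := module_finite_op
  let mod (X : ModuleCat.{0} Aᵐᵒᵖ) : Module k X := Module.compHom X (algebraMap k Aᵐᵒᵖ)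
  have tower (X : ModuleCat.{0} Aᵐᵒᵖ) : IsScalarTower k Aᵐᵒᵖ X := isScalarTower_compHom
  refine tauTiltingFinite_of_bricks (D := BrickRep.LowerType n ⊕ BrickRep.LowerType n)
    (fun d X => Module.Finite Aᵐᵒᵖ X ∧ ∃ h : Brick Aᵐᵒᵖ X, BrickRep.HasType (g.brickRep h) d) ?_ ?_
  · rintro d X Y ⟨hX, hbX, hdX⟩ ⟨hY, hbY, hdY⟩
    have _ : Module.Finite k X := Module.Finite.trans Aᵐᵒᵖ X
    have _ : Module.Finite k Y := Module.Finite.trans Aᵐᵒᵖ Y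
    obtain ⟨T, hT, hbij⟩ := BrickRep.HasType.exists_bijective (g.isBrick_brickRep hbX)
      (g.isBrick_brickRep hbY) hdX hdY
    exact ⟨LinearEquiv.ofBijective { T with map_smul' := g.map_op_smul hbX hbY hT } hbij⟩
  · intro X hX hb
    have _ : Module.Finite k X := Module.Finite.trans Aᵐᵒᵖ X
    obtain ⟨d, hd⟩ := (g.isBrick_brickRep hb).exists_hasType
    exact ⟨d, hX, hb, hd⟩

end BrickModules

section Presentation

theorem triV3_zero (p q r : ℕ) : triV3 p q r 0 = none := dif_pos rfl

theorem triV3_of_ne (p q r : ℕ) {l : ZMod r} (h : l ≠ 0) :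
    triV3 p q r l = some (Sum.inr (Sum.inr ⟨l, h⟩)) := dif_neg h

theorem triV3_injective (p q r : ℕ) : Function.Injective (triV3 p q r) := by
  intro i j h
  by_cases hi : i = 0 <;> by_cases hj : j = 0
  · rw [hi, hj]
  · rw [hi, triV3_zero, triV3_of_ne p q r hj] at h
    exact absurd h.symm (Option.some_ne_none _)
  · rw [hj, triV3_zero, triV3_of_ne p q r hi] at h
    exact absurd h (Option.some_ne_none _)
  · rw [triV3_of_ne p q r hi, triV3_of_ne p q r hj] at h
    exact congrArg Subtype.val (Sum.inr_injective (Sum.inr_injective (Option.some_injective _ h)))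

/-- The vertices of `Δ(2,2,n)`. -/
def vertexMap (n : ℕ) : ZMod n ⊕ Bool → TriV 2 2 n
  | Sum.inl l => triV3 2 2 n l
  | Sum.inr false => triV1 2 2 n 1
  | Sum.inr true => triV2 2 2 n 1

theorem triV1_one (p q r : ℕ) [Fact (1 < p)] :
    triV1 p q r 1 = some (Sum.inl ⟨1, one_ne_zero⟩) := dif_neg _

theorem triV2_one (p q r : ℕ) [Fact (1 < q)] :
    triV2 p q r 1 = some (Sum.inr (Sum.inl ⟨1, one_ne_zero⟩)) := dif_neg _

theorem triV3_ne_triV1 (p q r : ℕ) [Fact (1 < p)] (l : ZMod r) :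
    triV3 p q r l ≠ triV1 p q r 1 := by
  rw [triV1_one]
  by_cases h : l = 0
  · rw [h, triV3_zero]
    exact (Option.some_ne_none _).symm
  · rw [triV3_of_ne p q r h]
    exact fun h => Sum.inr_ne_inl (Option.some_injective _ h)

theorem triV3_ne_triV2 (p q r : ℕ) [Fact (1 < q)] (l : ZMod r) :
    triV3 p q r l ≠ triV2 p q r 1 := by
  rw [triV2_one]
  by_cases h : l = 0
  · rw [h, triV3_zero]
    exact (Option.some_ne_none _).symm
  · rw [triV3_of_ne p q r h]
    exact fun h => Sum.inr_ne_inl (Sum.inr_injective (Option.some_injective _ h))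

theorem triV1_ne_triV2 (p q r : ℕ) [Fact (1 < p)] [Fact (1 < q)] :
    triV1 p q r 1 ≠ triV2 p q r 1 := by
  rw [triV1_one, triV2_one]
  exact fun h => Sum.inl_ne_inr (Option.some_injective _ h)

instance : Fact (1 < 2) := ⟨one_lt_two⟩

theorem vertexMap_bijective (n : ℕ) : Function.Bijective (vertexMap n) := by
  constructor
  · rintro (i | _ | _) (j | _ | _) h
    · rw [triV3_injective 2 2 n h]
    · exact absurd h (triV3_ne_triV1 2 2 n i)
    · exact absurd h (triV3_ne_triV2 2 2 n i)
    · exact absurd h.symm (triV3_ne_triV1 2 2 n j)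
    · rfl
    · exact absurd h (triV1_ne_triV2 2 2 n)
    · exact absurd h.symm (triV3_ne_triV2 2 2 n j)
    · exact absurd h.symm (triV1_ne_triV2 2 2 n)
    · rfl
  · have two : ∀ i : ZMod 2, i ≠ 0 → i = 1 := by decide
    rintro (_ | ⟨i, hi⟩ | ⟨i, hi⟩ | ⟨i, hi⟩)
    · exact ⟨Sum.inl 0, dif_pos rfl⟩
    · obtain rfl := two i hi
      exact ⟨Sum.inr false, triV1_one 2 2 n⟩
    · obtain rfl := two i hi
      exact ⟨Sum.inr true, triV2_one 2 2 n⟩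
    · exact ⟨Sum.inl i, dif_neg hi⟩

namespace GamAlg

variable (k : Type) [Field k] (n : ℕ) (hn : 0 < n)

/-- The projection onto `Γ(n)`. -/
def quo : FreeAlgebra k (TriV 2 2 n ⊕ TriE 2 2 n) →ₐ[k] GamAlg k n hn :=
  have : NeZero n := ⟨hn.ne'⟩
  RingQuot.mkAlgHom k (quivRel k (triSrc 2 2 n) (triTgt 2 2 n) (GamRelExtra k n))

theorem quo_surjective : Function.Surjective (quo k n hn) := by
  have : NeZero n := ⟨hn.ne'⟩
  exact RingQuot.mkAlgHom_surjective k _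

theorem quo_rel [NeZero n] {x y : FreeAlgebra k (TriV 2 2 n ⊕ TriE 2 2 n)}
    (h : quivRel k (triSrc 2 2 n) (triTgt 2 2 n) (GamRelExtra k n) x y) :
    quo k n hn x = quo k n hn y :=
  RingQuot.mkAlgHom_rel k h

theorem quo_extra {x y : FreeAlgebra k (TriV 2 2 n ⊕ TriE 2 2 n)}
    (h : GamRelExtra k n x y) : quo k n hn x = quo k n hn y := by
  have : NeZero n := ⟨hn.ne'⟩
  exact quo_rel k n hn (Or.inr (Or.inr (Or.inr (Or.inr h))))

/-- The trivial path at a vertex. -/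
def vtx (v : TriV 2 2 n) : GamAlg k n hn := quo k n hn (FreeAlgebra.ι k (Sum.inl v))

/-- The class of an arrow. -/
def arr (a : TriE 2 2 n) : GamAlg k n hn := quo k n hn (FreeAlgebra.ι k (Sum.inr a))

theorem vtx_mul_vtx (v w : TriV 2 2 n) :
    vtx k n hn v * vtx k n hn w = if v = w then vtx k n hn v else 0 := by
  have : NeZero n := ⟨hn.ne'⟩
  rw [vtx, vtx, ← map_mul, quo_rel k n hn (Or.inl ⟨v, w, rfl, rfl⟩), apply_ite (quo k n hn),
    map_zero]

theorem vtx_mul_self (v : TriV 2 2 n) : vtx k n hn v * vtx k n hn v = vtx k n hn v := by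
  rw [vtx_mul_vtx, if_pos rfl]

theorem vtx_mul_of_ne {v w : TriV 2 2 n} (h : v ≠ w) : vtx k n hn v * vtx k n hn w = 0 := by
  rw [vtx_mul_vtx, if_neg h]

theorem sum_vtx [NeZero n] : ∑ v, vtx k n hn v = 1 := by
  rw [← map_one (quo k n hn), ← quo_rel k n hn (Or.inr (Or.inl ⟨rfl, rfl⟩)), map_sum]
  rfl

theorem src_mul_arr (a : TriE 2 2 n) :
    vtx k n hn (triSrc 2 2 n a) * arr k n hn a = arr k n hn a := by
  have : NeZero n := ⟨hn.ne'⟩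
  rw [arr, vtx, ← map_mul, quo_rel k n hn (Or.inr (Or.inr (Or.inl ⟨a, rfl, rfl⟩)))]

theorem arr_mul_tgt (a : TriE 2 2 n) :
    arr k n hn a * vtx k n hn (triTgt 2 2 n a) = arr k n hn a := by
  have : NeZero n := ⟨hn.ne'⟩
  rw [arr, vtx, ← map_mul, quo_rel k n hn (Or.inr (Or.inr (Or.inr (Or.inl ⟨a, rfl, rfl⟩))))]

theorem vtx_mul_arr_of_ne {v : TriV 2 2 n} {a : TriE 2 2 n} (h : v ≠ triSrc 2 2 n a) :
    vtx k n hn v * arr k n hn a = 0 := by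
  rw [← src_mul_arr, ← mul_assoc, vtx_mul_of_ne k n hn h, zero_mul]

theorem arr_mul_vtx_of_ne {v : TriV 2 2 n} {a : TriE 2 2 n} (h : triTgt 2 2 n a ≠ v) :
    arr k n hn a * vtx k n hn v = 0 := by
  rw [← arr_mul_tgt, mul_assoc, vtx_mul_of_ne k n hn h, mul_zero]

/-- The sum of the arrows of the third cycle. -/
def gam [NeZero n] : GamAlg k n hn := ∑ l : ZMod n, arr k n hn (Sum.inr (Sum.inr l))

variable [NeZero n]

theorem vtx_mul_gam (l : ZMod n) :
    vtx k n hn (triV3 2 2 n l) * gam k n hn = arr k n hn (Sum.inr (Sum.inr l)) := by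
  rw [gam, Finset.mul_sum, Finset.sum_eq_single l]
  · exact src_mul_arr k n hn (Sum.inr (Sum.inr l))
  · intro i _ hi
    exact vtx_mul_arr_of_ne k n hn fun h => hi (triV3_injective 2 2 n h).symm
  · exact fun h => absurd (Finset.mem_univ l) h

theorem gam_mul_vtx (l : ZMod n) :
    gam k n hn * vtx k n hn (triV3 2 2 n (l + 1)) = arr k n hn (Sum.inr (Sum.inr l)) := by
  rw [gam, Finset.sum_mul, Finset.sum_eq_single l]
  · exact arr_mul_tgt k n hn (Sum.inr (Sum.inr l))
  · intro i _ hi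
    exact arr_mul_vtx_of_ne k n hn fun h => hi (add_right_cancel (triV3_injective 2 2 n h))
  · exact fun h => absurd (Finset.mem_univ l) h

theorem vtx_gam_comm (l : ZMod n) :
    vtx k n hn (triV3 2 2 n l) * gam k n hn = gam k n hn * vtx k n hn (triV3 2 2 n (l + 1)) := by
  rw [vtx_mul_gam, gam_mul_vtx]

theorem vtx_mul_gam_of_ne {v : TriV 2 2 n} (h : ∀ l, triV3 2 2 n l ≠ v) :
    vtx k n hn v * gam k n hn = 0 := by
  rw [gam, Finset.mul_sum]
  exact Finset.sum_eq_zero fun l _ => vtx_mul_arr_of_ne k n hn (h l).symm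

theorem gam_mul_vtx_of_ne {v : TriV 2 2 n} (h : ∀ l, triV3 2 2 n l ≠ v) :
    gam k n hn * vtx k n hn v = 0 := by
  rw [gam, Finset.sum_mul]
  exact Finset.sum_eq_zero fun l _ => arr_mul_vtx_of_ne k n hn (h _)

theorem vtx_mul_gam_pow (l : ZMod n) (m : ℕ) :
    vtx k n hn (triV3 2 2 n l) * gam k n hn ^ m =
      gam k n hn ^ m * vtx k n hn (triV3 2 2 n (l + m)) :=
  mul_pow_shift (vtx_gam_comm k n hn) m l

omit [NeZero n] in
theorem quo_arrWord_append (w w' : List (TriE 2 2 n)) :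
    quo k n hn (arrWord k (w ++ w')) = quo k n hn (arrWord k w) * quo k n hn (arrWord k w') := by
  rw [← map_mul, arrWord, List.map_append, List.prod_append]
  rfl

omit [NeZero n] in
theorem quo_arrWord_singleton (a : TriE 2 2 n) : quo k n hn (arrWord k [a]) = arr k n hn a :=
  congrArg _ List.prod_singleton

omit [NeZero n] in
theorem arr_mul_arr (a b : TriE 2 2 n) :
    arr k n hn a * arr k n hn b = quo k n hn (arrWord k [a, b]) := by
  rw [← quo_arrWord_singleton, ← quo_arrWord_singleton, ← quo_arrWord_append]
  rfl

omit [NeZero n] in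
theorem tgw_succ (st m : ℕ) : tgw 2 2 n st (m + 1) =
    tgw 2 2 n st m ++ ([Sum.inr (Sum.inr ((st + m : ℕ) : ZMod n))] : List (TriE 2 2 n)) :=
  (congrArg _ List.range_succ).trans List.map_append

theorem quo_tgw (st m : ℕ) : quo k n hn (arrWord k (tgw 2 2 n st (m + 1))) =
    vtx k n hn (triV3 2 2 n st) * gam k n hn ^ (m + 1) := by
  induction m with
  | zero =>
    rw [zero_add, pow_one, vtx_mul_gam]
    exact quo_arrWord_singleton k n hn _
  | succ m ih =>
    have h : quo k n hn (arrWord k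
        ([Sum.inr (Sum.inr ((st + (m + 1) : ℕ) : ZMod n))] : List (TriE 2 2 n))) =
        vtx k n hn (triV3 2 2 n ((st + (m + 1) : ℕ) : ZMod n)) * gam k n hn :=
      (quo_arrWord_singleton k n hn _).trans (vtx_mul_gam k n hn _).symm
    rw [tgw_succ, quo_arrWord_append, ih, h, Nat.cast_add, mul_assoc, ← mul_assoc (gam k n hn ^ (m + 1)),
      ← vtx_mul_gam_pow, ← mul_assoc, ← mul_assoc, vtx_mul_self, mul_assoc, ← pow_succ]

theorem quo_tgw_of_pos (st : ℕ) {m : ℕ} (hm : 0 < m) : quo k n hn (arrWord k (tgw 2 2 n st m)) =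
    vtx k n hn (triV3 2 2 n st) * gam k n hn ^ m := by
  obtain ⟨m, rfl⟩ := Nat.exists_eq_succ_of_ne_zero hm.ne'
  exact quo_tgw k n hn st m

theorem vtx_gam_pow_mul {l l' : ZMod n} {m : ℕ} (h : l + m = l') (m' : ℕ) :
    vtx k n hn (triV3 2 2 n l) * gam k n hn ^ m * (vtx k n hn (triV3 2 2 n l') * gam k n hn ^ m') =
      vtx k n hn (triV3 2 2 n l) * gam k n hn ^ (m + m') := by
  rw [mul_assoc, ← mul_assoc (gam k n hn ^ m), ← h, ← vtx_mul_gam_pow, ← mul_assoc, ← mul_assoc,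
    vtx_mul_self, mul_assoc, ← pow_add]

theorem quo_tgw_tgw : quo k n hn (arrWord k (tgw 2 2 n 0 n ++ tgw 2 2 n 0 n)) =
    vtx k n hn (triV3 2 2 n 0) * gam k n hn ^ (2 * n) := by
  rw [quo_arrWord_append, quo_tgw_of_pos k n hn 0 hn, Nat.cast_zero,
    vtx_gam_pow_mul k n hn (by simp), two_mul]

/-- The standard generators of `Γ(n)`. -/
def gens : GamGens k n (GamAlg k n hn) := by
  have a1_a2 : arr k n hn (Sum.inl 0) * arr k n hn (Sum.inl 1) =
      vtx k n hn (triV3 2 2 n 0) * gam k n hn ^ (2 * n) :=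
    (arr_mul_arr k n hn _ _).trans
      ((quo_extra k n hn (Or.inl ⟨rfl, rfl⟩)).trans (quo_tgw_tgw k n hn))
  have b1_b2 : arr k n hn (Sum.inr (Sum.inl 0)) * arr k n hn (Sum.inr (Sum.inl 1)) =
      vtx k n hn (triV3 2 2 n 0) * gam k n hn ^ (2 * n) :=
    (arr_mul_arr k n hn _ _).trans
      ((quo_extra k n hn (Or.inr (Or.inl ⟨rfl, rfl⟩))).trans (quo_tgw_tgw k n hn))
  have a2_e0 : arr k n hn (Sum.inl 1) * vtx k n hn (triV3 2 2 n 0) = arr k n hn (Sum.inl 1) := by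
    rw [triV3_zero]
    exact arr_mul_tgt k n hn (Sum.inl 1)
  have b2_e0 : arr k n hn (Sum.inr (Sum.inl 1)) * vtx k n hn (triV3 2 2 n 0) =
      arr k n hn (Sum.inr (Sum.inl 1)) := by
    rw [triV3_zero]
    exact arr_mul_tgt k n hn (Sum.inr (Sum.inl 1))
  have e0_a1 : vtx k n hn (triV3 2 2 n 0) * arr k n hn (Sum.inl 0) = arr k n hn (Sum.inl 0) := by
    rw [triV3_zero]
    exact src_mul_arr k n hn (Sum.inl 0)
  have e0_b1 : vtx k n hn (triV3 2 2 n 0) * arr k n hn (Sum.inr (Sum.inl 0)) =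
      arr k n hn (Sum.inr (Sum.inl 0)) := by
    rw [triV3_zero]
    exact src_mul_arr k n hn (Sum.inr (Sum.inl 0))
  have a2_G : arr k n hn (Sum.inl 1) * gam k n hn = 0 := by
    have h := quo_extra k n hn (Or.inr (Or.inr (Or.inl ⟨rfl, rfl⟩)))
    rw [quo_arrWord_append, quo_tgw_of_pos k n hn 0 one_pos, pow_one, map_zero, Nat.cast_zero,
      ← mul_assoc] at h
    have h' : quo k n hn (arrWord k (taw 2 2 n 1 1)) = arr k n hn (Sum.inl 1) :=
      quo_arrWord_singleton k n hn _
    rwa [h', a2_e0] at h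
  have b2_G : arr k n hn (Sum.inr (Sum.inl 1)) * gam k n hn = 0 := by
    have h := quo_extra k n hn (Or.inr (Or.inr (Or.inr (Or.inl ⟨rfl, rfl⟩))))
    rw [quo_arrWord_append, quo_tgw_of_pos k n hn 0 one_pos, pow_one, map_zero, Nat.cast_zero,
      ← mul_assoc] at h
    have h' : quo k n hn (arrWord k (tbw 2 2 n 1 1)) = arr k n hn (Sum.inr (Sum.inl 1)) :=
      quo_arrWord_singleton k n hn _
    rwa [h', b2_e0] at h
  have hn1 : ((n - 1 : ℕ) : ZMod n) + 1 = 0 := by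
    rw [Nat.cast_sub hn, ZMod.natCast_self]
    simp
  have G_a1 : gam k n hn * arr k n hn (Sum.inl 0) = 0 := by
    have h := quo_extra k n hn (Or.inr (Or.inr (Or.inr (Or.inr (Or.inl ⟨rfl, rfl⟩)))))
    rw [quo_arrWord_append, quo_tgw_of_pos k n hn _ one_pos, pow_one, map_zero, vtx_gam_comm, hn1,
      mul_assoc] at h
    have h' : quo k n hn (arrWord k (taw 2 2 n 0 1)) = arr k n hn (Sum.inl 0) :=
      quo_arrWord_singleton k n hn _
    rwa [h', e0_a1] at h
  have G_b1 : gam k n hn * arr k n hn (Sum.inr (Sum.inl 0)) = 0 := by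
    have h := quo_extra k n hn (Or.inr (Or.inr (Or.inr (Or.inr (Or.inr (Or.inl ⟨rfl, rfl⟩))))))
    rw [quo_arrWord_append, quo_tgw_of_pos k n hn _ one_pos, pow_one, map_zero, vtx_gam_comm, hn1,
      mul_assoc] at h
    have h' : quo k n hn (arrWord k (tbw 2 2 n 0 1)) = arr k n hn (Sum.inr (Sum.inl 0)) :=
      quo_arrWord_singleton k n hn _
    rwa [h', e0_b1] at h
  have a2_b1 : arr k n hn (Sum.inl 1) * arr k n hn (Sum.inr (Sum.inl 0)) = 0 := by
    have h := quo_extra k n hn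
      (Or.inr (Or.inr (Or.inr (Or.inr (Or.inr (Or.inr (Or.inl ⟨rfl, rfl⟩)))))))
    rw [map_zero] at h
    exact (arr_mul_arr k n hn _ _).trans h
  have b2_a1 : arr k n hn (Sum.inr (Sum.inl 1)) * arr k n hn (Sum.inl 0) = 0 := by
    have h := quo_extra k n hn
      (Or.inr (Or.inr (Or.inr (Or.inr (Or.inr (Or.inr (Or.inr (Or.inl ⟨rfl, rfl⟩))))))))
    rw [map_zero] at h
    exact (arr_mul_arr k n hn _ _).trans h
  have e_G_pow : ∀ l, vtx k n hn (triV3 2 2 n l) * gam k n hn ^ (2 * n + 1) = 0 := by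
    intro l
    have hl : ((l.val : ℕ) : ZMod n) = l := ZMod.natCast_zmod_val l
    have hlt := l.val_lt
    by_cases h0 : l = 0
    · rw [h0, pow_succ, ← mul_assoc, ← a1_a2, mul_assoc, a2_G, mul_zero]
    by_cases h1 : l.val + 1 = n
    · have hl1 : l + 1 = 0 := by
        rw [← hl, ← Nat.cast_succ, Nat.succ_eq_add_one, h1, ZMod.natCast_self]
      rw [pow_succ', ← mul_assoc, vtx_gam_comm, hl1, mul_assoc, ← a1_a2, ← mul_assoc, G_a1,
        zero_mul]
    · have hpos : l.val ≠ 0 := fun h => h0 ((ZMod.val_eq_zero l).1 h)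
      have h := quo_extra k n hn (Or.inr (Or.inr (Or.inr (Or.inr (Or.inr (Or.inr (Or.inr (Or.inr
        ⟨l.val + 1, by omega, by omega, rfl, rfl⟩))))))))
      rw [quo_arrWord_append, quo_arrWord_append, quo_tgw_of_pos k n hn _ (by omega),
        quo_tgw_of_pos k n hn _ hn, quo_tgw_of_pos k n hn _ (by omega), map_zero, Nat.cast_zero,
        vtx_gam_pow_mul, vtx_gam_pow_mul, Nat.add_sub_cancel, hl] at h
      · rw [← h]
        congr 2
        omega
      · rw [← Nat.cast_add]
        exact (ZMod.natCast_eq_zero_iff _ n).2 ⟨2, by omega⟩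
      · rw [← Nat.cast_add]
        exact (ZMod.natCast_eq_zero_iff _ n).2 ⟨1, by omega⟩
  exact
  { e := fun l => vtx k n hn (triV3 2 2 n l)
    ea := vtx k n hn (triV1 2 2 n 1)
    eb := vtx k n hn (triV2 2 2 n 1)
    a1 := arr k n hn (Sum.inl 0)
    a2 := arr k n hn (Sum.inl 1)
    b1 := arr k n hn (Sum.inr (Sum.inl 0))
    b2 := arr k n hn (Sum.inr (Sum.inl 1))
    G := gam k n hn
    e_e := fun l m => by
      rw [vtx_mul_vtx]
      exact if_congr (triV3_injective 2 2 n).eq_iff rfl rfl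
    ea_ea := vtx_mul_self k n hn _
    eb_eb := vtx_mul_self k n hn _
    e_ea := fun l => vtx_mul_of_ne k n hn (triV3_ne_triV1 2 2 n l)
    ea_e := fun l => vtx_mul_of_ne k n hn (triV3_ne_triV1 2 2 n l).symm
    e_eb := fun l => vtx_mul_of_ne k n hn (triV3_ne_triV2 2 2 n l)
    eb_e := fun l => vtx_mul_of_ne k n hn (triV3_ne_triV2 2 2 n l).symm
    ea_eb := vtx_mul_of_ne k n hn (triV1_ne_triV2 2 2 n)
    eb_ea := vtx_mul_of_ne k n hn (triV1_ne_triV2 2 2 n).symm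
    sum_eq := by
      rw [← sum_vtx k n hn, ← (vertexMap_bijective n).sum_comp, Fintype.sum_sum_type,
        Fintype.sum_bool, add_assoc, add_comm (vtx k n hn (triV1 2 2 n 1))]
      rfl
    e_G := vtx_gam_comm k n hn
    ea_G := vtx_mul_gam_of_ne k n hn (triV3_ne_triV1 2 2 n)
    G_ea := gam_mul_vtx_of_ne k n hn (triV3_ne_triV1 2 2 n)
    eb_G := vtx_mul_gam_of_ne k n hn (triV3_ne_triV2 2 2 n)
    G_eb := gam_mul_vtx_of_ne k n hn (triV3_ne_triV2 2 2 n)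
    e0_a1 := e0_a1
    a1_ea := arr_mul_tgt k n hn (Sum.inl 0)
    ea_a2 := src_mul_arr k n hn (Sum.inl 1)
    a2_e0 := a2_e0
    e0_b1 := e0_b1
    b1_eb := arr_mul_tgt k n hn (Sum.inr (Sum.inl 0))
    eb_b2 := src_mul_arr k n hn (Sum.inr (Sum.inl 1))
    b2_e0 := b2_e0
    G_a1 := G_a1
    G_b1 := G_b1
    a2_G := a2_G
    b2_G := b2_G
    a2_b1 := a2_b1
    b2_a1 := b2_a1
    a1_a2 := a1_a2
    b1_b2 := b1_b2
    G_pow := by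
      have h : gam k n hn = ∑ l, vtx k n hn (triV3 2 2 n l) * gam k n hn :=
        Finset.sum_congr rfl fun l _ => (vtx_mul_gam k n hn l).symm
      rw [pow_succ']
      nth_rewrite 1 [h]
      rw [Finset.sum_mul]
      refine Finset.sum_eq_zero fun l _ => ?_
      rw [mul_assoc, ← pow_succ', e_G_pow]
    eq_top := by
      intro M h1 he hea heb ha1 ha2 hb1 hb2 hG
      have two : ∀ i : ZMod 2, i = 0 ∨ i = 1 := by decide
      have key : ∀ x, ∀ m ∈ M, m * quo k n hn x ∈ M := by
        intro x
        induction x using FreeAlgebra.induction with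
        | grade0 c =>
          intro m hm
          rw [AlgHom.commutes, ← Algebra.commutes, ← Algebra.smul_def]
          exact M.smul_mem c hm
        | grade1 y =>
          intro m hm
          rcases y with v | i | i | l
          · obtain ⟨l | _ | _, rfl⟩ := (vertexMap_bijective n).2 v
            · exact he l m hm
            · exact hea m hm
            · exact heb m hm
          · rcases two i with rfl | rfl
            · exact ha1 m hm
            · exact ha2 m hm
          · rcases two i with rfl | rfl
            · exact hb1 m hm
            · exact hb2 m hm
          · show m * arr k n hn (Sum.inr (Sum.inr l)) ∈ M
            rw [← vtx_mul_gam, ← mul_assoc]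
            exact hG _ (he l m hm)
        | mul x y hx hy =>
          intro m hm
          rw [map_mul, ← mul_assoc]
          exact hy _ (hx m hm)
        | add x y hx hy =>
          intro m hm
          rw [map_add, mul_add]
          exact M.add_mem (hx m hm) (hy m hm)
      refine eq_top_iff.2 fun a _ => ?_
      obtain ⟨x, rfl⟩ := quo_surjective k n hn a
      simpa using key x 1 h1 }

end GamAlg
end Presentation

/-- For every `n ≥ 1`, the algebra `Γ(n)` is τ-tilting finite. -/
theorem statement15 (k : Type) [Field k] [IsAlgClosed k]
    (n : ℕ) (hn : 1 ≤ n) :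
    TauTiltingFinite k (GamAlg k n hn) := by
  have : NeZero n := ⟨by omega⟩
  exact (GamAlg.gens k n hn).tauTiltingFinite

end
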